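/- Let G be a connected reduced graph of order n, and let H be a spanning bipartite subgraph of G with bipartition {X, Y} such that |Y| ≥ |X| and every vertex v ∈ Y has degree d_H(v) ≥ 3 in H. If |X| ≤ (n + 5)/3, then G = H (i.e., E(G) = E(H)) and F(G) = 3. -/

import Mathlib

open scoped Classical

/-- A finite loopless multigraph on vertex type `V`, given by a multiset of edges. -/
structure Multigraph (V : Type) where
  edges : Multiset (Sym2 V)
  loopless : ∀ e ∈ edges, ¬ e.IsDiag

namespace Multigraph

variable {V W : Type}

/-- The degree of a vertex with respect to a multiset of edges. -/
noncomputable def degIn (E : Multiset (Sym2 V)) (v : V) : ℕ :=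
  Multiset.card (E.filter fun e => v ∈ e)

/-- The degree of a vertex in a multigraph. -/
noncomputable def deg (G : Multigraph V) (v : V) : ℕ :=
  degIn G.edges v

/-- All endpoints of the edges in `E` lie in `S`. -/
def Within (S : Set V) (E : Multiset (Sym2 V)) : Prop :=
  ∀ e ∈ E, ∀ v ∈ e, v ∈ S

/-- The graph with vertex set `S` and edge multiset `E` is connected (and spans `S`). -/
def ConnOn (S : Set V) (E : Multiset (Sym2 V)) : Prop :=
  S.Nonempty ∧ Within S E ∧
    ∀ u ∈ S, ∀ v ∈ S, Relation.ReflTransGen (fun a b => s(a, b) ∈ E) u v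

/-- The graph with vertex set `S` and edge multiset `E` is collapsible: for every even subset
`R` of `S` there is a spanning connected subgraph whose set of odd-degree vertices is `R`. -/
def CollapsiblePair (S : Set V) (E : Multiset (Sym2 V)) : Prop :=
  S.Nonempty ∧ Within S E ∧
    ∀ R : Set V, R ⊆ S → R.Finite → Even R.ncard →
      ∃ E' ≤ E, ConnOn S E' ∧ ∀ x ∈ S, (Odd (degIn E' x) ↔ x ∈ R)

/-- `(S, E)` is a subgraph of `G`. -/
def IsSubpair (G : Multigraph V) (S : Set V) (E : Multiset (Sym2 V)) : Prop :=
  E ≤ G.edges ∧ Within S E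

/-- A multigraph is reduced if it has no collapsible subgraph with more than one vertex. -/
def Reduced (G : Multigraph V) : Prop :=
  ∀ S E, G.IsSubpair S E → CollapsiblePair S E → S.ncard ≤ 1

/-- `(S, E)` is a maximal collapsible subgraph of `G`. -/
def MaxCollapsibleSub (G : Multigraph V) (S : Set V) (E : Multiset (Sym2 V)) : Prop :=
  G.IsSubpair S E ∧ CollapsiblePair S E ∧
    ∀ S' E', G.IsSubpair S' E' → CollapsiblePair S' E' → S ⊆ S' → E ≤ E' → S' = S ∧ E' = E

/-- `(S, E)` is a nontrivial maximal collapsible subgraph of `G`. -/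
def NontrivMaxCollapsible (G : Multigraph V) (S : Set V) (E : Multiset (Sym2 V)) : Prop :=
  G.MaxCollapsibleSub S E ∧ 1 < S.ncard

/-- The multiset of edges of `G` with both ends in `S`. -/
noncomputable def inducedEdges (G : Multigraph V) (S : Set V) : Multiset (Sym2 V) :=
  G.edges.filter fun e => ∀ v ∈ e, v ∈ S

/-- `S` is the vertex set of a maximal collapsible subgraph of `G`. -/
def IsMaxCollapsibleSet (G : Multigraph V) (S : Set V) : Prop :=
  CollapsiblePair S (G.inducedEdges S) ∧
    ∀ T : Set V, S ⊆ T → CollapsiblePair T (G.inducedEdges T) → T = S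

/-- `G'` (on vertex type `W`) is the reduction of `G`, witnessed by the contraction map `f`:
the fibres of `f` are exactly the (vertex sets of the) maximal collapsible subgraphs of `G`,
and the edges of `G'` are obtained by contracting each fibre to a point and deleting the
resulting loops. -/
def IsReduction (G : Multigraph V) (f : V → W) (G' : Multigraph W) : Prop :=
  Function.Surjective f ∧ (∀ w : W, G.IsMaxCollapsibleSet (f ⁻¹' {w})) ∧
    G'.edges = (G.edges.map (Sym2.map f)).filter fun e => ¬ e.IsDiag

/-- A multigraph is supereulerian if it has a spanning connected subgraph in which every
vertex has even degree. -/
def Supereulerian (G : Multigraph V) : Prop :=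
  ∃ E' ≤ G.edges, ConnOn Set.univ E' ∧ ∀ x : V, Even (degIn E' x)

/-- A multigraph is connected. -/
def Connected (G : Multigraph V) : Prop :=
  ConnOn Set.univ G.edges

/-- A multigraph is 3-edge-connected (edge connectivity at least 3): removing any at most two
edges leaves a spanning connected graph. -/
def ThreeEdgeConnected (G : Multigraph V) : Prop :=
  ∀ F : Multiset (Sym2 V), F ≤ G.edges → Multiset.card F ≤ 2 →
    ConnOn Set.univ (G.edges - F)

/-- A spanning tree: spanning connected with `|V| - 1` edges. -/
def IsSpanningTree [Fintype V] (E : Multiset (Sym2 V)) : Prop :=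
  ConnOn Set.univ E ∧ Multiset.card E = Fintype.card V - 1

/-- The edge multiset `E` contains two edge-disjoint spanning trees. -/
def HasTwoDisjointSpanningTrees [Fintype V] (E : Multiset (Sym2 V)) : Prop :=
  ∃ T₁ T₂ : Multiset (Sym2 V), T₁ + T₂ ≤ E ∧ IsSpanningTree T₁ ∧ IsSpanningTree T₂

/-- `F(G)`: the minimum number of extra (loopless) edges whose addition to `G` produces a
spanning supergraph having two edge-disjoint spanning trees. -/
noncomputable def FVal [Fintype V] (G : Multigraph V) : ℕ :=
  sInf {k : ℕ | ∃ Eadd : Multiset (Sym2 V), (∀ e ∈ Eadd, ¬ e.IsDiag) ∧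
    Multiset.card Eadd = k ∧ HasTwoDisjointSpanningTrees (G.edges + Eadd)}

/-- `σ̄₂(G)`: the minimum of `deg u + deg v` over edges `uv` of `G`. -/
noncomputable def sigma2bar (G : Multigraph V) : ℕ :=
  sInf {k : ℕ | ∃ u v : V, s(u, v) ∈ G.edges ∧ G.deg u + G.deg v = k}

/-- `G` contains a cycle of length four. -/
def HasFourCycle (G : Multigraph V) : Prop :=
  ∃ a b c d : V, a ≠ b ∧ a ≠ c ∧ a ≠ d ∧ b ≠ c ∧ b ≠ d ∧ c ≠ d ∧
    s(a, b) ∈ G.edges ∧ s(b, c) ∈ G.edges ∧ s(c, d) ∈ G.edges ∧ s(d, a) ∈ G.edges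

/-- `M` is a matching: distinct edges share no endpoint. -/
def IsMatching (M : Multiset (Sym2 V)) : Prop :=
  M.Nodup ∧ ∀ e ∈ M, ∀ f ∈ M, e ≠ f → ∀ x : V, x ∈ e → x ∉ f

/-- `{X, Y}` is a bipartition (of the full vertex set) for the edge multiset `E`:
every edge has one end in `X` and one end in `Y`. -/
def IsBipartition [Fintype V] (X Y : Finset V) (E : Multiset (Sym2 V)) : Prop :=
  Disjoint X Y ∧ X ∪ Y = Finset.univ ∧
    ∀ e ∈ E, (∃ a ∈ e, a ∈ X) ∧ (∃ b ∈ e, b ∈ Y)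

/-- The edge multiset of Catlin's π-reduction `G/π` obtained from the induced four-cycle
`u v z w`: remove the four cycle edges, identify `z` with `u` (forming `x = u`) and `w` with
`v` (forming `y = v`), and add the new edge `e_π = xy = s(u, v)`. -/
noncomputable def piEdges (G : Multigraph V) (u v z w : V) : Multiset (Sym2 V) :=
  ((G.edges - {s(u, v), s(v, z), s(z, w), s(w, u)}).map
      (Sym2.map fun a => if a = z then u else if a = w then v else a)) + {s(u, v)}

/-- `(S, E)` is the multigraph `Φ(c, t)`: a star `K_{1,t}` with centre `c` in which every
edge is doubled. -/
def IsPhi (S : Set V) (E : Multiset (Sym2 V)) (c : V) (t : ℕ) : Prop :=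
  ∃ A : Finset V, c ∉ A ∧ A.card = t ∧ S = insert c (↑A : Set V) ∧
    E = A.val.map (fun a => s(c, a)) + A.val.map (fun a => s(c, a))

/-- The multigraph associated with a simple graph. -/
noncomputable def ofSimple [Fintype V] (G : SimpleGraph V) : Multigraph V where
  edges := G.edgeSet.toFinset.val
  loopless := by
    intro e he
    have he' : e ∈ G.edgeSet := by simpa using he
    exact G.not_isDiag_of_mem_edgeSet he'

/-- Isomorphism of multigraphs. -/
def MIso {A B : Type} (G : Multigraph A) (H : Multigraph B) : Prop :=
  ∃ φ : A ≃ B, H.edges = G.edges.map (Sym2.map φ)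

end Multigraph

/-- Vertices of the Petersen graph: the 2-element subsets of a 5-element set. -/
abbrev PetersenVert : Type := {s : Finset (Fin 5) // s.card = 2}

/-- The Petersen graph (as the Kneser graph on 2-subsets of a 5-set). -/
def petersenSimple : SimpleGraph PetersenVert :=
  SimpleGraph.fromRel fun a b => Disjoint a.1 b.1

noncomputable def petersen : Multigraph PetersenVert :=
  Multigraph.ofSimple petersenSimple

/-- The graph `P₁₄`: obtained from the Petersen graph (outer cycle `0 1 2 3 4`, spokes
`i — i+5`, inner cycle `5 7 9 6 8 5`) by replacing the vertex `9` (whose neighbours were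
`4`, `7`, `6`) by a copy of `K_{2,3}` with degree-three vertices `9`, `10` and degree-two
vertices `11`, `12`, `13`, joined to `4`, `7`, `6` respectively. -/
def p14Simple : SimpleGraph (Fin 14) :=
  SimpleGraph.fromRel fun a b =>
    (a, b) ∈ ([(0, 1), (1, 2), (2, 3), (3, 4), (4, 0), (0, 5), (1, 6), (2, 7), (3, 8),
      (5, 7), (6, 8), (8, 5), (9, 11), (9, 12), (9, 13), (10, 11), (10, 12), (10, 13),
      (11, 4), (12, 7), (13, 6)] : List (Fin 14 × Fin 14))

noncomputable def p14 : Multigraph (Fin 14) :=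
  Multigraph.ofSimple p14Simple

set_option linter.unusedSectionVars false

namespace RG

/-- Matroid-type rank function. -/
structure IsRk {α : Type} [DecidableEq α] (r : Finset α → ℤ) : Prop where
  empty : r ∅ = 0
  mono : ∀ A B, A ⊆ B → r A ≤ r B
  sub : ∀ A B, r (A ∪ B) + r (A ∩ B) ≤ r A + r B
  inc : ∀ e A, r (insert e A) ≤ r A + 1

theorem IsRk.contract {α : Type} [DecidableEq α] {r : Finset α → ℤ} (h : IsRk r) (e : α) (he : r {e} = 1) :
    IsRk (fun A => r (insert e A) - 1) where
  empty := by simp [he]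
  mono A B hAB := by
    have := h.mono _ _ (Finset.insert_subset_insert e hAB)
    omega
  sub A B := by
    have := h.sub (insert e A) (insert e B)
    rw [← Finset.insert_union_distrib, ← Finset.insert_inter_distrib] at this
    omega
  inc f A := by
    have := h.inc f (insert e A)
    rw [Finset.insert_comm] at this
    omega

theorem munion {α : Type} [DecidableEq α] : ∀ (n : ℕ) (E : Finset α) (r1 r2 : Finset α → ℤ), E.card = n →
    IsRk r1 → IsRk r2 → (∀ A ⊆ E, (A.card : ℤ) ≤ r1 A + r2 A) →
    ∃ I1 I2, I1 ∪ I2 = E ∧ Disjoint I1 I2 ∧ r1 I1 = I1.card ∧ r2 I2 = I2.card := by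
  intro n
  induction n with
  | zero =>
    intro E r1 r2 hE h1 h2 _
    rw [Finset.card_eq_zero] at hE
    subst hE
    exact ⟨∅, ∅, by simp, by simp, by simp [h1.empty], by simp [h2.empty]⟩
  | succ n ih =>
    intro E r1 r2 hE h1 h2 hA
    obtain ⟨e, he⟩ : E.Nonempty := by rw [← Finset.card_pos]; omega
    -- a generic statement, used twice
    have key : ∀ (r1 r2 : Finset α → ℤ), IsRk r1 → IsRk r2 →
        (∀ A ⊆ E, (A.card : ℤ) ≤ r1 A + r2 A) →
        (∀ A ⊆ E.erase e, (A.card : ℤ) + 1 ≤ r1 (insert e A) + r2 A) →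
        ∃ I1 I2, I1 ∪ I2 = E ∧ Disjoint I1 I2 ∧ r1 I1 = I1.card ∧ r2 I2 = I2.card := by
      intro r1 r2 h1 h2 hA hc
      have he1 : r1 {e} = 1 := by
        have a := hc ∅ (by simp)
        have b := h1.inc e ∅
        simp [h1.empty, h2.empty] at a b
        omega
      obtain ⟨I1, I2, hu, hd, hr1, hr2⟩ := ih (E.erase e) _ r2 (by
        rw [Finset.card_erase_of_mem he]; omega) (h1.contract e he1) h2 (by
        intro A hAE
        have := hc A hAE
        omega)
      have heI1 : e ∉ I1 := fun h => by
        have : e ∈ E.erase e := hu ▸ Finset.mem_union_left _ h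
        simp at this
      have heI2 : e ∉ I2 := fun h => by
        have : e ∈ E.erase e := hu ▸ Finset.mem_union_right _ h
        simp at this
      refine ⟨insert e I1, I2, ?_, ?_, ?_, hr2⟩
      · rw [Finset.insert_union, hu, Finset.insert_erase he]
      · rw [Finset.disjoint_insert_left]; exact ⟨heI2, hd⟩
      · rw [Finset.card_insert_of_notMem heI1]; push_cast; omega
    by_cases c1 : ∀ A ⊆ E.erase e, (A.card : ℤ) + 1 ≤ r1 (insert e A) + r2 A
    · exact key r1 r2 h1 h2 hA c1
    by_cases c2 : ∀ A ⊆ E.erase e, (A.card : ℤ) + 1 ≤ r2 (insert e A) + r1 A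
    · obtain ⟨I2, I1, hu, hd, a, b⟩ := key r2 r1 h2 h1 (fun A h => by rw [add_comm]; exact hA A h) c2
      exact ⟨I1, I2, by rw [Finset.union_comm, hu], hd.symm, b, a⟩
    exfalso
    push Not at c1 c2
    obtain ⟨A, hAE, hA1⟩ := c1
    obtain ⟨B, hBE, hB1⟩ := c2
    have hsubE : E.erase e ⊆ E := Finset.erase_subset _ _
    have a1 := hA A (hAE.trans hsubE)
    have b1 := hA B (hBE.trans hsubE)
    have a2 := h1.mono A (insert e A) (Finset.subset_insert _ _)
    have b2 := h2.mono B (insert e B) (Finset.subset_insert _ _)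
    have i1 := hA (A ∩ B) ((Finset.inter_subset_left.trans hAE).trans hsubE)
    have u1 := hA (insert e (A ∪ B)) (Finset.insert_subset he
      ((Finset.union_subset hAE hBE).trans hsubE))
    have heAB : e ∉ A ∪ B := fun h => by
      have := (Finset.union_subset hAE hBE) h
      simp at this
    rw [Finset.card_insert_of_notMem heAB] at u1
    have cc := Finset.card_union_add_card_inter A B
    have s1 := h1.sub (insert e A) B
    have s2 := h2.sub A (insert e B)
    rw [Finset.insert_union] at s1
    rw [Finset.union_insert] at s2
    have m1 := h1.mono (A ∩ B) (insert e A ∩ B) (Finset.inter_subset_inter_right (Finset.subset_insert _ _))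
    have m2 := h2.mono (A ∩ B) (A ∩ insert e B) (Finset.inter_subset_inter_left (Finset.subset_insert _ _))
    push_cast at u1
    omega

end RG

namespace RG
variable {V : Type} [Fintype V]

/-- potentials that are constant along the edges of `A` -/
def Pot (A : Finset (Sym2 V)) : Submodule (ZMod 2) (V → ZMod 2) where
  carrier := {φ | ∀ a b, s(a, b) ∈ A → φ a = φ b}
  add_mem' := by
    intro f g hf hg a b h
    simp [hf a b h, hg a b h]
  zero_mem' := by intro a b _; rfl
  smul_mem' := by
    intro c f hf a b h
    simp [hf a b h]

theorem mem_Pot {A : Finset (Sym2 V)} {φ : V → ZMod 2} :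
    φ ∈ Pot A ↔ ∀ a b, s(a, b) ∈ A → φ a = φ b := Iff.rfl

theorem Pot_anti {A B : Finset (Sym2 V)} (h : A ⊆ B) : Pot B ≤ Pot A :=
  fun _ hφ a b hab => hφ a b (h hab)

/-- graphic rank -/
noncomputable def rk (A : Finset (Sym2 V)) : ℤ :=
  (Fintype.card V : ℤ) - Module.finrank (ZMod 2) (Pot A)

theorem rk_isRk : IsRk (rk (V := V)) where
  empty := by
    have : Pot (∅ : Finset (Sym2 V)) = ⊤ := by
      rw [eq_top_iff]; intro φ _ a b h; simp at h
    rw [rk, this]; simp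
  mono A B h := by
    have := Submodule.finrank_mono (Pot_anti h)
    unfold rk; omega
  sub A B := by
    have h := Submodule.finrank_sup_add_finrank_inf_eq (Pot A) (Pot B)
    have h1 : Pot A ⊓ Pot B ≤ Pot (A ∪ B) := by
      rintro φ ⟨h1, h2⟩ a b hab
      rcases Finset.mem_union.1 hab with h | h
      · exact h1 a b h
      · exact h2 a b h
    have h2 : Pot A ⊔ Pot B ≤ Pot (A ∩ B) :=
      sup_le (Pot_anti Finset.inter_subset_left) (Pot_anti Finset.inter_subset_right)
    have h1 := Submodule.finrank_mono h1
    have h2 := Submodule.finrank_mono h2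
    unfold rk; omega
  inc e A := by
    induction e using Sym2.ind with
    | _ a b =>
    let L : Pot A →ₗ[ZMod 2] ZMod 2 :=
      ((LinearMap.proj a : (V → ZMod 2) →ₗ[ZMod 2] ZMod 2) - LinearMap.proj b) ∘ₗ (Pot A).subtype
    have h := LinearMap.finrank_range_add_finrank_ker L
    have h1 : Module.finrank (ZMod 2) (LinearMap.range L) ≤ 1 := by
      have := Submodule.finrank_le (LinearMap.range L)
      simpa using this
    have h2 : (LinearMap.ker L).map (Pot A).subtype ≤ Pot (insert s(a, b) A) := by
      rintro _ ⟨φ, hφ, rfl⟩ c d hcd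
      have hφ' : φ.1 a = φ.1 b := by
        have : φ.1 a - φ.1 b = 0 := hφ
        exact sub_eq_zero.1 this
      rcases Finset.mem_insert.1 hcd with h | h
      · rcases Sym2.eq_iff.1 h with ⟨rfl, rfl⟩ | ⟨rfl, rfl⟩
        · exact hφ'
        · exact hφ'.symm
      · exact φ.2 c d h
    have h3 := Submodule.finrank_mono h2
    rw [Submodule.finrank_map_subtype_eq] at h3
    unfold rk; omega

theorem rk_filter_isRk (p : Sym2 V → Prop) : IsRk (fun A => rk (A.filter p)) where
  empty := by simp [rk_isRk.empty]
  mono A B h := rk_isRk.mono _ _ (Finset.filter_subset_filter _ h)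
  sub A B := by
    rw [Finset.filter_union, Finset.filter_inter_distrib]
    exact rk_isRk.sub _ _
  inc e A := by
    rw [Finset.filter_insert]
    split_ifs
    · exact rk_isRk.inc _ _
    · omega

theorem rk_le_card (A : Finset (Sym2 V)) : rk A ≤ A.card := by
  induction A using Finset.induction_on with
  | empty => simp [rk_isRk.empty]
  | insert e A he ih =>
    rw [Finset.card_insert_of_notMem he]
    have := rk_isRk.inc e A
    push_cast; omega

/-- lower bound for the rank -/
theorem rk_lower (A : Finset (Sym2 V)) (X : Finset V)
    (h : ∀ φ ∈ Pot A, (∀ x ∈ X, φ x = 0) → φ = 0) : (Fintype.card V : ℤ) ≤ rk A + X.card := by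
  let L : Pot A →ₗ[ZMod 2] (X → ZMod 2) :=
    { toFun := fun φ x => φ.1 x
      map_add' := fun _ _ => rfl
      map_smul' := fun _ _ => rfl }
  have hL : Function.Injective L := by
    rw [← LinearMap.ker_eq_bot, eq_bot_iff]
    intro φ hφ
    have h0 : ∀ x ∈ X, φ.1 x = 0 := fun x hx => congrFun (show L φ = 0 from hφ) ⟨x, hx⟩
    exact Subtype.ext (h φ.1 φ.2 h0)
  have := LinearMap.finrank_le_finrank_of_injective hL
  simp at this
  unfold rk; omega

/-- all ends of `e` are in `S` -/
def In (S : Finset V) (e : Sym2 V) : Prop := ∀ v ∈ e, v ∈ S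

theorem In_mk {S : Finset V} {a b : V} : In S s(a, b) ↔ a ∈ S ∧ b ∈ S := by
  simp [In]

/-- `Γ` connects `S` -/
def Cn (S : Finset V) (Γ : Finset (Sym2 V)) : Prop :=
  ∀ φ ∈ Pot Γ, ∀ x ∈ S, ∀ y ∈ S, φ x = φ y

theorem Cn.mono {S : Finset V} {Γ Γ' : Finset (Sym2 V)} (h : Cn S Γ) (hs : Γ ⊆ Γ') : Cn S Γ' :=
  fun φ hφ => h φ (Pot_anti hs hφ)

theorem Cn_of_rk {S : Finset V} {Γ : Finset (Sym2 V)} (hΓ : ∀ e ∈ Γ, In S e)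
    (hr : (S.card : ℤ) ≤ rk Γ + 1) : Cn S Γ := by
  intro φ hφ x hx y hy
  by_contra hne
  let D : Finset V := insert x (insert y Sᶜ)
  have hD : D.card = Fintype.card V - S.card + 2 := by
    have hxy : x ≠ y := fun h => hne (by rw [h])
    rw [Finset.card_insert_of_notMem, Finset.card_insert_of_notMem, Finset.card_compl]
    · simp [hy]
    · simp [hx, hxy]
  let xx : D := ⟨x, by simp [D]⟩
  let yy : D := ⟨y, by simp [D]⟩
  let F : (D → ZMod 2) → V → ZMod 2 := fun g z =>
    if h : z ∈ S then (if φ z = φ x then g xx else g yy) else g ⟨z, by simp [D, h]⟩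
  have hF : ∀ g, F g ∈ Pot Γ := by
    intro g a b hab
    have := In_mk.1 (hΓ _ hab)
    have hab' := hφ a b hab
    simp only [F, this.1, this.2, dif_pos, hab']
  let L : (D → ZMod 2) →ₗ[ZMod 2] Pot Γ :=
    { toFun := fun g => ⟨F g, hF g⟩
      map_add' := by
        intro f g
        apply Subtype.ext
        funext z
        simp only [F, Submodule.coe_add, Pi.add_apply]
        split_ifs <;> rfl
      map_smul' := by
        intro c g
        apply Subtype.ext
        funext z
        simp only [F, Submodule.coe_smul, Pi.smul_apply]
        split_ifs <;> rfl }
  have hL : Function.Injective L := by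
    intro f g hfg
    have h : ∀ z, F f z = F g z := fun z => congrFun (congrArg Subtype.val hfg) z
    funext ⟨z, hz⟩
    have hzz := h z
    by_cases hzx : z = x
    · subst hzx
      simpa [F, hx, xx] using hzz
    by_cases hzy : z = y
    · subst hzy
      simpa [F, hy, yy, Ne.symm hne] using hzz
    have hzS : z ∉ S := by simpa [D, hzx, hzy] using hz
    simpa [F, hzS] using hzz
  have h1 := LinearMap.finrank_le_finrank_of_injective hL
  have h2 := Finset.card_le_univ S
  simp only [Module.finrank_fintype_fun_eq_card, Fintype.card_coe] at h1
  rw [hD] at h1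
  unfold rk at hr
  omega

theorem Cn.rk_ge {S : Finset V} {Γ : Finset (Sym2 V)} (h : Cn S Γ) : (S.card : ℤ) ≤ rk Γ + 1 := by
  rcases S.eq_empty_or_nonempty with rfl | ⟨x, hx⟩
  · have := rk_isRk.mono ∅ Γ (by simp)
    rw [rk_isRk.empty] at this
    simp; omega
  have := rk_lower Γ (insert x Sᶜ) (by
    intro φ hφ h0
    funext z
    by_cases hz : z ∈ S
    · rw [h φ hφ z hz x hx]; exact h0 x (by simp)
    · exact h0 z (by simp [hz]))
  rw [Finset.card_insert_of_notMem (by simp [hx]), Finset.card_compl] at this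
  have := Finset.card_le_univ S
  omega

theorem Cn.card_ge {S : Finset V} {Γ : Finset (Sym2 V)} (h : Cn S Γ) : S.card ≤ Γ.card + 1 := by
  have := h.rk_ge
  have := rk_le_card Γ
  omega

/-- augmenting to a spanning tree -/
theorem exists_aug (A : Finset (Sym2 V)) (h : rk A + 1 < Fintype.card V) :
    ∃ e : Sym2 V, ¬ e.IsDiag ∧ rk (insert e A) = rk A + 1 := by
  by_cases hc : Cn Finset.univ A
  · have := hc.rk_ge
    rw [Finset.card_univ] at this
    omega
  · unfold Cn at hc
    push Not at hc
    obtain ⟨φ, hφ, a, -, b, -, hab⟩ := hc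
    refine ⟨s(a, b), ?_, ?_⟩
    · rw [Sym2.mk_isDiag_iff]; rintro rfl; exact hab rfl
    have h1 := rk_isRk.inc s(a, b) A
    have : Pot (insert s(a, b) A) < Pot A := by
      refine lt_of_le_of_ne (Pot_anti (Finset.subset_insert _ _)) ?_
      intro h
      rw [← h] at hφ
      exact hab (hφ a b (by simp))
    have := Submodule.finrank_lt_finrank_of_lt this
    unfold rk at *
    omega

theorem exists_tree (A : Finset (Sym2 V)) (hA : rk A = A.card) : ∀ k : ℕ,
    A.card + k + 1 = Fintype.card V → ∃ M : Multiset (Sym2 V), M.card = k ∧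
      (∀ e ∈ M, ¬ e.IsDiag) ∧ ∃ B : Finset (Sym2 V), B.val = A.val + M ∧ Cn Finset.univ B := by
  intro k
  induction k generalizing A with
  | zero =>
    intro h
    refine ⟨0, rfl, by simp, A, by simp, ?_⟩
    apply Cn_of_rk
    · intro e _ v _; simp
    · rw [Finset.card_univ]; omega
  | succ k ih =>
    intro h
    obtain ⟨e, hd, he⟩ := exists_aug A (by omega)
    have hn : e ∉ A := by
      intro h'
      rw [Finset.insert_eq_of_mem h'] at he; omega
    obtain ⟨M, hM, hMd, B, hB, hBc⟩ := ih (insert e A) (by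
      rw [he, Finset.card_insert_of_notMem hn, hA]; push_cast; rfl) (by
      rw [Finset.card_insert_of_notMem hn]; omega)
    refine ⟨e ::ₘ M, by simp [hM], ?_, B, ?_, hBc⟩
    · intro f hf
      rcases Multiset.mem_cons.1 hf with rfl | hf
      · exact hd
      · exact hMd f hf
    · rw [hB, Finset.insert_val_of_notMem hn]
      simp
end RG

namespace RG
variable {V : Type} [Fintype V]

/-- number of edges inside `C` -/
noncomputable def nE (E : Finset (Sym2 V)) (C : Finset V) : ℕ := (E.filter (In C)).card

theorem In.mono {S T : Finset V} {e : Sym2 V} (h : In S e) (hs : S ⊆ T) : In T e :=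
  fun v hv => hs (h v hv)

/-- a representative function for the components -/
theorem exists_rep (A : Finset (Sym2 V)) : ∃ ρ : V → V,
    (∀ φ ∈ Pot A, ∀ x, φ (ρ x) = φ x) ∧ (∀ a b, s(a, b) ∈ A → ρ a = ρ b) ∧
    (∀ x, ρ (ρ x) = ρ x) := by
  let R : Setoid V :=
    { r := fun x y => ∀ φ ∈ Pot A, φ x = φ y
      iseqv := ⟨fun _ _ _ => rfl, fun h φ hφ => (h φ hφ).symm,
        fun h1 h2 φ hφ => (h1 φ hφ).trans (h2 φ hφ)⟩ }
  refine ⟨fun x => (Quotient.mk R x).out, ?_, ?_, ?_⟩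
  · intro φ hφ x
    exact Quotient.mk_out (s := R) x φ hφ
  · intro a b hab
    have : (Quotient.mk R a) = Quotient.mk R b := Quotient.sound (fun φ hφ => hφ a b hab)
    simp only [this]
  · intro x
    simp only [Quotient.out_eq]

theorem decomp_bound {S Z : Finset V} (hZS : Z ⊆ S) (hZ2 : Z.card ≤ 2) {E : Finset (Sym2 V)}
    (hES : ∀ e ∈ E, In S e) (hEZ : ∀ e ∈ E, ∃ v ∈ e, v ∉ Z)
    (h1 : ∀ C ⊆ S \ Z, C.Nonempty → ∀ Z' ⊆ Z, Z'.card ≤ 1 →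
      nE E (C ∪ Z') + 2 ≤ 2 * C.card + Z'.card)
    (h2 : Z.card = 2 → ∀ C ⊆ S \ Z, C.Nonempty → nE E (C ∪ Z) ≤ 2 * C.card)
    (h3 : Z.card = 2 → ∀ C ⊆ S \ Z, C.Nonempty → ∀ C' ⊆ S \ Z, C'.Nonempty → Disjoint C C' →
      nE E (C ∪ Z) = 2 * C.card → nE E (C' ∪ Z) = 2 * C'.card → False)
    (A : Finset (Sym2 V)) (hA : A ⊆ E) :
    (A.card : ℤ) ≤ rk A + rk (A.filter (In (S \ Z))) := by
  set B := S \ Z with hB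
  obtain ⟨ρ, hρ1, hρ2, hρ3⟩ := exists_rep (A.filter (In B))
  set P := B.image ρ with hP
  let Cc : V → Finset V := fun p => B.filter (fun x => ρ x = p)
  let Zc : V → Finset V := fun p => Z.filter (fun z => ∃ c ∈ Cc p, s(z, c) ∈ A)
  let Ac : V → Finset (Sym2 V) := fun p => A.filter (fun e => ∃ c ∈ Cc p, c ∈ e)
  have hBS : B ⊆ S := Finset.sdiff_subset
  have hcardB : B.card = S.card - Z.card := Finset.card_sdiff_of_subset hZS
  have hcardZ := Finset.card_le_card hZS
  have hcardS := Finset.card_le_univ S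
  have hCsub : ∀ p, Cc p ⊆ B := fun p => Finset.filter_subset _ _
  have hZsub : ∀ p, Zc p ⊆ Z := fun p => Finset.filter_subset _ _
  have hCne : ∀ p ∈ P, (Cc p).Nonempty := by
    intro p hp
    obtain ⟨x, hx, rfl⟩ := Finset.mem_image.1 hp
    exact ⟨x, by simp [Cc, hx]⟩
  have hCdis : ∀ p q, p ≠ q → Disjoint (Cc p) (Cc q) := by
    intro p q hpq
    rw [Finset.disjoint_left]
    intro x hx hy
    simp only [Cc, Finset.mem_filter] at hx hy
    exact hpq (hx.2 ▸ hy.2)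
  have hsumC : ∑ p ∈ P, (Cc p).card = B.card :=
    (Finset.card_eq_sum_card_image ρ B).symm
  have hAcov : A ⊆ P.biUnion Ac := by
    intro e he
    obtain ⟨v, hv, hvZ⟩ := hEZ e (hA he)
    have hvB : v ∈ B := by
      rw [hB, Finset.mem_sdiff]; exact ⟨hES e (hA he) v hv, hvZ⟩
    rw [Finset.mem_biUnion]
    exact ⟨ρ v, Finset.mem_image_of_mem _ hvB, by
      simp only [Ac, Finset.mem_filter]
      exact ⟨he, v, by simp [Cc, hvB], hv⟩⟩
  have hAcard : A.card ≤ ∑ p ∈ P, (Ac p).card :=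
    (Finset.card_le_card hAcov).trans Finset.card_biUnion_le
  have hAi : ∀ p, (Ac p).card ≤ nE E (Cc p ∪ Zc p) := by
    intro p
    apply Finset.card_le_card
    intro e he
    simp only [Ac, Finset.mem_filter] at he
    obtain ⟨heA, c, hc, hce⟩ := he
    obtain ⟨d, rfl⟩ := Sym2.mem_iff_exists.1 hce
    rw [Finset.mem_filter]
    refine ⟨hA heA, In_mk.2 ⟨Finset.mem_union_left _ hc, ?_⟩⟩
    have hdS : d ∈ S := (In_mk.1 (hES _ (hA heA))).2
    have hc' := hc
    simp only [Cc, Finset.mem_filter] at hc'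
    by_cases hdZ : d ∈ Z
    · apply Finset.mem_union_right
      simp only [Zc, Finset.mem_filter]
      exact ⟨hdZ, c, hc, by rwa [Sym2.eq_swap]⟩
    · apply Finset.mem_union_left
      have hdB : d ∈ B := by rw [hB, Finset.mem_sdiff]; exact ⟨hdS, hdZ⟩
      simp only [Cc, Finset.mem_filter]
      refine ⟨hdB, ?_⟩
      rw [← hc'.2]
      exact (hρ2 c d (by rw [Finset.mem_filter]; exact ⟨heA, In_mk.2 ⟨hc'.1, hdB⟩⟩)).symm
  -- rank bounds
  have hr2 : (B.card : ℤ) ≤ rk (A.filter (In B)) + P.card := by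
    have := rk_lower (A.filter (In B)) (P ∪ Bᶜ) (by
      intro φ hφ h0
      funext x
      by_cases hx : x ∈ B
      · rw [← hρ1 φ hφ x]
        exact h0 _ (Finset.mem_union_left _ (Finset.mem_image_of_mem _ hx))
      · exact h0 _ (Finset.mem_union_right _ (by simpa using hx)))
    have h' := Finset.card_union_le P Bᶜ
    rw [Finset.card_compl] at h'
    have := Finset.card_le_univ B
    omega
  set U := P.filter (fun p => Zc p = ∅) with hU
  have hpot : ∀ φ ∈ Pot A, φ ∈ Pot (A.filter (In B)) := fun φ hφ =>
    Pot_anti (Finset.filter_subset _ _) hφ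
  have hcz : ∀ φ ∈ Pot A, ∀ p, ∀ z ∈ Zc p, φ z = φ p := by
    intro φ hφ p z hz
    simp only [Zc, Finset.mem_filter, Cc] at hz
    obtain ⟨_, c, ⟨_, hcp⟩, hzc⟩ := hz
    rw [hφ z c hzc, ← hρ1 φ (hpot φ hφ) c, hcp]
  have hgen : ∀ φ ∈ Pot A, (∀ p ∈ U, φ p = 0) → (∀ z ∈ Z, φ z = 0) → ∀ x ∈ B, φ x = 0 := by
    intro φ hφ hu hz x hx
    rw [← hρ1 φ (hpot φ hφ) x]
    have hp : ρ x ∈ P := Finset.mem_image_of_mem _ hx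
    by_cases he : Zc (ρ x) = ∅
    · exact hu _ (by rw [hU, Finset.mem_filter]; exact ⟨hp, he⟩)
    · obtain ⟨z, hzz⟩ := Finset.nonempty_iff_ne_empty.2 he
      rw [← hcz φ hφ _ z hzz]
      exact hz z (hZsub _ hzz)
  have hr1 : (B.card : ℤ) ≤ rk A + U.card := by
    have := rk_lower A (U ∪ (Z ∪ Sᶜ)) (by
      intro φ hφ h0
      have hz : ∀ z ∈ Z, φ z = 0 := fun z hz => h0 z (by simp [hz])
      funext x
      by_cases hx : x ∈ B
      · exact hgen φ hφ (fun p hp => h0 p (by simp [hp])) hz x hx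
      · by_cases hxS : x ∈ S
        · exact hz x (by simpa [hB, hxS] using hx)
        · exact h0 x (by simp [hxS]))
    have h' := Finset.card_union_le U (Z ∪ Sᶜ)
    have h'' := Finset.card_union_le Z Sᶜ
    rw [Finset.card_compl] at h''
    omega
  have hr1' : (∃ p ∈ P, (Zc p).card = 2) → (B.card : ℤ) + 1 ≤ rk A + U.card := by
    rintro ⟨p, hp, hc⟩
    have hZeq : Zc p = Z := Finset.eq_of_subset_of_card_le (hZsub p) (by omega)
    obtain ⟨v, w, hvw, hvwZ⟩ := Finset.card_eq_two.1 hc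
    have hZ' : Z = {v, w} := hZeq ▸ hvwZ
    have hv : v ∈ Zc p := by simp [hvwZ]
    have hw : w ∈ Zc p := by simp [hvwZ]
    have := rk_lower A (U ∪ ({v} ∪ Sᶜ)) (by
      intro φ hφ h0
      have hz : ∀ z ∈ Z, φ z = 0 := by
        intro z hz
        have hvv : φ v = 0 := h0 v (by simp)
        rw [hZ'] at hz
        simp only [Finset.mem_insert, Finset.mem_singleton] at hz
        rcases hz with rfl | rfl
        · exact hvv
        · rw [hcz φ hφ p z hw, ← hcz φ hφ p v hv, hvv]
      funext x
      by_cases hx : x ∈ B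
      · exact hgen φ hφ (fun p hp => h0 p (by simp [hp])) hz x hx
      · by_cases hxS : x ∈ S
        · exact hz x (by simpa [hB, hxS] using hx)
        · exact h0 x (by simp [hxS]))
    have h' := Finset.card_union_le U ({v} ∪ Sᶜ)
    have h'' := Finset.card_union_le {v} Sᶜ
    rw [Finset.card_compl] at h''
    have hZc : Z.card = 2 := by rw [← hZeq, hc]
    simp only [Finset.card_singleton] at h''
    omega
  have hUsum : U.card = ∑ p ∈ P, if Zc p = ∅ then 1 else 0 := by
    rw [hU, Finset.card_filter]
  have hsumP : P.card = ∑ p ∈ P, 1 := by simp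
  -- per component bounds
  have hcomp : ∀ p ∈ P, (Ac p).card + 1 + (if Zc p = ∅ then 1 else 0) ≤ 2 * (Cc p).card ∨
      ((Zc p).card = 2 ∧ Zc p = Z ∧ Z.card = 2 ∧ nE E (Cc p ∪ Z) = 2 * (Cc p).card ∧ Zc p ≠ ∅) := by
    intro p hp
    have hle : (Zc p).card ≤ Z.card := Finset.card_le_card (hZsub p)
    have hai := hAi p
    by_cases hc : (Zc p).card ≤ 1
    · left
      have := h1 (Cc p) (hCsub p) (hCne p hp) (Zc p) (hZsub p) hc
      split_ifs with he
      · rw [he] at this hai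
        simp only [Finset.card_empty] at this
        omega
      · omega
    · have hZeq : Zc p = Z := Finset.eq_of_subset_of_card_le (hZsub p) (by omega)
      have hZc : Z.card = 2 := by rw [hZeq] at hc; omega
      have hne : Zc p ≠ ∅ := by rw [← Finset.card_pos.trans Finset.nonempty_iff_ne_empty]; omega
      have := h2 hZc (Cc p) (hCsub p) (hCne p hp)
      rw [hZeq] at hai
      by_cases ht : nE E (Cc p ∪ Z) = 2 * (Cc p).card
      · right
        exact ⟨by omega, hZeq, hZc, ht, hne⟩
      · left
        rw [if_neg hne]; omega
  by_cases hex : ∃ p0 ∈ P, ¬ ((Ac p0).card + 1 + (if Zc p0 = ∅ then 1 else 0) ≤ 2 * (Cc p0).card)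
  · obtain ⟨p0, hp0, hn⟩ := hex
    obtain ⟨a1, a2, a3, a4, a5⟩ := (hcomp p0 hp0).resolve_left hn
    have hall : ∀ p ∈ P, (Ac p).card + 1 + (if Zc p = ∅ then 1 else 0) ≤
        2 * (Cc p).card + (if p = p0 then 1 else 0) := by
      intro p hp
      by_cases hpp : p = p0
      · subst hpp
        have := hAi p
        rw [a2, a4] at this
        rw [if_neg a5, if_pos rfl]; omega
      · rw [if_neg hpp]
        rcases hcomp p hp with h | ⟨_, _, _, b4, _⟩
        · omega
        · exact (h3 a3 _ (hCsub p) (hCne p hp) _ (hCsub p0) (hCne p0 hp0) (hCdis _ _ hpp) b4 a4).elim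
    have hs := Finset.sum_le_sum hall
    simp only [Finset.sum_add_distrib, ← Finset.mul_sum, hsumC, ← hUsum, ← hsumP] at hs
    rw [Finset.sum_ite_eq' P p0, if_pos hp0] at hs
    have := hr1' ⟨p0, hp0, a1⟩
    omega
  · push Not at hex
    have hs := Finset.sum_le_sum hex
    simp only [Finset.sum_add_distrib, ← Finset.mul_sum, hsumC, ← hUsum, ← hsumP] at hs
    omega

theorem decomp {S Z : Finset V} (hZS : Z ⊆ S) (hZ2 : Z.card ≤ 2) {E : Finset (Sym2 V)}
    (hES : ∀ e ∈ E, In S e) (hEZ : ∀ e ∈ E, ∃ v ∈ e, v ∉ Z)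
    (h1 : ∀ C ⊆ S \ Z, C.Nonempty → ∀ Z' ⊆ Z, Z'.card ≤ 1 →
      nE E (C ∪ Z') + 2 ≤ 2 * C.card + Z'.card)
    (h2 : Z.card = 2 → ∀ C ⊆ S \ Z, C.Nonempty → nE E (C ∪ Z) ≤ 2 * C.card)
    (h3 : Z.card = 2 → ∀ C ⊆ S \ Z, C.Nonempty → ∀ C' ⊆ S \ Z, C'.Nonempty → Disjoint C C' →
      nE E (C ∪ Z) = 2 * C.card → nE E (C' ∪ Z) = 2 * C'.card → False)
    (hne : (S \ Z).Nonempty)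
    (hcard : E.card + 2 = S.card + (S \ Z).card) :
    ∃ T F, T ∪ F = E ∧ Disjoint T F ∧ T.card + 1 = S.card ∧ Cn S T ∧
      (∀ e ∈ F, In (S \ Z) e) ∧ Cn (S \ Z) F := by
  obtain ⟨T, F, hu, hd, hT, hF⟩ := munion E.card E rk (fun A => rk (A.filter (In (S \ Z)))) rfl
    rk_isRk (rk_filter_isRk _) (decomp_bound hZS hZ2 hES hEZ h1 h2 h3)
  have hTE : T ⊆ E := hu ▸ Finset.subset_union_left
  have hFE : F ⊆ E := hu ▸ Finset.subset_union_right
  have hFf : F.filter (In (S \ Z)) = F := by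
    apply Finset.eq_of_subset_of_card_le (Finset.filter_subset _ _)
    have := rk_le_card (F.filter (In (S \ Z)))
    omega
  rw [hFf] at hF
  have hFB : ∀ e ∈ F, In (S \ Z) e := by
    intro e he; rw [← hFf] at he; exact (Finset.mem_filter.1 he).2
  have up : ∀ (W : Finset V), W.Nonempty → ∀ A : Finset (Sym2 V), (∀ e ∈ A, In W e) →
      rk A + 1 ≤ W.card := by
    intro W hW A hA
    by_contra hcon
    obtain ⟨x, hx⟩ := hW
    have hmono : rk A ≤ rk (Finset.univ.filter (In W)) :=
      rk_isRk.mono _ _ (by intro e he; simp [hA e he])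
    have hle : (Fintype.card V - W.card : ℕ) + 1 ≤ Module.finrank (ZMod 2) (Pot A) := by
      let D : Finset V := insert x Wᶜ
      have hD : D.card = Fintype.card V - W.card + 1 := by
        rw [Finset.card_insert_of_notMem (by simp [hx]), Finset.card_compl]
      let F : (D → ZMod 2) → V → ZMod 2 := fun g z =>
        if h : z ∈ W then g ⟨x, by simp [D]⟩ else g ⟨z, by simp [D, h]⟩
      let L : (D → ZMod 2) →ₗ[ZMod 2] Pot A :=
        { toFun := fun g => ⟨F g, by
            intro a b hab
            have := In_mk.1 (hA _ hab)
            simp only [F, this.1, this.2, dif_pos]⟩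
          map_add' := by
            intro f g
            apply Subtype.ext
            funext z
            simp only [F, Submodule.coe_add, Pi.add_apply]
            split_ifs <;> rfl
          map_smul' := by
            intro c g
            apply Subtype.ext
            funext z
            simp only [F, Submodule.coe_smul, Pi.smul_apply]
            split_ifs <;> rfl }
      have hL : Function.Injective L := by
        intro f g hfg
        have h : ∀ z, F f z = F g z := fun z => congrFun (congrArg Subtype.val hfg) z
        funext ⟨z, hz⟩
        have hzz := h z
        by_cases hzx : z = x
        · subst hzx
          simpa [F, hx] using hzz
        have hzS : z ∉ W := by simpa [D, hzx] using hz
        simpa [F, hzS] using hzz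
      have h1 := LinearMap.finrank_le_finrank_of_injective hL
      simp only [Module.finrank_fintype_fun_eq_card, Fintype.card_coe] at h1
      omega
    have := Finset.card_le_univ W
    unfold rk at hcon
    omega
  have hc := Finset.card_union_of_disjoint hd
  rw [hu] at hc
  have u1 := up S (hne.mono Finset.sdiff_subset) T (fun e he => hES e (hTE he))
  have u2 := up (S \ Z) hne F hFB
  have hTc : T.card + 1 = S.card := by omega
  have hFc : F.card + 1 = (S \ Z).card := by omega
  exact ⟨T, F, hu, hd, hTc, Cn_of_rk (fun e he => hES e (hTE he)) (by omega), hFB,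
    Cn_of_rk hFB (by omega)⟩
end RG

namespace RG

/-- indicator with values in `ZMod 2` -/
noncomputable def iv (p : Prop) : ZMod 2 := if p then 1 else 0

theorem iv_true {p : Prop} (h : p) : iv p = 1 := if_pos h
theorem iv_false {p : Prop} (h : ¬ p) : iv p = 0 := if_neg h
theorem iv_dec (p : Prop) [Decidable p] : iv p = if p then 1 else 0 := by
  unfold iv; congr
theorem fin3_three {i k q : Fin 3} (h1 : i ≠ k) (h2 : i ≠ q) (h3 : k ≠ q) :
    ∀ t : Fin 3, t = i ∨ t = k ∨ t = q := by
  revert i k q; decide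
theorem fin3_two (o : Fin 3) : ∃ j l : Fin 3, j ≠ o ∧ l ≠ o ∧ j ≠ l := by
  revert o; decide
theorem fin3_third {i k : Fin 3} (h : i ≠ k) : ∃ q : Fin 3, i ≠ q ∧ k ≠ q := by
  revert i k; decide
theorem two_cases (x : ZMod 2) : x = 0 ∨ x = 1 := by
  revert x; decide
theorem add_self2 (x : ZMod 2) : x + x = 0 := by
  revert x; decide
theorem ne_zero2 {x : ZMod 2} (h : x ≠ 0) : x = 1 := (two_cases x).resolve_left h
theorem ne_one2 {x : ZMod 2} (h : x ≠ 1) : x = 0 := (two_cases x).resolve_right h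
theorem eq_of_add2 {x y : ZMod 2} (h : x + y = 0) : x = y := by
  revert x y; decide

/-- rooted trees given by a parent function -/
structure Rt (β : Type) where
  r : β
  par : β → β
  dep : β → ℕ
  par_r : par r = r
  dep_par : ∀ x, x ≠ r → dep (par x) + 1 = dep x

namespace Rt
variable {β : Type} (R : Rt β)

/-- `y` is an ancestor of `x` -/
def le (x y : β) : Prop := ∃ k, R.par^[k] x = y

theorem le_refl (x : β) : R.le x x := ⟨0, rfl⟩

theorem le_trans {x y z : β} (h1 : R.le x y) (h2 : R.le y z) : R.le x z := by
  obtain ⟨k, rfl⟩ := h1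
  obtain ⟨l, rfl⟩ := h2
  exact ⟨l + k, by rw [Function.iterate_add_apply]⟩

theorem le_par (x : β) : R.le x (R.par x) := ⟨1, rfl⟩

theorem le_r (x : β) : R.le x R.r := by
  induction h : R.dep x using Nat.strong_induction_on generalizing x with
  | _ n ih =>
    by_cases hx : x = R.r
    · rw [hx]; exact R.le_refl _
    · have := R.dep_par x hx
      exact R.le_trans (R.le_par x) (ih (R.dep (R.par x)) (by omega) (R.par x) rfl)

theorem r_le {y : β} (h : R.le R.r y) : y = R.r := by
  obtain ⟨k, rfl⟩ := h
  exact Function.iterate_fixed R.par_r k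

theorem par_le {x y : β} (h : R.le x y) (hne : x ≠ y) : R.le (R.par x) y := by
  obtain ⟨k, hk⟩ := h
  cases k with
  | zero => exact (hne hk).elim
  | succ k => exact ⟨k, by rw [← hk, Function.iterate_succ_apply]⟩

theorem dep_lt {x y : β} (h : R.le x y) (hne : x ≠ y) : R.dep y < R.dep x := by
  obtain ⟨k, hk⟩ := h
  induction k generalizing x with
  | zero => exact (hne hk).elim
  | succ k ih =>
    rw [Function.iterate_succ_apply] at hk
    have hxr : x ≠ R.r := by
      rintro rfl
      rw [R.par_r, Function.iterate_fixed R.par_r] at hk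
      exact hne hk
    have := R.dep_par x hxr
    by_cases hp : R.par x = y
    · rw [hp] at this; omega
    · have := ih hp hk; omega

theorem le_antisymm {x y : β} (h1 : R.le x y) (h2 : R.le y x) : x = y := by
  by_contra hne
  have := R.dep_lt h1 hne
  have := R.dep_lt h2 (Ne.symm hne)
  omega

theorem chain {x y z : β} (h1 : R.le x y) (h2 : R.le x z) : R.le y z ∨ R.le z y := by
  obtain ⟨k, rfl⟩ := h1
  obtain ⟨l, rfl⟩ := h2
  rcases Nat.le_total k l with h | h
  · left; exact ⟨l - k, by rw [← Function.iterate_add_apply]; congr 2; omega⟩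
  · right; exact ⟨k - l, by rw [← Function.iterate_add_apply]; congr 2; omega⟩

theorem ne_r_of_le {x y : β} (h : R.le x y) (hne : x ≠ y) : x ≠ R.r := by
  rintro rfl
  exact hne (R.r_le h).symm

theorem ne_r_of_le' {x y : β} (h : R.le x y) (hy : y ≠ R.r) : x ≠ R.r := by
  rintro rfl
  exact hy (R.r_le h)

theorem first (P : β → Prop) {x y : β} (h : R.le x y) (hy : P y) :
    ∃ z, R.le x z ∧ R.le z y ∧ P z ∧ ∀ t, R.le x t → R.le t z → t ≠ z → ¬ P t := by
  have hex : ∃ k, P (R.par^[k] x) := by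
    obtain ⟨k, rfl⟩ := h; exact ⟨k, hy⟩
  refine ⟨R.par^[Nat.find hex] x, ⟨_, rfl⟩, ?_, Nat.find_spec hex, ?_⟩
  · obtain ⟨k, rfl⟩ := h
    have : Nat.find hex ≤ k := Nat.find_min' hex hy
    exact ⟨k - Nat.find hex, by rw [← Function.iterate_add_apply]; congr 2; omega⟩
  · rintro t ⟨m, rfl⟩ htz hne hP
    have hm : Nat.find hex ≤ m := Nat.find_min' hex hP
    refine hne (R.le_antisymm htz ⟨m - Nat.find hex, ?_⟩)
    rw [← Function.iterate_add_apply]; congr 2; omega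

theorem chain_const {γ : Type} (φ : β → γ) {x z : β} (h : R.le x z)
    (hs : ∀ t, R.le x t → R.le t z → t ≠ z → φ t = φ (R.par t)) : φ x = φ z := by
  obtain ⟨k, hk⟩ := h
  induction k generalizing x with
  | zero => rw [← hk]; rfl
  | succ k ih =>
    by_cases hxz : x = z
    · rw [hxz]
    rw [hs x (R.le_refl x) ⟨k + 1, hk⟩ hxz]
    rw [Function.iterate_succ_apply] at hk
    exact ih (fun t h1 h2 h3 => hs t (R.le_trans (R.le_par x) h1) h2 h3) hk

theorem chain_drop (P : β → Prop) {x z : β} (h : R.le x z) (hx : P x) (hz : ¬ P z) :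
    ∃ t, R.le x t ∧ R.le t z ∧ t ≠ z ∧ P t ∧ ¬ P (R.par t) := by
  by_contra hcon
  push Not at hcon
  obtain ⟨k, hk⟩ := h
  induction k generalizing x with
  | zero => exact hz (hk ▸ hx)
  | succ k ih =>
    have hxz : x ≠ z := by rintro rfl; exact hz hx
    have hp := hcon x (R.le_refl x) ⟨k + 1, hk⟩ hxz hx
    rw [Function.iterate_succ_apply] at hk
    exact ih hp (fun t h1 h2 h3 => hcon t (R.le_trans (R.le_par x) h1) h2 h3) hk

/-- change of the indicator of class `i` at the edge above `x` -/
noncomputable def dl (c : β → Fin 3) (i : Fin 3) (x : β) : ZMod 2 :=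
  iv (c x = i) + iv (c (R.par x) = i)

theorem dl_eq_zero {c : β → Fin 3} {i : Fin 3} {x : β} (h : R.dl c i x = 0) :
    (c x = i) = (c (R.par x) = i) := by
  unfold dl iv at h
  by_cases h1 : c x = i <;> by_cases h2 : c (R.par x) = i <;> simp [h1, h2] at h ⊢

theorem dl_sum {c : β → Fin 3} {i k q : Fin 3} (h1 : i ≠ k) (h2 : i ≠ q) (h3 : k ≠ q) (x : β) :
    R.dl c i x + R.dl c k x + R.dl c q x = 0 := by
  unfold dl
  simp only [iv_dec]
  generalize c x = u
  generalize c (R.par x) = v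
  revert i k q u v
  decide

/-- another class changes too -/
theorem dl_other {c : β → Fin 3} {i : Fin 3} {x : β} (h : R.dl c i x = 1) :
    ∃ k, k ≠ i ∧ R.dl c k x = 1 := by
  unfold dl at *
  simp only [iv_dec] at *
  revert h
  generalize c x = u
  generalize c (R.par x) = v
  revert i u v
  decide

/-- deepest vertex with two terminals below -/
theorem deepest [Fintype β] (a : Fin 3 → β) {z : β} (hz : ∃ i k, i ≠ k ∧ R.le (a i) z ∧ R.le (a k) z) :
    ∃ m i k, R.le m z ∧ i ≠ k ∧ R.le (a i) m ∧ R.le (a k) m ∧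
      ∀ x, R.le x m → x ≠ m → ∀ p q, R.le (a p) x → R.le (a q) x → p = q := by
  let M : Finset β := Finset.univ.filter (fun x => R.le x z ∧ ∃ i k, i ≠ k ∧ R.le (a i) x ∧ R.le (a k) x)
  obtain ⟨m, hm, hmax⟩ := Finset.exists_max_image M R.dep ⟨z, by simpa [M] using ⟨R.le_refl z, hz⟩⟩
  simp only [M, Finset.mem_filter, Finset.mem_univ, true_and] at hm hmax
  obtain ⟨hmz, i, k, hik, hi, hk⟩ := hm
  refine ⟨m, i, k, hmz, hik, hi, hk, ?_⟩
  intro x hx hne p q hp hq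
  by_contra hpq
  have h1 := hmax x ⟨R.le_trans hx hmz, p, q, hpq, hp, hq⟩
  have := R.dep_lt hx hne
  omega

theorem lemma1 [Fintype β] (c : β → Fin 3) (a : Fin 3 → β) (ha : ∀ i, c (a i) = i) (K : β → ZMod 2) :
    ∃ i x, x ≠ R.r ∧ K x + iv (R.le (a i) x) = 1 ∧ R.dl c i x = 1 := by
  obtain ⟨m, i0, k0, -, hne, hi0, hk0, hbel⟩ := R.deepest a (z := R.r)
    ⟨0, 1, by decide, R.le_r _, R.le_r _⟩
  obtain ⟨i, hi, hci⟩ : ∃ i, R.le (a i) m ∧ c m ≠ i := by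
    by_cases h : c m = i0
    · exact ⟨k0, hk0, by rw [h]; exact hne⟩
    · exact ⟨i0, hi0, h⟩
  obtain ⟨x, h1, h2, h3, h4, h5⟩ := R.chain_drop (fun x => c x = i) hi (ha i) hci
  have hxr := R.ne_r_of_le h2 h3
  rcases two_cases (K x) with hK | hK
  · refine ⟨i, x, hxr, ?_, ?_⟩
    · rw [hK, iv_true h1]; decide
    · rw [dl, iv_true h4, iv_false h5]; decide
  · refine ⟨c (R.par x), x, hxr, ?_, ?_⟩
    · rw [hK, iv_false]
      · decide
      · intro h; exact h5 (hbel x h2 h3 _ _ h h1)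
    · rw [dl, iv_true rfl, iv_false]
      · decide
      · rw [h4]; exact fun h => h5 h.symm

/-- the bilinear form -/
noncomputable def bf (c c' : β → Fin 3) (i j : Fin 3) (x y : β) : ZMod 2 :=
  R.dl c i x * R.dl c' j y + R.dl c i y * R.dl c' j x

theorem star [Fintype β] (c c' : β → Fin 3) (b : Fin 3 → β) (ν μ : Fin 3)
    (hb : ∀ j, c' (b j) = j) (hν : ∀ j, c (b j) = ν) (hcr : ∀ x, c x = ν ∨ c' x = μ)
    (K : β → ZMod 2) (i : Fin 3) (x : β) (hx : R.dl c i x = 1) :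
    ∃ j y, y ≠ R.r ∧ K y + iv (R.le (b j) y) = 1 ∧ R.bf c c' i j x y = 1 := by
  let D : β → Prop := fun p => (i = ν ∧ c p ≠ ν) ∨ (i ≠ ν ∧ c p = i)
  have hDμ : ∀ p, D p → c' p = μ := by
    intro p hp
    apply (hcr p).resolve_left
    rcases hp with ⟨_, h⟩ | ⟨h1, h2⟩
    · exact h
    · rw [h2]; exact h1
  have hDb : ∀ j, ¬ D (b j) := by
    intro j hp
    rcases hp with ⟨_, h⟩ | ⟨h1, h2⟩
    · exact h (hν j)
    · exact h1 (h2 ▸ hν j)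
  have hDd : ∀ p q, iv (D p) + iv (D q) = iv (c p = i) + iv (c q = i) := by
    intro p q
    by_cases hi : i = ν
    · have : ∀ p, D p ↔ c p ≠ i := by
        intro p; simp only [D]; rw [← hi]; simp
      rw [this, this]
      unfold iv
      by_cases h1 : c p = i <;> by_cases h2 : c q = i <;> simp [h1, h2] <;> decide
    · have : ∀ p, D p ↔ c p = i := by
        intro p; simp [D, hi]
      rw [this, this]
  obtain ⟨u, hu⟩ : ∃ u, ∀ j, R.dl c' j x = iv (c' u = j) + iv (μ = j) := by
    have h := hDd x (R.par x)
    change _ = R.dl c i x at h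
    rw [hx] at h
    by_cases h1 : D x
    · refine ⟨R.par x, fun j => ?_⟩
      rw [dl, hDμ x h1, add_comm]
    · have h2 : D (R.par x) := by
        by_contra h2
        rw [iv_false h1, iv_false h2] at h
        exact absurd h (by decide)
      exact ⟨x, fun j => by rw [dl, hDμ _ h2]⟩
  let cs : β → Fin 3 := fun p => if D p then c' u else c' p
  have hcs : ∀ p j, iv (cs p = j) = iv (c' p = j) + iv (D p) * R.dl c' j x := by
    intro p j
    by_cases hp : D p
    · simp only [cs, if_pos hp]
      rw [hu, iv_true hp, hDμ p hp, one_mul, add_comm (iv (c' u = j)), ← add_assoc, add_self2, zero_add]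
    · simp only [cs, if_neg hp]
      rw [iv_false hp]; ring
  obtain ⟨j, y, h1, h2, h3⟩ := R.lemma1 cs b (fun j => by simp [cs, hDb j, hb]) K
  refine ⟨j, y, h1, h2, ?_⟩
  rw [← h3, bf, hx]
  have := hDd y (R.par y)
  change _ = R.dl c i y at this
  rw [← this]
  unfold dl
  rw [hcs, hcs]
  unfold dl
  ring

theorem bf_sum_left {c c' : β → Fin 3} {i k q : Fin 3} (h1 : i ≠ k) (h2 : i ≠ q) (h3 : k ≠ q)
    (j : Fin 3) (x y : β) : R.bf c c' i j x y + R.bf c c' k j x y + R.bf c c' q j x y = 0 := by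
  have hx := R.dl_sum (c := c) h1 h2 h3 x
  have hy := R.dl_sum (c := c) h1 h2 h3 y
  unfold bf
  linear_combination (R.dl c' j y) * hx + (R.dl c' j x) * hy

theorem bf_sum_right {c c' : β → Fin 3} {i k q : Fin 3} (h1 : i ≠ k) (h2 : i ≠ q) (h3 : k ≠ q)
    (j : Fin 3) (x y : β) : R.bf c c' j i x y + R.bf c c' j k x y + R.bf c c' j q x y = 0 := by
  have hx := R.dl_sum (c := c') h1 h2 h3 x
  have hy := R.dl_sum (c := c') h1 h2 h3 y
  unfold bf
  linear_combination (R.dl c j y) * hx + (R.dl c j x) * hy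

theorem lemma2 [Fintype β] (c c' : β → Fin 3) (a b : Fin 3 → β) (ν μ : Fin 3)
    (ha : ∀ i, c (a i) = i) (hb : ∀ j, c' (b j) = j)
    (hν : ∀ j, c (b j) = ν) (hμ : ∀ i, c' (a i) = μ) (hcr : ∀ x, c x = ν ∨ c' x = μ)
    (hmed : ∀ x, x ≠ R.r → ∀ j l, R.le (b j) x → R.le (b l) x → j = l)
    (K : β → ZMod 2) :
    ∃ i j x y, x ≠ R.r ∧ y ≠ R.r ∧ K x + iv (R.le (a i) x) + iv (R.le (b j) x) = 1 ∧
      K y + iv (R.le (a i) y) + iv (R.le (b j) y) = 1 ∧ R.bf c c' i j x y = 1 := by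
  by_contra hcon
  have hno : ∀ i j x y, x ≠ R.r → y ≠ R.r → K x + iv (R.le (a i) x) + iv (R.le (b j) x) = 1 →
      K y + iv (R.le (a i) y) + iv (R.le (b j) y) = 1 → R.bf c c' i j x y = 0 := by
    intro i j x y h1 h2 h3 h4
    by_contra h5
    exact hcon ⟨i, j, x, y, h1, h2, h3, h4, ne_zero2 h5⟩
  clear hcon
  -- consequences of the star lemma
  have stA : ∀ i x, x ≠ R.r → (∀ j, ¬ R.le (b j) x) → R.dl c i x = 1 →
      K x + iv (R.le (a i) x) = 0 := by
    intro i x hx hB hd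
    by_contra h0
    have h0 := ne_zero2 h0
    obtain ⟨j, y, h1, h2, h3⟩ := R.star c c' b ν μ hb hν hcr (fun y => K y + iv (R.le (a i) y)) i x hd
    have := hno i j x y hx h1 (by rw [iv_false (hB j), h0, add_zero]) h2
    rw [h3] at this
    exact absurd this (by decide)
  have stB : ∀ j x, x ≠ R.r → (∀ i, ¬ R.le (a i) x) → R.dl c' j x = 1 →
      K x + iv (R.le (b j) x) = 0 := by
    intro j x hx hA hd
    by_contra h0
    have h0 := ne_zero2 h0
    obtain ⟨i, y, h1, h2, h3⟩ := R.star c' c a μ ν ha hμ (fun x => (hcr x).symm)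
      (fun y => K y + iv (R.le (b j) y)) j x hd
    have := hno i j x y hx h1 (by rw [iv_false (hA i), add_zero, h0])
      (by rw [← h2]; ring)
    have h4 : R.bf c c' i j x y = R.bf c' c j i x y := by unfold bf; ring
    rw [h4, h3] at this
    exact absurd this (by decide)
  have cA : ∀ i x, x ≠ R.r → (∀ j, ¬ R.le (b j) x) → R.le (a i) x →
      (∀ k, R.le (a k) x → k = i) → (c x = i) = (c (R.par x) = i) := by
    intro i x hx hB hi hk
    apply R.dl_eq_zero
    by_contra h
    have h := ne_zero2 h
    obtain ⟨k, hki, hk1⟩ := R.dl_other h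
    have e1 := stA i x hx hB h
    have e2 := stA k x hx hB hk1
    rw [iv_true hi] at e1
    rw [iv_false (fun h => hki (hk k h))] at e2
    rw [add_zero] at e2
    rw [e2] at e1
    exact absurd e1 (by decide)
  have cB : ∀ j x, x ≠ R.r → (∀ i, ¬ R.le (a i) x) → R.le (b j) x →
      (∀ k, R.le (b k) x → k = j) → (c' x = j) = (c' (R.par x) = j) := by
    intro i x hx hB hi hk
    apply R.dl_eq_zero
    by_contra h
    have h := ne_zero2 h
    obtain ⟨k, hki, hk1⟩ := R.dl_other h
    have e1 := stB i x hx hB h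
    have e2 := stB k x hx hB hk1
    rw [iv_true hi] at e1
    rw [iv_false (fun h => hki (hk k h))] at e2
    rw [add_zero] at e2
    rw [e2] at e1
    exact absurd e1 (by decide)
  -- the vertices z_j
  have hz : ∀ j, ∃ z, R.le (b j) z ∧ (∃ i, R.le (a i) z) ∧ c' z = j ∧
      ∀ t, R.le (b j) t → R.le t z → t ≠ z → ∀ i, ¬ R.le (a i) t := by
    intro j
    obtain ⟨z, h1, _, h3, h4⟩ := R.first (fun z => ∃ i, R.le (a i) z) (R.le_r (b j))
      ⟨0, R.le_r _⟩
    have h4' : ∀ t, R.le (b j) t → R.le t z → t ≠ z → ∀ i, ¬ R.le (a i) t :=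
      fun t q1 q2 q3 i hi => h4 t q1 q2 q3 ⟨i, hi⟩
    refine ⟨z, h1, h3, ?_, h4'⟩
    have := R.chain_const (fun x => c' x = j) h1 (fun t q1 q2 q3 =>
      cB j t (R.ne_r_of_le q2 q3) (h4' t q1 q2 q3) q1
        (fun k hk => hmed t (R.ne_r_of_le q2 q3) k j hk q1))
    rw [← this]
    exact hb j
  choose z hz1 hz2 hz3 hz4 using hz
  -- below z_j no b, if an a is below
  have hzB : ∀ j, z j ≠ R.r → ∀ t, R.le t (z j) → t ≠ z j → (∃ i, R.le (a i) t) →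
      ∀ l, ¬ R.le (b l) t := by
    intro j hj t h1 h2 ⟨i, hi⟩ l hl
    have : l = j := hmed (z j) hj l j (R.le_trans hl h1) (hz1 j)
    subst this
    exact hz4 l t hl h1 h2 i hi
  have hsing : ∀ j, z j ≠ R.r → ∃ i, c (z j) = i ∧ R.le (a i) (z j) ∧
      ∀ k, R.le (a k) (z j) → k = i := by
    intro j hj
    have huniq : ∀ p q, R.le (a p) (z j) → R.le (a q) (z j) → p = q := by
      intro p q hp hq
      by_contra hpq
      obtain ⟨m, i, k, hm, hik, hi, hk, hbel⟩ := R.deepest a (z := z j) ⟨p, q, hpq, hp, hq⟩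
      have hcm : ∀ i, R.le (a i) m → c m = i := by
        intro i hi
        have := R.chain_const (fun x => c x = i) hi (fun t q1 q2 q3 =>
          cA i t (R.ne_r_of_le q2 q3) (hzB j hj t (R.le_trans q2 hm)
            (fun h => q3 (R.le_antisymm q2 (h ▸ hm))) ⟨i, q1⟩) q1
            (fun k hk => hbel t q2 q3 k i hk q1))
        rw [← this]; exact ha i
      exact hik ((hcm i hi).symm.trans (hcm k hk))
    obtain ⟨i, hi⟩ := hz2 j
    refine ⟨i, ?_, hi, fun k hk => huniq k i hk hi⟩
    have := R.chain_const (fun x => c x = i) hi (fun t q1 q2 q3 =>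
      cA i t (R.ne_r_of_le q2 q3) (hzB j hj t q2 q3 ⟨i, q1⟩) q1
        (fun k hk => huniq k i (R.le_trans hk q2) hi))
    rw [← this]; exact ha i
  -- cross shape contradiction
  have hcross : ∀ p1 p2 p3, c p1 ≠ c p2 → c p1 ≠ c p3 → c p2 ≠ c p3 →
      c' p1 ≠ c' p2 → c' p1 ≠ c' p3 → c' p2 ≠ c' p3 → False := by
    intro p1 p2 p3 h1 h2 h3 h4 h5 h6
    rcases hcr p1 with e1 | e1 <;> rcases hcr p2 with e2 | e2 <;> rcases hcr p3 with e3 | e3 <;>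
      first
      | exact h1 (e1.trans e2.symm)
      | exact h2 (e1.trans e3.symm)
      | exact h3 (e2.trans e3.symm)
      | exact h4 (e1.trans e2.symm)
      | exact h5 (e1.trans e3.symm)
      | exact h6 (e2.trans e3.symm)
  have hzinj : ∀ j l, j ≠ l → z j ≠ z l := by
    intro j l h h'
    exact h ((hz3 j).symm.trans (h' ▸ hz3 l))
  obtain ⟨o, ho⟩ : ∃ o, ∀ j, j ≠ o → z j ≠ R.r := by
    by_cases h : ∃ o, z o = R.r
    · obtain ⟨o, ho⟩ := h
      exact ⟨o, fun j hj h => hzinj j o hj (h.trans ho.symm)⟩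
    · push Not at h
      exact ⟨0, fun j _ => h j⟩
  -- incomparability
  have hincz : ∀ j l, j ≠ l → ∀ x, x ≠ R.r → R.le (z j) x → R.le (z l) x → False := by
    intro j l hjl x hx h1 h2
    exact hjl (hmed x hx j l (R.le_trans (hz1 j) h1) (R.le_trans (hz1 l) h2))
  have hdisj : ∀ j l, j ≠ l → z j ≠ R.r → z l ≠ R.r → ∀ i, R.le (a i) (z j) → R.le (a i) (z l) → False := by
    intro j l hjl hj hl i h1 h2
    rcases R.chain h1 h2 with h | h
    · exact hincz j l hjl _ hl h (R.le_refl _)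
    · exact hincz j l hjl _ hj (R.le_refl _) h
  obtain ⟨j, l, hjo, hlo, hjl⟩ : ∃ j l : Fin 3, j ≠ o ∧ l ≠ o ∧ j ≠ l := fin3_two o
  have hzj := ho j hjo
  have hzl := ho l hlo
  by_cases hzo : z o = R.r
  swap
  · obtain ⟨i, hi1, hi2, hi3⟩ := hsing j hzj
    obtain ⟨k, hk1, hk2, hk3⟩ := hsing l hzl
    obtain ⟨q, hq1, hq2, hq3⟩ := hsing o hzo
    refine hcross (z j) (z l) (z o) ?_ ?_ ?_ ?_ ?_ ?_
    · rw [hi1, hk1]; rintro rfl; exact hdisj j l hjl hzj hzl i hi2 hk2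
    · rw [hi1, hq1]; rintro rfl; exact hdisj j o hjo hzj hzo i hi2 hq2
    · rw [hk1, hq1]; rintro rfl; exact hdisj l o hlo hzl hzo k hk2 hq2
    · rw [hz3, hz3]; exact hjl
    · rw [hz3, hz3]; exact hjo
    · rw [hz3, hz3]; exact hlo
  have hcr' : c' R.r = o := hzo ▸ hz3 o
  have hoA : ∀ x, x ≠ R.r → R.le (b o) x → ∀ i, ¬ R.le (a i) x := by
    intro x hx h i hi
    exact hz4 o x h (by rw [hzo]; exact R.le_r x) (by rw [hzo]; exact hx) i hi
  -- main symmetric case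
  have main : ∀ j l i k q : Fin 3, j ≠ o → l ≠ o → j ≠ l → z j ≠ R.r → z l ≠ R.r → i ≠ k → i ≠ q → k ≠ q →
      c (z j) = i → R.le (a i) (z j) → (∀ t, R.le (a t) (z j) → t = i) →
      c (z l) = k → R.le (a k) (z l) → (∀ t, R.le (a t) (z l) → t = k) →
      ∀ x0, x0 ≠ R.r → R.le (a q) x0 → R.le (b j) x0 → False := by
    intro j l i k q hjo hlo hjl hzj hzl hik hiq hkq hi1 hi2 hi3 hk1 hk2 hk3 x0 hx0 hqx hjx
    have hjlo : ∀ t : Fin 3, t = j ∨ t = l ∨ t = o := fin3_three hjl hjo hlo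
    have hikq : ∀ t : Fin 3, t = i ∨ t = k ∨ t = q := fin3_three hik hiq hkq
    have hqz : ¬ R.le (a q) (z j) := fun h => hiq (hi3 q h).symm
    have hzx : R.le (z j) x0 := by
      rcases R.chain (hz1 j) hjx with h | h
      · exact h
      · exact (hqz (R.le_trans hqx h)).elim
    obtain ⟨m, hm1, hm2, hm3, hm4⟩ := R.first (fun t => R.le (a q) t) hzx hqx
    have hmr : m ≠ R.r := R.ne_r_of_le' hm2 hx0
    have hkn : ∀ t, t ≠ R.r → R.le (z j) t → ¬ R.le (a k) t := by
      intro t ht hzt hkt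
      rcases R.chain hkt hk2 with h | h
      · exact hincz j l hjl _ hzl (R.le_trans hzt h) (R.le_refl _)
      · exact hincz j l hjl t ht hzt h
    have hcm : c m = q := by
      have := R.chain_const (fun x => c x = q) hm3 (fun t q1 q2 q3 => by
        have htz : ¬ R.le (z j) t := fun h => hm4 t h q2 q3 q1
        have htz' : ¬ R.le t (z j) := fun h => hqz (R.le_trans q1 h)
        have htr := R.ne_r_of_le q2 q3
        refine cA q t htr ?_ q1 ?_
        · intro y hy
          rcases hjlo y with rfl | rfl | rfl
          · rcases R.chain hy (hz1 y) with h | h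
            · exact htz' h
            · exact htz h
          · exact hjl (hmed m hmr j y (R.le_trans (hz1 j) hm1) (R.le_trans hy q2))
          · exact hoA t htr hy q q1
        · intro y hy
          rcases hikq y with rfl | rfl | rfl
          · rcases R.chain hy hi2 with h | h
            · exact (htz' h).elim
            · exact (htz h).elim
          · exact (hkn m hmr hm1 (R.le_trans hy q2)).elim
          · rfl)
      rw [← this]; exact ha q
    obtain ⟨x, y, hx1, hx2, hx3, hy1, hy2, hxy⟩ : ∃ x y, R.le (z j) x ∧ R.le x m ∧ x ≠ m ∧
        R.le m y ∧ y ≠ R.r ∧ R.bf c c' q j x y = 1 := by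
      by_contra hcon
      have hz0 : ∀ x y, R.le (z j) x → R.le x m → x ≠ m → R.le m y → y ≠ R.r →
          R.bf c c' q j x y = 0 := by
        intro x y h1 h2 h3 h4 h5
        by_contra h6
        exact hcon ⟨x, y, h1, h2, h3, h4, h5, ne_zero2 h6⟩
      have s1 : ∀ x, R.le (z j) x → R.le x m → x ≠ m →
          R.dl c q x * iv (c' m = j) + R.dl c' j x * iv (c m = q) =
          R.dl c q x * iv (c' R.r = j) + R.dl c' j x * iv (c R.r = q) := by
        intro x h1 h2 h3
        refine R.chain_const (fun y => R.dl c q x * iv (c' y = j) + R.dl c' j x * iv (c y = q))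
          (R.le_r m) (fun t q1 _ q3 => ?_)
        have := hz0 x t h1 h2 h3 q1 q3
        apply eq_of_add2
        rw [← this]
        unfold bf dl
        ring
      have s2 := R.chain_const (fun t => iv (c t = q) * (iv (c' m = j) + iv (c' R.r = j)) +
          iv (c' t = j) * (iv (c m = q) + iv (c R.r = q))) hm1 (fun t q1 q2 q3 => by
        have := s1 t q1 q2 q3
        apply eq_of_add2
        have h' : ∀ u v : ZMod 2, u = v → u + v = 0 := by decide
        rw [← h' _ _ this]
        unfold dl
        ring)
      rw [hcm, hi1, hz3, hcr', iv_false hiq, iv_true rfl, iv_true rfl, iv_false (Ne.symm hjo)] at s2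
      rcases em (c' m = j) with e | e
      · rw [iv_true e] at s2
        rcases two_cases (iv (c R.r = q)) with e2 | e2 <;> rw [e2] at s2 <;> exact absurd s2 (by decide)
      · rw [iv_false e] at s2
        by_cases e2 : c R.r = q
        · refine hcross (z j) (z l) R.r ?_ ?_ ?_ ?_ ?_ ?_
          · rwa [hi1, hk1]
          · rwa [hi1, e2]
          · rwa [hk1, e2]
          · rwa [hz3, hz3]
          · rwa [hz3, hcr']
          · rwa [hz3, hcr']
        · rw [iv_false e2] at s2
          exact absurd s2 (by decide)
    have hxr : x ≠ R.r := R.ne_r_of_le' hx2 hmr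
    have hzy : R.le (z j) y := R.le_trans hm1 hy1
    have ax_i : iv (R.le (a i) x) = 1 := iv_true (R.le_trans hi2 hx1)
    have ax_k : iv (R.le (a k) x) = 0 := iv_false (hkn x hxr hx1)
    have ax_q : iv (R.le (a q) x) = 0 := iv_false (hm4 x hx1 hx2 hx3)
    have ay_i : iv (R.le (a i) y) = 1 := iv_true (R.le_trans hi2 hzy)
    have ay_k : iv (R.le (a k) y) = 0 := iv_false (hkn y hy2 hzy)
    have ay_q : iv (R.le (a q) y) = 1 := iv_true (R.le_trans hm3 hy1)
    have bx_j : iv (R.le (b j) x) = 1 := iv_true (R.le_trans (hz1 j) hx1)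
    have by_j : iv (R.le (b j) y) = 1 := iv_true (R.le_trans (hz1 j) hzy)
    have bx_n : ∀ t, t ≠ j → iv (R.le (b t) x) = 0 := fun t ht =>
      iv_false (fun h => ht (hmed x hxr t j h (R.le_trans (hz1 j) hx1)))
    have by_n : ∀ t, t ≠ j → iv (R.le (b t) y) = 0 := fun t ht =>
      iv_false (fun h => ht (hmed y hy2 t j h (R.le_trans (hz1 j) hzy)))
    have hbi : R.bf c c' i j x y = 0 → R.bf c c' k j x y = 0 → False := by
      intro h1 h2
      have := R.bf_sum_left (c := c) (c' := c') hik hiq hkq j x y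
      rw [h1, h2, hxy] at this
      exact absurd this (by decide)
    have hsr : ∀ p, R.bf c c' p l x y = 0 → R.bf c c' p o x y = 0 → R.bf c c' p j x y = 0 := by
      intro p h1 h2
      have := R.bf_sum_right (c := c) (c' := c') hjl hjo hlo p x y
      rw [h1, h2] at this
      simpa using this
    rcases two_cases (K x) with kx | kx <;> rcases two_cases (K y) with ky | ky
    · refine hbi (hsr i ?_ ?_) ?_
      · exact hno i l x y hxr hy2 (by rw [kx, ax_i, bx_n l hjl.symm]; decide)
          (by rw [ky, ay_i, by_n l hjl.symm]; decide)
      · exact hno i o x y hxr hy2 (by rw [kx, ax_i, bx_n o hjo.symm]; decide)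
          (by rw [ky, ay_i, by_n o hjo.symm]; decide)
      · exact hno k j x y hxr hy2 (by rw [kx, ax_k, bx_j]; decide) (by rw [ky, ay_k, by_j]; decide)
    · have := hno q j x y hxr hy2 (by rw [kx, ax_q, bx_j]; decide) (by rw [ky, ay_q, by_j]; decide)
      rw [this] at hxy
      exact absurd hxy (by decide)
    · have := hsr q (hno q l x y hxr hy2 (by rw [kx, ax_q, bx_n l hjl.symm]; decide)
          (by rw [ky, ay_q, by_n l hjl.symm]; decide))
        (hno q o x y hxr hy2 (by rw [kx, ax_q, bx_n o hjo.symm]; decide)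
          (by rw [ky, ay_q, by_n o hjo.symm]; decide))
      rw [this] at hxy
      exact absurd hxy (by decide)
    · refine hbi ?_ (hsr k ?_ ?_)
      · exact hno i j x y hxr hy2 (by rw [kx, ax_i, bx_j]; decide) (by rw [ky, ay_i, by_j]; decide)
      · exact hno k l x y hxr hy2 (by rw [kx, ax_k, bx_n l hjl.symm]; decide)
          (by rw [ky, ay_k, by_n l hjl.symm]; decide)
      · exact hno k o x y hxr hy2 (by rw [kx, ax_k, bx_n o hjo.symm]; decide)
          (by rw [ky, ay_k, by_n o hjo.symm]; decide)
  obtain ⟨i, hi1, hi2, hi3⟩ := hsing j hzj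
  obtain ⟨k, hk1, hk2, hk3⟩ := hsing l hzl
  have hik : i ≠ k := by rintro rfl; exact hdisj j l hjl hzj hzl i hi2 hk2
  obtain ⟨q, hiq, hkq⟩ : ∃ q : Fin 3, i ≠ q ∧ k ≠ q := fin3_third hik
  by_cases hx0 : ∃ x0, x0 ≠ R.r ∧ R.le (a q) x0 ∧ (R.le (b j) x0 ∨ R.le (b l) x0)
  · obtain ⟨x0, h1, h2, h3 | h3⟩ := hx0
    · exact main j l i k q hjo hlo hjl hzj hzl hik hiq hkq hi1 hi2 hi3 hk1 hk2 hk3 x0 h1 h2 h3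
    · exact main l j k i q hlo hjo hjl.symm hzl hzj hik.symm hkq hiq hk1 hk2 hk3 hi1 hi2 hi3 x0 h1 h2 h3
  · push Not at hx0
    have hjlo : ∀ t : Fin 3, t = j ∨ t = l ∨ t = o := fin3_three hjl hjo hlo
    have hikq : ∀ t : Fin 3, t = i ∨ t = k ∨ t = q := fin3_three hik hiq hkq
    have hcq : c R.r = q := by
      have := R.chain_const (fun x => c x = q) (R.le_r (a q)) (fun t q1 _ htr => by
        have hn := hx0 t htr q1
        refine cA q t htr ?_ q1 ?_
        · intro y hy
          rcases hjlo y with rfl | rfl | rfl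
          · exact hn.1 hy
          · exact hn.2 hy
          · exact hoA t htr hy q q1
        · intro y hy
          rcases hikq y with rfl | rfl | rfl
          · rcases R.chain hy hi2 with h | h
            · exact (hi3 q (R.le_trans q1 h)).symm
            · exact (hn.1 (R.le_trans (hz1 j) h)).elim
          · rcases R.chain hy hk2 with h | h
            · exact (hk3 q (R.le_trans q1 h)).symm
            · exact (hn.2 (R.le_trans (hz1 l) h)).elim
          · rfl)
      rw [← this]; exact ha q
    refine hcross (z j) (z l) R.r ?_ ?_ ?_ ?_ ?_ ?_
    · rwa [hi1, hk1]
    · rwa [hi1, hcq]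
    · rwa [hk1, hcq]
    · rwa [hz3, hz3]
    · rwa [hz3, hcr']
    · rwa [hz3, hcr']

end Rt
end RG

namespace RG
variable {V : Type} [Fintype V]

/-- degree parity -/
noncomputable def dg (Γ : Finset (Sym2 V)) (z : V) : ZMod 2 := ∑ e ∈ Γ, iv (z ∈ e)

theorem iv_mem_mk {a b z : V} (h : a ≠ b) : iv (z ∈ s(a, b)) = iv (a = z) + iv (b = z) := by
  by_cases h1 : a = z
  · subst h1
    rw [iv_true (by simp), iv_true rfl, iv_false (Ne.symm h), add_zero]
  · by_cases h2 : b = z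
    · subst h2
      rw [iv_true (by simp), iv_false h1, iv_true rfl, zero_add]
    · rw [iv_false (by simp [Ne.symm h1, Ne.symm h2]), iv_false h1, iv_false h2, add_zero]

theorem handshake (S : Finset V) (Γ : Finset (Sym2 V)) (hS : ∀ e ∈ Γ, In S e)
    (hd : ∀ e ∈ Γ, ¬ e.IsDiag) : ∑ x ∈ S, dg Γ x = 0 := by
  unfold dg
  rw [Finset.sum_comm]
  apply Finset.sum_eq_zero
  intro e he
  have h1 := hS e he
  have h2 := hd e he
  induction e using Sym2.ind with
  | _ a b =>
    rw [Sym2.mk_isDiag_iff] at h2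
    have h1 := In_mk.1 h1
    simp only [iv_mem_mk h2, Finset.sum_add_distrib]
    unfold iv
    rw [Finset.sum_ite_eq S a, Finset.sum_ite_eq S b, if_pos h1.1, if_pos h1.2]
    decide

theorem dg_union {A B : Finset (Sym2 V)} (h : Disjoint A B) (z : V) :
    dg (A ∪ B) z = dg A z + dg B z := Finset.sum_union h

theorem dg_erase {A : Finset (Sym2 V)} {e : Sym2 V} (h : e ∈ A) (z : V) :
    dg (A.erase e) z = dg A z + iv (z ∈ e) := by
  unfold dg
  rw [← Finset.sum_erase_add A _ h, add_assoc, add_self2, add_zero]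

theorem sum_iv_card (S R : Finset V) (hR : R ⊆ S) (he : Even R.card) :
    ∑ x ∈ S, iv (x ∈ R) = 0 := by
  simp only [iv_dec]
  rw [Finset.sum_ite_mem, Finset.inter_eq_right.2 hR]
  simp only [Finset.sum_const, nsmul_eq_mul, mul_one]
  rwa [ZMod.natCast_eq_zero_iff_even]

/-- existence of a rooted spanning tree with root at a median of `b` -/
theorem exists_rt {B : Finset V} {F : Finset (Sym2 V)} (hne : B.Nonempty)
    (hF : ∀ e ∈ F, In B e) (hC : Cn B F)
    (b : Fin 3 → B) : ∃ R : Rt B, (∀ x, x ≠ R.r → s(x.1, (R.par x).1) ∈ F) ∧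
      ∀ x, x ≠ R.r → ∀ j l, R.le (b j) x → R.le (b l) x → j = l := by
  let g : SimpleGraph B :=
    { Adj := fun x y => x ≠ y ∧ s(x.1, y.1) ∈ F
      symm := ⟨fun x y h => ⟨h.1.symm, by rw [Sym2.eq_swap]; exact h.2⟩⟩
      loopless := ⟨fun x h => h.1 rfl⟩ }
  have hpre : ∀ x y : B, g.Reachable x y := by
    intro x y
    let φ : V → ZMod 2 := fun z => iv (∃ h : z ∈ B, g.Reachable x ⟨z, h⟩)
    have hφ : φ ∈ Pot F := by
      intro p q hpq
      have hin := In_mk.1 (hF _ hpq)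
      by_cases hne : p = q
      · rw [hne]
      have hadj : g.Adj ⟨p, hin.1⟩ ⟨q, hin.2⟩ := ⟨fun h => hne (congrArg Subtype.val h), hpq⟩
      simp only [φ]
      congr 1
      apply propext
      constructor
      · rintro ⟨_, h⟩; exact ⟨hin.2, h.trans hadj.reachable⟩
      · rintro ⟨_, h⟩; exact ⟨hin.1, h.trans hadj.symm.reachable⟩
    have h1 := hC φ hφ x.1 x.2 y.1 y.2
    have h2 : φ x.1 = 1 := iv_true ⟨x.2, SimpleGraph.Reachable.refl _⟩
    rw [h2] at h1
    by_contra hcon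
    have : φ y.1 = 0 := iv_false (fun ⟨_, h⟩ => hcon h)
    rw [this] at h1
    exact absurd h1 (by decide)
  have : Nonempty B := ⟨⟨hne.choose, hne.choose_spec⟩⟩
  have hcon : g.Connected := ⟨hpre⟩
  have hpar : ∀ r x : B, x ≠ r → ∃ y, g.Adj x y ∧ g.dist y r + 1 = g.dist x r := by
    intro r x hx
    obtain ⟨p, hp⟩ := hcon.exists_walk_length_eq_dist x r
    cases p with
    | nil => exact (hx rfl).elim
    | @cons _ y _ h p =>
      refine ⟨y, h, ?_⟩
      have h1 := SimpleGraph.dist_le p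
      have h2 : g.dist x r ≤ g.dist x y + g.dist y r := hcon.dist_triangle
      have h3 : g.dist x y = 1 := SimpleGraph.dist_eq_one_iff_adj.2 h
      simp only [SimpleGraph.Walk.length_cons] at hp
      omega
  obtain ⟨r, -, hr⟩ := Finset.exists_min_image (Finset.univ : Finset B)
    (fun r => ∑ j, g.dist (b j) r) ⟨⟨hne.choose, hne.choose_spec⟩, Finset.mem_univ _⟩
  choose par hp1 hp2 using hpar r
  let R : Rt B :=
    { r := r
      par := fun x => if h : x = r then r else par x h
      dep := fun x => g.dist x r
      par_r := by simp
      dep_par := by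
        intro x hx
        simp only [dif_neg hx]
        exact hp2 x hx }
  have hadj : ∀ x, x ≠ r → g.Adj x (R.par x) := by
    intro x hx
    simp only [R, dif_neg hx]
    exact hp1 x hx
  refine ⟨R, fun x hx => (hadj x hx).2, ?_⟩
  have hdist : ∀ x y, R.le x y → g.dist x y + R.dep y ≤ R.dep x := by
    rintro x y ⟨k, hk⟩
    induction k generalizing x with
    | zero =>
      have : x = y := hk
      subst this
      simp
    | succ k ih =>
      rw [Function.iterate_succ_apply] at hk
      have h1 := ih _ hk
      by_cases hx : x = r
      · rw [hx] at h1 ⊢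
        have : R.par r = r := R.par_r
        rwa [this] at h1
      · have h2 := R.dep_par x hx
        have h3 : g.dist x y ≤ g.dist x (R.par x) + g.dist (R.par x) y := hcon.dist_triangle
        have h4 : g.dist x (R.par x) = 1 := SimpleGraph.dist_eq_one_iff_adj.2 (hadj x hx)
        omega
  intro x hx j l hj hl
  by_contra hjl
  obtain ⟨o, ho1, ho2⟩ := fin3_third hjl
  -- child of the root above x
  obtain ⟨y, hy1, -, hy3, hy4⟩ := R.first (fun t => R.par t = R.r) (R.le_r x) R.par_r
  have hyr : y ≠ R.r := by
    intro hyr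
    obtain ⟨t, ht1, ht2, ht3, ht4, ht5⟩ := R.chain_drop (fun t => t ≠ R.r) (R.le_r x) hx
      (by simp)
    exact hy4 t ht1 (hyr ▸ ht2) (hyr ▸ ht3) (not_not.1 ht5)
  have hdy : R.dep y = 1 := by
    have := R.dep_par y hyr
    rw [hy3] at this
    have h0 : R.dep R.r = 0 := SimpleGraph.dist_self
    omega
  have hmin := hr y (Finset.mem_univ _)
  have d1 := hdist (b j) y (R.le_trans hj hy1)
  have d2 := hdist (b l) y (R.le_trans hl hy1)
  have d3 : g.dist (b o) y ≤ g.dist (b o) r + 1 := by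
    have h3 : g.dist (b o) y ≤ g.dist (b o) r + g.dist r y := hcon.dist_triangle
    have h4 : g.dist y r = 1 := hdy
    rw [SimpleGraph.dist_comm] at h4
    omega
  have hsum : ∀ f : Fin 3 → ℕ, ∑ t, f t = f j + f l + f o := by
    intro f
    have hu : (Finset.univ : Finset (Fin 3)) = {j, l, o} := by
      ext t
      have := fin3_three hjl ho1 ho2 t
      simp [this]
    rw [hu, Finset.sum_insert (by simp [hjl, ho1]), Finset.sum_insert (by simp [ho2]),
      Finset.sum_singleton]
    ring
  rw [hsum, hsum] at hmin
  have e1 : R.dep (b j) = g.dist (b j) r := rfl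
  have e2 : R.dep (b l) = g.dist (b l) r := rfl
  omega

namespace Rt
variable {β : Type} [Fintype β] (R : Rt β)

theorem tel (a z : β) : ∑ x, iv (x ≠ R.r ∧ R.le a x) * (iv (x = z) + iv (R.par x = z)) =
    iv (a = z) + iv (R.r = z) := by
  induction h : R.dep a using Nat.strong_induction_on generalizing a with
  | _ n ih =>
    by_cases ha : a = R.r
    · rw [ha, add_self2]
      apply Finset.sum_eq_zero
      intro x _
      rw [iv_false, zero_mul]
      rintro ⟨h1, h2⟩
      exact h1 (R.r_le h2)
    · have hd := R.dep_par a ha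
      have := ih (R.dep (R.par a)) (by omega) (R.par a) rfl
      have hkey : ∀ x, iv (x ≠ R.r ∧ R.le a x) = iv (x ≠ R.r ∧ R.le (R.par a) x) + iv (x = a) := by
        intro x
        by_cases hxa : x = a
        · subst hxa
          rw [iv_true ⟨ha, R.le_refl _⟩, iv_true rfl, iv_false, zero_add]
          rintro ⟨_, h2⟩
          by_cases hpx : R.par x = x
          · rw [hpx] at hd; omega
          · have := R.dep_lt h2 hpx
            omega
        · rw [iv_false hxa, add_zero]
          congr 1
          apply propext
          constructor
          · rintro ⟨h1, h2⟩; exact ⟨h1, R.par_le h2 (Ne.symm hxa)⟩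
          · rintro ⟨h1, h2⟩; exact ⟨h1, R.le_trans (R.le_par a) h2⟩
      simp only [hkey, add_mul, Finset.sum_add_distrib]
      rw [this]
      have h2 : ∑ x, iv (x = a) * (iv (x = z) + iv (R.par x = z)) = iv (a = z) + iv (R.par a = z) := by
        rw [Finset.sum_eq_single a]
        · rw [iv_true rfl, one_mul]
        · intro x _ hx; rw [iv_false hx, zero_mul]
        · intro h; exact (h (Finset.mem_univ _)).elim
      rw [h2]
      have h3 := add_self2 (iv (R.par a = z))
      linear_combination h3

/-- the subtree sums -/
noncomputable def Js (q : β → ZMod 2) (x : β) : ZMod 2 := ∑ z, iv (R.le z x) * q z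

theorem Js_bd (q : β → ZMod 2) (hq : ∑ z, q z = 0) (z : β) :
    ∑ x, iv (x ≠ R.r) * R.Js q x * (iv (x = z) + iv (R.par x = z)) = q z := by
  have : ∀ x, iv (x ≠ R.r) * R.Js q x * (iv (x = z) + iv (R.par x = z)) =
      ∑ a, q a * (iv (x ≠ R.r ∧ R.le a x) * (iv (x = z) + iv (R.par x = z))) := by
    intro x
    unfold Js
    rw [Finset.mul_sum, Finset.sum_mul]
    apply Finset.sum_congr rfl
    intro a _
    have : iv (x ≠ R.r ∧ R.le a x) = iv (x ≠ R.r) * iv (R.le a x) := by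
      unfold iv
      by_cases h1 : x = R.r <;> by_cases h2 : R.le a x <;> simp [h1, h2]
    rw [this]; ring
  simp only [this]
  rw [Finset.sum_comm]
  simp only [← Finset.mul_sum, R.tel]
  simp only [mul_add, Finset.sum_add_distrib]
  rw [← Finset.sum_mul, hq, zero_mul, add_zero, Finset.sum_eq_single z]
  · rw [iv_true rfl, mul_one]
  · intro x _ hx; rw [iv_false hx, mul_zero]
  · intro h; exact (h (Finset.mem_univ _)).elim

theorem Js_add (q q' : β → ZMod 2) (x : β) : R.Js (fun z => q z + q' z) x = R.Js q x + R.Js q' x := by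
  unfold Js
  simp only [mul_add, Finset.sum_add_distrib]

theorem Js_single (a x : β) : R.Js (fun z => iv (a = z)) x = iv (R.le a x) := by
  unfold Js
  beta_reduce
  rw [Finset.sum_eq_single a]
  · rw [iv_true rfl, mul_one]
  · intro y _ hy; rw [iv_false (Ne.symm hy), mul_zero]
  · intro h; exact (h (Finset.mem_univ _)).elim

end Rt

/-- realising a parity function inside `F` -/
theorem exists_join {B : Finset V} {F : Finset (Sym2 V)} (hF : ∀ e ∈ F, In B e) (R : Rt B)
    (hR : ∀ x, x ≠ R.r → s(x.1, (R.par x).1) ∈ F) (q : B → ZMod 2) (hq : ∑ z, q z = 0) :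
    ∃ J ⊆ F, (∀ x, x ≠ R.r → R.Js q x = 1 → s(x.1, (R.par x).1) ∈ J) ∧
      (∀ z : B, dg J z.1 = q z) ∧ ∀ z, z ∉ B → dg J z = 0 := by
  have hpne : ∀ x, x ≠ R.r → x.1 ≠ (R.par x).1 := by
    intro x hx h
    have := R.dep_par x hx
    rw [← Subtype.ext h] at this
    omega
  let I : Finset B := Finset.univ.filter (fun x => x ≠ R.r ∧ R.Js q x = 1)
  have hI : ∀ x, x ∈ I ↔ x ≠ R.r ∧ R.Js q x = 1 := by intro x; simp [I]
  have hJF : I.image (fun x => s(x.1, (R.par x).1)) ⊆ F := by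
    intro e he
    obtain ⟨x, hx, rfl⟩ := Finset.mem_image.1 he
    exact hR x ((hI x).1 hx).1
  refine ⟨I.image (fun x => s(x.1, (R.par x).1)), hJF, ?_, ?_, ?_⟩
  · intro x hx hJ
    exact Finset.mem_image_of_mem _ ((hI x).2 ⟨hx, hJ⟩)
  · intro z
    unfold dg
    rw [Finset.sum_image]
    · rw [← R.Js_bd q hq z, Finset.sum_filter]
      apply Finset.sum_congr rfl
      intro x _
      split_ifs with h
      · rw [iv_mem_mk (hpne x h.1), iv_true h.1, h.2, one_mul, one_mul]
        congr 2 <;> rw [Subtype.ext_iff]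
      · by_cases hx : x = R.r
        · rw [iv_false (not_not.2 hx)]; ring
        · have : R.Js q x = 0 := ne_one2 (fun h' => h ⟨hx, h'⟩)
          rw [this]; ring
    · intro x hx y hy hxy
      have hx := ((hI x).1 hx).1
      have hy := ((hI y).1 hy).1
      rcases Sym2.eq_iff.1 hxy with ⟨h, _⟩ | ⟨h1, h2⟩
      · exact Subtype.ext h
      · have d1 := R.dep_par x hx
        have d2 := R.dep_par y hy
        rw [Subtype.ext h2] at d1
        rw [← Subtype.ext h1] at d2
        omega
  · intro z hz
    unfold dg
    apply Finset.sum_eq_zero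
    intro e he
    exact iv_false (fun h => hz (hF e (hJF he) z h))

/-- assembling a subgraph with prescribed parities -/
theorem assemble {S Z R : Finset V} {T F T' : Finset (Sym2 V)} (hZS : Z ⊆ S)
    (hTS : ∀ e ∈ T, In S e) (hTd : ∀ e ∈ T, ¬ e.IsDiag) (hdis : Disjoint T F)
    (hF : ∀ e ∈ F, In (S \ Z) e) (hT' : T' ⊆ T) (hRS : R ⊆ S) (hRe : Even R.card)
    (hZ : ∀ z ∈ Z, dg T' z = iv (z ∈ R)) (ρ : Rt ↥(S \ Z))
    (hρ : ∀ x, x ≠ ρ.r → s(x.1, (ρ.par x).1) ∈ F) :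
    ∃ J ⊆ F, (∀ x, x ≠ ρ.r → ρ.Js (fun z => iv (z.1 ∈ R) + dg T' z.1) x = 1 →
      s(x.1, (ρ.par x).1) ∈ J) ∧ ∀ z ∈ S, dg (T' ∪ J) z = iv (z ∈ R) := by
  obtain ⟨J, hJF, h1, h2, h3⟩ := exists_join hF ρ hρ (fun z => iv (z.1 ∈ R) + dg T' z.1) (by
    have e1 := sum_iv_card S R hRS hRe
    have e2 := handshake S T' (fun e he => hTS e (hT' he)) (fun e he => hTd e (hT' he))
    have e3 : ∑ x ∈ S, (iv (x ∈ R) + dg T' x) = 0 := by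
      rw [Finset.sum_add_distrib, e1, e2, add_zero]
    rw [← Finset.sum_sdiff hZS] at e3
    have e4 : ∑ x ∈ Z, (iv (x ∈ R) + dg T' x) = 0 := by
      apply Finset.sum_eq_zero
      intro x hx
      rw [hZ x hx, add_self2]
    rw [e4, add_zero] at e3
    rw [Finset.sum_coe_sort (S \ Z) (fun z => iv (z ∈ R) + dg T' z)]
    exact e3)
  refine ⟨J, hJF, h1, ?_⟩
  intro z hz
  rw [dg_union (Finset.disjoint_of_subset_left hT' (Finset.disjoint_of_subset_right hJF hdis))]
  by_cases hzZ : z ∈ Z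
  · rw [h3 z (by simp [hzZ]), hZ z hzZ, add_zero]
  · have := h2 ⟨z, by simp [hz, hzZ]⟩
    simp only at this
    rw [this]
    have := add_self2 (dg T' z)
    linear_combination this

/-- the `T`-neighbours of `v` are `a 0, a 1, a 2` -/
def Star3 (T : Finset (Sym2 V)) (v : V) (a : Fin 3 → V) : Prop :=
  Function.Injective a ∧ ∀ y, s(v, y) ∈ T ↔ ∃ i, y = a i

/-- classes of `T - v` -/
def Cls (T : Finset (Sym2 V)) (v : V) (a : Fin 3 → V) (c : V → Fin 3) : Prop :=
  (∀ i, c (a i) = i) ∧ ∀ x y, s(x, y) ∈ T → x ≠ v → y ≠ v → c x = c y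

theorem exists_cls {S : Finset V} {T : Finset (Sym2 V)} {v : V} {a : Fin 3 → V}
    (hC : Cn S T) (hc : T.card + 1 = S.card) (hst : Star3 T v a) : ∃ c, Cls T v a c := by
  obtain ⟨ρ, h1, h2, -⟩ := exists_rep (T.filter (fun e => v ∉ e))
  have hinj : ∀ i k, ρ (a i) = ρ (a k) → i = k := by
    intro i k hik
    by_contra hne
    have hmem : s(v, a i) ∈ T := (hst.2 _).2 ⟨i, rfl⟩
    have hmem' : s(v, a k) ∈ T := (hst.2 _).2 ⟨k, rfl⟩
    have : Cn S (T.erase s(v, a i)) := by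
      intro φ hφ
      apply hC φ
      have hφ0 : φ ∈ Pot (T.filter (fun e => v ∉ e)) := by
        refine Pot_anti ?_ hφ
        intro e he
        rw [Finset.mem_filter] at he
        rw [Finset.mem_erase]
        exact ⟨fun h => he.2 (by rw [h]; simp), he.1⟩
      have hak : s(v, a k) ∈ T.erase s(v, a i) := by
        rw [Finset.mem_erase]
        refine ⟨fun h => ?_, hmem'⟩
        rw [Sym2.congr_right] at h
        exact hne (hst.1 h.symm)
      have hva : φ v = φ (a i) := by
        rw [hφ v (a k) hak, ← h1 φ hφ0, ← hik, h1 φ hφ0]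
      intro x y hxy
      by_cases he : s(x, y) = s(v, a i)
      · rcases Sym2.eq_iff.1 he with ⟨rfl, rfl⟩ | ⟨rfl, rfl⟩
        · exact hva
        · exact hva.symm
      · exact hφ x y (Finset.mem_erase.2 ⟨he, hxy⟩)
    have := this.card_ge
    rw [Finset.card_erase_of_mem hmem] at this
    have hpos : 0 < T.card := Finset.card_pos.2 ⟨_, hmem⟩
    omega
  let c : V → Fin 3 := fun x => if h : ∃ i, ρ x = ρ (a i) then h.choose else 0
  refine ⟨c, ?_, ?_⟩
  · intro i
    have h : ∃ k, ρ (a i) = ρ (a k) := ⟨i, rfl⟩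
    simp only [c, dif_pos h]
    exact (hinj _ _ h.choose_spec).symm
  · intro x y hxy hx hy
    have : ρ x = ρ y := h2 x y (by
      rw [Finset.mem_filter]
      refine ⟨hxy, ?_⟩
      simp [Ne.symm hx, Ne.symm hy])
    simp only [c, this]

theorem Star3.dg {T : Finset (Sym2 V)} {v : V} {a : Fin 3 → V} (h : Star3 T v a) : dg T v = 1 := by
  have h1 : RG.dg T v = ∑ e ∈ Finset.univ.image (fun i => s(v, a i)), iv (v ∈ e) := by
    unfold RG.dg
    symm
    apply Finset.sum_subset
    · intro e he
      obtain ⟨i, _, rfl⟩ := Finset.mem_image.1 he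
      exact (h.2 _).2 ⟨i, rfl⟩
    · intro e he hn
      apply iv_false
      intro hv
      obtain ⟨y, rfl⟩ := Sym2.mem_iff_exists.1 hv
      obtain ⟨i, rfl⟩ := (h.2 y).1 he
      exact hn (Finset.mem_image_of_mem _ (Finset.mem_univ i))
  rw [h1, Finset.sum_image]
  · have : ∀ i, iv (v ∈ s(v, a i)) = 1 := fun i => iv_true (by simp)
    simp only [this]
    decide
  · intro i _ k _ hik
    simp only [Sym2.congr_right] at hik
    exact h.1 hik

/-- change of the class indicator along edges of `T` -/
theorem cls_change {T : Finset (Sym2 V)} {v : V} {a : Fin 3 → V} {c : V → Fin 3}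
    (hd : ∀ e ∈ T, ¬ e.IsDiag)
    (hst : Star3 T v a) (hc : Cls T v a c) (i : Fin 3) (x y : V) (hxy : s(x, y) ∈ T) :
    iv (x ≠ v ∧ c x = i) + iv (y ≠ v ∧ c y = i) = iv (s(x, y) = s(v, a i)) := by
  have hxyne : x ≠ y := by
    have := hd _ hxy
    rwa [Sym2.mk_isDiag_iff] at this
  have key : ∀ y, s(v, y) ∈ T → y ≠ v → iv (v ≠ v ∧ c v = i) + iv (y ≠ v ∧ c y = i) =
      iv (s(v, y) = s(v, a i)) := by
    intro y hy hyv
    rw [iv_false (p := v ≠ v ∧ c v = i) (by simp), zero_add]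
    congr 1
    apply propext
    rw [Sym2.congr_right]
    obtain ⟨k, rfl⟩ := (hst.2 y).1 hy
    rw [hc.1 k]
    constructor
    · rintro ⟨_, rfl⟩; rfl
    · intro h; exact ⟨hyv, hst.1 h⟩
  by_cases hx : x = v
  · subst hx
    exact key y hxy (Ne.symm hxyne)
  by_cases hy : y = v
  · subst hy
    rw [add_comm, Sym2.eq_swap]
    exact key x (by rwa [Sym2.eq_swap]) hxyne
  rw [hc.2 x y hxy hx hy, iv_false (p := s(x, y) = s(v, a i))]
  · simp only [ne_eq, hx, hy, not_false_eq_true, true_and]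
    exact add_self2 _
  · intro h
    rcases Sym2.eq_iff.1 h with ⟨h, _⟩ | ⟨_, h⟩
    · exact hx h
    · exact hy h

end RG

namespace RG
variable {V : Type} [Fintype V]

/-- the subgraph of `E` induced by `S` is collapsible -/
def Coll (E : Finset (Sym2 V)) (S : Finset V) : Prop :=
  ∀ R ⊆ S, Even R.card → ∃ Γ ⊆ E, (∀ e ∈ Γ, In S e) ∧ Cn S Γ ∧ ∀ x ∈ S, dg Γ x = iv (x ∈ R)

/-- a decomposition into a spanning tree and a connected graph avoiding `Z` -/
structure Dec (S Z : Finset V) (T F : Finset (Sym2 V)) : Prop where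
  hZS : Z ⊆ S
  hTS : ∀ e ∈ T, In S e
  hTd : ∀ e ∈ T, ¬ e.IsDiag
  hdis : Disjoint T F
  hF : ∀ e ∈ F, In (S \ Z) e
  hne : (S \ Z).Nonempty
  hcT : Cn S T
  hcF : Cn (S \ Z) F
  hcard : T.card + 1 = S.card

/-- the conclusion for one set `R` -/
def Good (S : Finset V) (E : Finset (Sym2 V)) (R : Finset V) : Prop :=
  ∃ Γ ⊆ E, (∀ e ∈ Γ, In S e) ∧ Cn S Γ ∧ ∀ x ∈ S, dg Γ x = iv (x ∈ R)

variable {S Z R : Finset V} {T F : Finset (Sym2 V)}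

theorem Dec.finish (h : Dec S Z T F) {T' J : Finset (Sym2 V)} (hT' : T' ⊆ T) (hJ : J ⊆ F)
    (hc : Cn S (T' ∪ J)) (hd : ∀ z ∈ S, dg (T' ∪ J) z = iv (z ∈ R)) : Good S (T ∪ F) R := by
  refine ⟨T' ∪ J, Finset.union_subset_union hT' hJ, ?_, hc, hd⟩
  intro e he
  rcases Finset.mem_union.1 he with he | he
  · exact h.hTS e (hT' he)
  · exact (h.hF e (hJ he)).mono Finset.sdiff_subset

theorem Dec.drop0 (h : Dec S Z T F) (hRS : R ⊆ S) (hRe : Even R.card)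
    (hZ : ∀ z ∈ Z, dg T z = iv (z ∈ R)) : Good S (T ∪ F) R := by
  obtain ⟨x, hx⟩ := h.hne
  obtain ⟨ρ, hρ, -⟩ := exists_rt h.hne h.hF h.hcF (fun _ => ⟨x, hx⟩)
  obtain ⟨J, hJ, -, hd⟩ := assemble h.hZS h.hTS h.hTd h.hdis h.hF (Finset.Subset.refl T) hRS hRe hZ ρ hρ
  exact h.finish (Finset.Subset.refl T) hJ (h.hcT.mono Finset.subset_union_left) hd

theorem Dec.drop1 (h : Dec S Z T F) (hRS : R ⊆ S) (hRe : Even R.card) {v : V} (hv : v ∈ Z)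
    (hvR : v ∉ R) {a : Fin 3 → V} (hst : Star3 T v a) (haB : ∀ i, a i ∈ S \ Z)
    (hZ : ∀ z ∈ Z, z ≠ v → dg T z = iv (z ∈ R)) : Good S (T ∪ F) R := by
  obtain ⟨c, hc⟩ := exists_cls h.hcT h.hcard hst
  let aa : Fin 3 → ↥(S \ Z) := fun i => ⟨a i, haB i⟩
  obtain ⟨ρ, hρ, -⟩ := exists_rt h.hne h.hF h.hcF aa
  have hvB : ∀ z : ↥(S \ Z), z.1 ≠ v := by
    intro z hz
    have := (Finset.mem_sdiff.1 z.2).2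
    rw [hz] at this
    exact this hv
  obtain ⟨i, x, hxr, hJx, hdx⟩ := ρ.lemma1 (fun z => c z.1) aa (fun i => hc.1 i)
    (ρ.Js (fun z => iv (z.1 ∈ R) + dg T z.1))
  have hmem : s(v, a i) ∈ T := (hst.2 _).2 ⟨i, rfl⟩
  have hva : v ≠ a i := fun h => hvB (aa i) h.symm
  have hT' : T.erase s(v, a i) ⊆ T := Finset.erase_subset _ _
  obtain ⟨J, hJ, hJm, hd⟩ := assemble h.hZS h.hTS h.hTd h.hdis h.hF hT' hRS hRe (by
    intro z hz
    rw [dg_erase hmem]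
    by_cases hzv : z = v
    · rw [hzv, hst.dg, iv_true (by simp), iv_false hvR]; decide
    · rw [hZ z hz hzv, iv_false (p := z ∈ s(v, a i)), add_zero]
      rw [Sym2.mem_iff]
      rintro (h1 | h1)
      · exact hzv h1
      · rw [h1] at hz; exact (Finset.mem_sdiff.1 (haB i)).2 hz) ρ hρ
  refine h.finish hT' hJ ?_ hd
  have hfun : (fun z : ↥(S \ Z) => iv (z.1 ∈ R) + dg (T.erase s(v, a i)) z.1) =
      fun z => (iv (z.1 ∈ R) + dg T z.1) + iv (aa i = z) := by
    funext z
    have hsub : iv (a i = z.1) = iv (aa i = z) := by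
      congr 1; exact propext ⟨fun h => Subtype.ext h, fun h => congrArg Subtype.val h⟩
    rw [dg_erase hmem, iv_mem_mk hva, iv_false (Ne.symm (hvB z)), zero_add, ← add_assoc, hsub]
  have hxm := hJm x hxr (by
    rw [hfun, ρ.Js_add, ρ.Js_single]; exact hJx)
  intro φ hφ
  set lam := φ v + φ (a i) with hlam
  have hψ : (fun z => φ z + lam * iv (z ≠ v ∧ c z = i)) ∈ Pot T := by
    intro p q hpq
    beta_reduce
    have hch := cls_change h.hTd hst hc i p q hpq
    apply eq_of_add2
    have : φ p + lam * iv (p ≠ v ∧ c p = i) + (φ q + lam * iv (q ≠ v ∧ c q = i)) =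
        φ p + φ q + lam * iv (s(p, q) = s(v, a i)) := by rw [← hch]; ring
    rw [this]
    by_cases he : s(p, q) = s(v, a i)
    · rw [iv_true he, mul_one]
      rcases Sym2.eq_iff.1 he with ⟨h1, h2⟩ | ⟨h1, h2⟩
      · rw [h1, h2]; exact add_self2 _
      · rw [h1, h2, hlam, add_comm (φ (a i))]; exact add_self2 _
    · rw [iv_false he, mul_zero, add_zero, hφ p q (Finset.mem_union_left _ (Finset.mem_erase.2 ⟨he, hpq⟩))]
      exact add_self2 _
  have hconst := h.hcT _ hψ
  have hxS : ∀ z : ↥(S \ Z), z.1 ∈ S := fun z => (Finset.mem_sdiff.1 z.2).1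
  have h0 : lam = 0 := by
    have e1 := hconst x.1 (hxS x) (ρ.par x).1 (hxS _)
    have e2 := hφ _ _ (Finset.mem_union_right _ hxm)
    have e3 : iv (c x.1 = i) + iv (c (ρ.par x).1 = i) = 1 := hdx
    simp only [ne_eq, hvB x, hvB (ρ.par x), not_false_eq_true, true_and] at e1
    rw [e2] at e1
    have e4 : lam * (iv (c x.1 = i) + iv (c (ρ.par x).1 = i)) = 0 := by
      have h2 := add_left_cancel e1
      rw [mul_add, h2]; exact add_self2 _
    rwa [e3, mul_one] at e4
  intro p hp q hq
  have := hconst p hp q hq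
  simpa [h0] using this

theorem Dec.drop2 {v w : V} (h : Dec S {v, w} T F) (hRS : R ⊆ S) (hRe : Even R.card) (hvw : v ≠ w)
    (hvR : v ∉ R) (hwR : w ∉ R) {a b : Fin 3 → V} (hst : Star3 T v a) (hst' : Star3 T w b)
    (haB : ∀ i, a i ∈ S \ {v, w}) (hbB : ∀ i, b i ∈ S \ {v, w}) : Good S (T ∪ F) R := by
  obtain ⟨c, hc⟩ := exists_cls h.hcT h.hcard hst
  obtain ⟨c', hc'⟩ := exists_cls h.hcT h.hcard hst'
  let aa : Fin 3 → ↥(S \ {v, w}) := fun i => ⟨a i, haB i⟩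
  let bb : Fin 3 → ↥(S \ {v, w}) := fun i => ⟨b i, hbB i⟩
  obtain ⟨ρ, hρ, hmed⟩ := exists_rt h.hne h.hF h.hcF bb
  have hvB : ∀ z : ↥(S \ {v, w}), z.1 ≠ v := by
    intro z hz
    have := (Finset.mem_sdiff.1 z.2).2
    rw [hz] at this
    simp at this
  have hwB : ∀ z : ↥(S \ {v, w}), z.1 ≠ w := by
    intro z hz
    have := (Finset.mem_sdiff.1 z.2).2
    rw [hz] at this
    simp at this
  have hxS : ∀ z : ↥(S \ {v, w}), z.1 ∈ S := fun z => (Finset.mem_sdiff.1 z.2).1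
  have hvS : v ∈ S := h.hZS (by simp)
  have hmema : ∀ i, s(v, a i) ∈ T := fun i => (hst.2 _).2 ⟨i, rfl⟩
  have hmemb : ∀ i, s(w, b i) ∈ T := fun i => (hst'.2 _).2 ⟨i, rfl⟩
  have hν : ∀ j, c (b j) = c w := fun j => (hc.2 w (b j) (hmemb j) hvw.symm (hvB (bb j))).symm
  have hμ : ∀ i, c' (a i) = c' v := fun i => (hc'.2 v (a i) (hmema i) hvw (hwB (aa i))).symm
  have hcr : ∀ x : ↥(S \ {v, w}), c x.1 = c w ∨ c' x.1 = c' v := by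
    intro x
    by_contra hcon
    push Not at hcon
    let φ : V → ZMod 2 := fun z => iv (z ≠ v ∧ z ≠ w ∧ c z = c x.1 ∧ c' z = c' x.1)
    have hstep : ∀ p q, s(p, q) ∈ T → (p ≠ v ∧ p ≠ w ∧ c p = c x.1 ∧ c' p = c' x.1) →
        (q ≠ v ∧ q ≠ w ∧ c q = c x.1 ∧ c' q = c' x.1) := by
      rintro p q hpq ⟨h1, h2, h3, h4⟩
      have hqv : q ≠ v := by
        rintro rfl
        exact hcon.2 (h4 ▸ hc'.2 p q hpq h2 hvw)
      have hqw : q ≠ w := by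
        rintro rfl
        exact hcon.1 (h3 ▸ hc.2 p q hpq h1 hvw.symm)
      exact ⟨hqv, hqw, (hc.2 p q hpq h1 hqv) ▸ h3, (hc'.2 p q hpq h2 hqw) ▸ h4⟩
    have hφ : φ ∈ Pot T := by
      intro p q hpq
      simp only [φ]
      congr 1
      exact propext ⟨hstep p q hpq, hstep q p (by rwa [Sym2.eq_swap])⟩
    have h1 := h.hcT φ hφ x.1 (hxS x) v hvS
    have h2 : φ x.1 = 1 := iv_true ⟨hvB x, hwB x, rfl, rfl⟩
    have h3 : φ v = 0 := iv_false (by simp)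
    rw [h2, h3] at h1
    exact absurd h1 (by decide)
  obtain ⟨i, j, x, y, hxr, hyr, hJx, hJy, hbf⟩ := ρ.lemma2 (fun z => c z.1) (fun z => c' z.1) aa bb
    (c w) (c' v) (fun i => hc.1 i) (fun i => hc'.1 i) (fun j => hν j) (fun i => hμ i) hcr hmed
    (ρ.Js (fun z => iv (z.1 ∈ R) + dg T z.1))
  have hva : v ≠ a i := fun h => hvB (aa i) h.symm
  have hwb : w ≠ b j := fun h => hwB (bb j) h.symm
  have hef : s(w, b j) ≠ s(v, a i) := by
    intro h
    rcases Sym2.eq_iff.1 h with ⟨h, _⟩ | ⟨h, _⟩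
    · exact hvw h.symm
    · exact hwB (aa i) h.symm
  have hmem2 : s(w, b j) ∈ T.erase s(v, a i) := Finset.mem_erase.2 ⟨hef, hmemb j⟩
  have hT' : (T.erase s(v, a i)).erase s(w, b j) ⊆ T :=
    (Finset.erase_subset _ _).trans (Finset.erase_subset _ _)
  have hdgT' : ∀ z, dg ((T.erase s(v, a i)).erase s(w, b j)) z =
      dg T z + (iv (v = z) + iv (a i = z)) + (iv (w = z) + iv (b j = z)) := by
    intro z
    rw [dg_erase hmem2, dg_erase (hmema i), iv_mem_mk hva, iv_mem_mk hwb]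
  obtain ⟨J, hJ, hJm, hd⟩ := assemble h.hZS h.hTS h.hTd h.hdis h.hF hT' hRS hRe (by
    intro z hz
    rw [hdgT']
    simp only [Finset.mem_insert, Finset.mem_singleton] at hz
    rcases hz with rfl | rfl
    · rw [hst.dg, iv_true rfl, iv_false hva.symm, iv_false hvw.symm, iv_false (hvB (bb j)),
        iv_false hvR]; decide
    · rw [hst'.dg, iv_true rfl, iv_false hvw, iv_false (hwB (aa i)), iv_false hwb.symm,
        iv_false hwR]; decide) ρ hρ
  refine h.finish hT' hJ ?_ hd
  have hfun : (fun z : ↥(S \ {v, w}) =>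
      iv (z.1 ∈ R) + dg ((T.erase s(v, a i)).erase s(w, b j)) z.1) =
      fun z => ((iv (z.1 ∈ R) + dg T z.1) + iv (aa i = z)) + iv (bb j = z) := by
    funext z
    have hsub : iv (a i = z.1) = iv (aa i = z) := by
      congr 1; exact propext ⟨fun h => Subtype.ext h, fun h => congrArg Subtype.val h⟩
    have hsub' : iv (b j = z.1) = iv (bb j = z) := by
      congr 1; exact propext ⟨fun h => Subtype.ext h, fun h => congrArg Subtype.val h⟩
    rw [hdgT', iv_false (Ne.symm (hvB z)), iv_false (Ne.symm (hwB z)), zero_add, zero_add,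
      ← add_assoc, ← add_assoc, hsub, hsub']
  have hJs : ∀ x, ρ.Js (fun z : ↥(S \ {v, w}) =>
      iv (z.1 ∈ R) + dg ((T.erase s(v, a i)).erase s(w, b j)) z.1) x =
      ρ.Js (fun z => iv (z.1 ∈ R) + dg T z.1) x + iv (ρ.le (aa i) x) + iv (ρ.le (bb j) x) := by
    intro x
    rw [hfun, ρ.Js_add, ρ.Js_single, ρ.Js_add, ρ.Js_single]
  have hxm := hJm x hxr (by rw [hJs]; exact hJx)
  have hym := hJm y hyr (by rw [hJs]; exact hJy)
  intro φ hφ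
  set lam := φ v + φ (a i) with hlam
  set kap := φ w + φ (b j) with hkap
  have hψ : (fun z => φ z + lam * iv (z ≠ v ∧ c z = i) + kap * iv (z ≠ w ∧ c' z = j)) ∈ Pot T := by
    intro p q hpq
    beta_reduce
    have hch := cls_change h.hTd hst hc i p q hpq
    have hch' := cls_change h.hTd hst' hc' j p q hpq
    apply eq_of_add2
    have : φ p + lam * iv (p ≠ v ∧ c p = i) + kap * iv (p ≠ w ∧ c' p = j) +
        (φ q + lam * iv (q ≠ v ∧ c q = i) + kap * iv (q ≠ w ∧ c' q = j)) =
        φ p + φ q + lam * iv (s(p, q) = s(v, a i)) + kap * iv (s(p, q) = s(w, b j)) := by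
      rw [← hch, ← hch']; ring
    rw [this]
    by_cases he : s(p, q) = s(v, a i)
    · rw [iv_true he, iv_false (fun h => hef (h.symm.trans he)), mul_one, mul_zero, add_zero]
      rcases Sym2.eq_iff.1 he with ⟨h1, h2⟩ | ⟨h1, h2⟩
      · rw [h1, h2]; exact add_self2 _
      · rw [h1, h2, hlam, add_comm (φ (a i))]; exact add_self2 _
    · rw [iv_false he, mul_zero, add_zero]
      by_cases hf : s(p, q) = s(w, b j)
      · rw [iv_true hf, mul_one]
        rcases Sym2.eq_iff.1 hf with ⟨h1, h2⟩ | ⟨h1, h2⟩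
        · rw [h1, h2]; exact add_self2 _
        · rw [h1, h2, hkap, add_comm (φ (b j))]; exact add_self2 _
      · rw [iv_false hf, mul_zero, add_zero, hφ p q (Finset.mem_union_left _
          (Finset.mem_erase.2 ⟨hf, Finset.mem_erase.2 ⟨he, hpq⟩⟩))]
        exact add_self2 _
  have hconst := h.hcT _ hψ
  have heq : ∀ x : ↥(S \ {v, w}), s(x.1, (ρ.par x).1) ∈ J →
      lam * ρ.dl (fun z => c z.1) i x + kap * ρ.dl (fun z => c' z.1) j x = 0 := by
    intro x hxm
    have e1 := hconst x.1 (hxS x) (ρ.par x).1 (hxS _)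
    have e2 := hφ _ _ (Finset.mem_union_right _ hxm)
    simp only [ne_eq, hvB x, hvB (ρ.par x), hwB x, hwB (ρ.par x), not_false_eq_true, true_and] at e1
    rw [e2, add_assoc, add_assoc] at e1
    have h2 := add_left_cancel e1
    unfold Rt.dl
    have h3 := add_self2 (lam * iv (c (ρ.par x).1 = i) + kap * iv (c' (ρ.par x).1 = j))
    linear_combination h2 + h3
  have ex := heq x hxm
  have ey := heq y hym
  have h00 : lam = 0 ∧ kap = 0 := by
    unfold Rt.bf at hbf
    revert hbf ex ey
    generalize ρ.dl (fun z => c z.1) i x = d1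
    generalize ρ.dl (fun z => c z.1) i y = d2
    generalize ρ.dl (fun z => c' z.1) j x = d3
    generalize ρ.dl (fun z => c' z.1) j y = d4
    clear_value lam kap
    clear * -
    revert lam kap d1 d2 d3 d4
    decide
  intro p hp q hq
  have := hconst p hp q hq
  simpa [h00.1, h00.2] using this

theorem Dec.coll0 (h : Dec S ∅ T F) : Coll (T ∪ F) S :=
  fun _ hR he => h.drop0 hR he (by simp)

theorem Dec.coll1 {v : V} (h : Dec S {v} T F) {a : Fin 3 → V} (hst : Star3 T v a)
    (haB : ∀ i, a i ∈ S \ {v}) : Coll (T ∪ F) S := by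
  intro R hR he
  by_cases hv : v ∈ R
  · refine h.drop0 hR he ?_
    intro z hz
    rw [Finset.mem_singleton.1 hz, hst.dg, iv_true hv]
  · refine h.drop1 hR he (v := v) (by simp) hv hst haB ?_
    intro z hz hzv
    exact (hzv (Finset.mem_singleton.1 hz)).elim

theorem Dec.coll2 {v w : V} (h : Dec S {v, w} T F) (hvw : v ≠ w) {a b : Fin 3 → V}
    (hst : Star3 T v a) (hst' : Star3 T w b)
    (haB : ∀ i, a i ∈ S \ {v, w}) (hbB : ∀ i, b i ∈ S \ {v, w}) : Coll (T ∪ F) S := by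
  intro R hR he
  by_cases hv : v ∈ R <;> by_cases hw : w ∈ R
  · refine h.drop0 hR he ?_
    intro z hz
    simp only [Finset.mem_insert, Finset.mem_singleton] at hz
    rcases hz with rfl | rfl
    · rw [hst.dg, iv_true hv]
    · rw [hst'.dg, iv_true hw]
  · refine h.drop1 hR he (v := w) (by simp) hw hst' hbB ?_
    intro z hz hzv
    simp only [Finset.mem_insert, Finset.mem_singleton] at hz
    rcases hz with rfl | rfl
    · rw [hst.dg, iv_true hv]
    · exact (hzv rfl).elim
  · refine h.drop1 hR he (v := v) (by simp) hv hst haB ?_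
    intro z hz hzv
    simp only [Finset.mem_insert, Finset.mem_singleton] at hz
    rcases hz with rfl | rfl
    · exact (hzv rfl).elim
    · rw [hst'.dg, iv_true hw]
  · exact h.drop2 hR he hvw hv hw hst hst' haB hbB

end RG

namespace RG
variable {V : Type} [Fintype V]

/-- xor of the first `n` values -/
def xr (g : ℕ → Bool) : ℕ → Bool
  | 0 => false
  | n + 1 => xor (xr g n) (g n)

theorem xr_sum (g : ℕ → Bool) (n : ℕ) :
    ∑ i ∈ Finset.range n, iv (g i = true) = iv (xr g n = true) := by
  induction n with
  | zero => simp [xr, iv]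
  | succ n ih =>
    rw [Finset.sum_range_succ, ih, xr]
    cases xr g n <;> cases g n <;> simp [iv]; decide

/-- brute force test for collapsibility of a small graph -/
def chk (k n : ℕ) (src tgt : ℕ → ℕ) : Bool :=
  (List.range (2 ^ k)).all fun r => (xr r.testBit k) ||
    (List.range (2 ^ n)).any fun m =>
      ((List.range k).all fun i =>
        (xr (fun j => m.testBit j && (src j == i || tgt j == i)) n == r.testBit i)) &&
      ((List.range (2 ^ k)).all fun p =>
        ((List.range n).any fun j => m.testBit j && (p.testBit (src j) != p.testBit (tgt j))) ||
        ((List.range k).all fun i => p.testBit i == p.testBit 0))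

theorem exists_bits (k : ℕ) (P : ℕ → Prop) :
    ∃ r < 2 ^ k, ∀ i < k, (r.testBit i = true ↔ P i) := by
  refine ⟨Nat.ofBits (fun i : Fin k => decide (P i.1)), Nat.ofBits_lt_two_pow _, ?_⟩
  intro i hi
  rw [Nat.testBit_ofBits_lt _ _ hi]
  simp

theorem iv_congr {p q : Prop} (h : p ↔ q) : iv p = iv q := by rw [propext h]

theorem coll_small (k n : ℕ) (src tgt : ℕ → ℕ) (hchk : chk k n src tgt = true)
    (hs : ∀ j < n, src j < k ∧ tgt j < k ∧ src j ≠ tgt j)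
    (hinj : ∀ i < n, ∀ j < n, s(src i, tgt i) = s(src j, tgt j) → i = j)
    (f : ℕ → V) (hf : ∀ i < k, ∀ j < k, f i = f j → i = j) {E : Finset (Sym2 V)}
    (hE : ∀ j < n, s(f (src j), f (tgt j)) ∈ E) :
    Coll E ((Finset.range k).image f) := by
  intro R hRS hRe
  obtain ⟨r, hr, hrR⟩ := exists_bits k (fun i => f i ∈ R)
  have hinjk : Set.InjOn f (Finset.range k) := by
    intro i hi j hj h
    exact hf i (by simpa using hi) j (by simpa using hj) h
  have hx : xr r.testBit k = false := by
    have h1 := xr_sum r.testBit k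
    have h2 : ∑ i ∈ Finset.range k, iv (r.testBit i = true) = (R.card : ZMod 2) := by
      have h3 : R = ((Finset.range k).filter (fun i => f i ∈ R)).image f := by
        ext z
        simp only [Finset.mem_image, Finset.mem_filter, Finset.mem_range]
        constructor
        · intro hz
          obtain ⟨i, hi, rfl⟩ := Finset.mem_image.1 (hRS hz)
          exact ⟨i, ⟨by simpa using hi, hz⟩, rfl⟩
        · rintro ⟨i, ⟨_, hi⟩, rfl⟩; exact hi
      have h4 : R.card = ((Finset.range k).filter (fun i => f i ∈ R)).card := by
        conv_lhs => rw [h3]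
        rw [Finset.card_image_of_injOn]
        exact hinjk.mono (by intro x hx; simp at hx ⊢; exact hx.1)
      rw [h4, Finset.card_filter]
      push_cast
      refine Finset.sum_congr rfl fun i hi => ?_
      rw [iv_congr (hrR i (by simpa using hi))]
      by_cases hq : f i ∈ R
      · rw [iv_true hq, if_pos hq]
      · rw [iv_false hq, if_neg hq]
    have h0 : (R.card : ZMod 2) = 0 := (ZMod.natCast_eq_zero_iff_even).2 hRe
    rw [h2, h0] at h1
    by_contra hne
    rw [iv_true (by simpa using hne)] at h1
    exact absurd h1 (by decide)
  unfold chk at hchk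
  have hc := List.all_eq_true.1 hchk r (List.mem_range.2 hr)
  rw [hx, Bool.false_or, List.any_eq_true] at hc
  obtain ⟨m, -, hm⟩ := hc
  rw [Bool.and_eq_true, List.all_eq_true, List.all_eq_true] at hm
  obtain ⟨hm1, hm2⟩ := hm
  let g : ℕ → Sym2 V := fun j => s(f (src j), f (tgt j))
  let M := (Finset.range n).filter (fun j => m.testBit j = true)
  have hM : ∀ j ∈ M, j < n := fun j hj => by simpa using (Finset.mem_filter.1 hj).1
  have hg : Set.InjOn g M := by
    intro i hi j hj h
    refine hinj i (hM i hi) j (hM j hj) ?_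
    have a1 := hs i (hM i hi)
    have a2 := hs j (hM j hj)
    rcases Sym2.eq_iff.1 h with ⟨h1, h2⟩ | ⟨h1, h2⟩
    · rw [hf _ a1.1 _ a2.1 h1, hf _ a1.2.1 _ a2.2.1 h2]
    · rw [hf _ a1.1 _ a2.2.1 h1, hf _ a1.2.1 _ a2.1 h2, Sym2.eq_swap]
  refine ⟨M.image g, ?_, ?_, ?_, ?_⟩
  · intro e he
    obtain ⟨j, hj, rfl⟩ := Finset.mem_image.1 he
    exact hE j (hM j hj)
  · intro e he
    obtain ⟨j, hj, rfl⟩ := Finset.mem_image.1 he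
    have a1 := hs j (hM j hj)
    refine In_mk.2 ⟨?_, ?_⟩
    · exact Finset.mem_image_of_mem _ (Finset.mem_range.2 a1.1)
    · exact Finset.mem_image_of_mem _ (Finset.mem_range.2 a1.2.1)
  · intro φ hφ
    obtain ⟨p, hp, hpφ⟩ := exists_bits k (fun i => φ (f i) = 1)
    have h2 := hm2 p (List.mem_range.2 hp)
    rw [Bool.or_eq_true] at h2
    rcases h2 with h2 | h2
    · exfalso
      obtain ⟨j, hj, h3⟩ := List.any_eq_true.1 h2
      have hj := List.mem_range.1 hj
      rw [Bool.and_eq_true] at h3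
      have a1 := hs j hj
      have h4 := hφ (f (src j)) (f (tgt j)) (Finset.mem_image.2 ⟨j, Finset.mem_filter.2
        ⟨Finset.mem_range.2 hj, h3.1⟩, rfl⟩)
      have h5 := hpφ _ a1.1
      have h6 := hpφ _ a1.2.1
      rw [h4, ← h6] at h5
      have h7 : p.testBit (src j) = p.testBit (tgt j) := Bool.eq_iff_iff.2 h5
      simp [h7] at h3
    · have key : ∀ z ∈ (Finset.range k).image f, φ z = iv (p.testBit 0 = true) := by
        intro z hz
        obtain ⟨i, hi, rfl⟩ := Finset.mem_image.1 hz
        have hi := Finset.mem_range.1 hi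
        have h3 := List.all_eq_true.1 h2 i (List.mem_range.2 hi)
        have h4 : p.testBit i = p.testBit 0 := by simpa using h3
        have h5 := hpφ i hi
        rw [h4] at h5
        by_cases h6 : p.testBit 0 = true
        · rw [iv_true h6, h5.1 h6]
        · rw [iv_false h6]
          exact ne_one2 (fun h => h6 (h5.2 h))
      intro x hx y hy
      rw [key x hx, key y hy]
  · intro z hz
    obtain ⟨i, hi, rfl⟩ := Finset.mem_image.1 hz
    have hi := Finset.mem_range.1 hi
    have h1 := hm1 i (List.mem_range.2 hi)
    have h1 := beq_iff_eq.1 h1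
    rw [← iv_congr (hrR i hi), ← h1, ← xr_sum]
    unfold dg
    rw [Finset.sum_image hg, Finset.sum_filter]
    refine Finset.sum_congr rfl fun j hj => ?_
    have hj := Finset.mem_range.1 hj
    have a1 := hs j hj
    by_cases hb : m.testBit j = true
    · rw [if_pos hb]
      apply iv_congr
      simp only [g, Sym2.mem_iff, hb, Bool.true_and, Bool.or_eq_true, beq_iff_eq]
      constructor
      · rintro (h | h)
        · exact Or.inl (hf _ a1.1 _ hi h.symm)
        · exact Or.inr (hf _ a1.2.1 _ hi h.symm)
      · rintro (h | h)
        · exact Or.inl (by rw [h])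
        · exact Or.inr (by rw [h])
    · rw [if_neg hb, iv_false]
      simp [hb]

/-- no nontrivial collapsible induced subgraph -/
def Red (E : Finset (Sym2 V)) : Prop := ∀ S : Finset V, 2 ≤ S.card → ¬ Coll E S

theorem Red.no_small {E : Finset (Sym2 V)} (hr : Red E) (k n : ℕ) (hk : 2 ≤ k) (src tgt : ℕ → ℕ)
    (hchk : chk k n src tgt = true)
    (hs : ∀ j < n, src j < k ∧ tgt j < k ∧ src j ≠ tgt j)
    (hinj : ∀ i < n, ∀ j < n, s(src i, tgt i) = s(src j, tgt j) → i = j)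
    (f : ℕ → V) (hf : ∀ i < k, ∀ j < k, f i = f j → i = j)
    (hE : ∀ j < n, s(f (src j), f (tgt j)) ∈ E) : False := by
  refine hr _ ?_ (coll_small k n src tgt hchk hs hinj f hf hE)
  rw [Finset.card_image_of_injOn, Finset.card_range]
  · exact hk
  · intro i hi j hj h
    exact hf i (by simpa using hi) j (by simpa using hj) h

theorem Red.no_triangle {E : Finset (Sym2 V)} (hr : Red E) {a b c : V} (hab : a ≠ b) (hac : a ≠ c)
    (hbc : b ≠ c) (h1 : s(a, b) ∈ E) (h2 : s(a, c) ∈ E) (h3 : s(b, c) ∈ E) : False := by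
  refine hr.no_small 3 3 (by norm_num) (fun j => [0, 0, 1].getD j 0) (fun j => [1, 2, 2].getD j 0)
    (by decide +kernel) (by decide) (by decide) (fun j => [a, b, c].getD j a) ?_ ?_
  · intro i hi j hj
    interval_cases i <;> interval_cases j <;> simp_all [eq_comm]
  · intro j hj
    interval_cases j <;> simpa

/-- `K_{3,3}` minus an edge -/
theorem Red.no_k33 {E : Finset (Sym2 V)} (hr : Red E) {p q v x y z : V} 
    (hnd : [p, q, v, x, y, z].Nodup)
    (h1 : s(p, x) ∈ E) (h2 : s(p, y) ∈ E) (h3 : s(p, z) ∈ E)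
    (h4 : s(q, x) ∈ E) (h5 : s(q, y) ∈ E) (h6 : s(q, z) ∈ E)
    (h7 : s(v, x) ∈ E) (h8 : s(v, y) ∈ E) : False := by
  refine hr.no_small 6 8 (by norm_num) (fun j => [0, 0, 0, 1, 1, 1, 2, 2].getD j 0)
    (fun j => [3, 4, 5, 3, 4, 5, 3, 4].getD j 0)
    (by decide +kernel) (by decide) (by decide) (fun j => [p, q, v, x, y, z].getD j p) ?_ ?_
  · intro i hi j hj h
    have hi' : i < [p, q, v, x, y, z].length := by simpa using hi
    have hj' : j < [p, q, v, x, y, z].length := by simpa using hj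
    simp only [List.getD_eq_getElem _ _ hi', List.getD_eq_getElem _ _ hj'] at h
    exact (List.Nodup.getElem_inj_iff hnd).1 h
  · intro j hj
    interval_cases j <;> simpa

end RG

namespace RG
variable {V : Type} [Fintype V]

/-- neighbours of `v` inside `S` -/
noncomputable def nb (E : Finset (Sym2 V)) (S : Finset V) (v : V) : Finset V :=
  S.filter (fun y => s(v, y) ∈ E)

theorem mem_nb {E : Finset (Sym2 V)} {S : Finset V} {v y : V} :
    y ∈ nb E S v ↔ y ∈ S ∧ s(v, y) ∈ E := by simp [nb]

theorem nb_sub {E : Finset (Sym2 V)} {S : Finset V} {v : V} : nb E S v ⊆ S :=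
  Finset.filter_subset _ _

theorem not_mem_nb_self {E : Finset (Sym2 V)} (hnd : ∀ e ∈ E, ¬ e.IsDiag) {S : Finset V} {v : V} :
    v ∉ nb E S v := by
  intro h
  exact hnd _ (mem_nb.1 h).2 (by simp)

theorem nE_insert {E : Finset (Sym2 V)} (hnd : ∀ e ∈ E, ¬ e.IsDiag) {S : Finset V} {v : V}
    (hv : v ∉ S) : nE E (insert v S) = nE E S + (nb E S v).card := by
  have h1 : E.filter (In (insert v S)) = E.filter (In S) ∪ (nb E S v).image (fun y => s(v, y)) := by
    ext e
    induction e using Sym2.ind with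
    | _ a b =>
    simp only [Finset.mem_filter, Finset.mem_union, Finset.mem_image, mem_nb, In_mk,
      Finset.mem_insert]
    constructor
    · rintro ⟨he, ha, hb⟩
      by_cases hav : a = v
      · subst hav
        right
        refine ⟨b, ⟨?_, he⟩, rfl⟩
        rcases hb with rfl | hb
        · exact (hnd _ he (by simp)).elim
        · exact hb
      · by_cases hbv : b = v
        · subst hbv
          right
          exact ⟨a, ⟨ha.resolve_left hav, by rwa [Sym2.eq_swap]⟩, Sym2.eq_swap⟩
        · exact Or.inl ⟨he, ha.resolve_left hav, hb.resolve_left hbv⟩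
    · rintro (⟨he, ha, hb⟩ | ⟨y, ⟨hy, hyE⟩, h⟩)
      · exact ⟨he, Or.inr ha, Or.inr hb⟩
      · rw [← h]
        refine ⟨hyE, ?_⟩
        rcases Sym2.eq_iff.1 h with ⟨rfl, rfl⟩ | ⟨rfl, rfl⟩
        · exact ⟨Or.inl rfl, Or.inr hy⟩
        · exact ⟨Or.inr hy, Or.inl rfl⟩
  unfold nE
  rw [h1, Finset.card_union_of_disjoint, Finset.card_image_of_injective]
  · intro a b h
    have h : a = b ∨ v = b ∧ a = v := by simpa using h
    rcases h with h | ⟨h1, h2⟩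
    · exact h
    · exact h2.trans h1
  · rw [Finset.disjoint_left]
    intro e he h
    obtain ⟨y, -, rfl⟩ := Finset.mem_image.1 h
    exact hv ((Finset.mem_filter.1 he).2 v (by simp))

theorem nb_erase_self {E : Finset (Sym2 V)} (hnd : ∀ e ∈ E, ¬ e.IsDiag) {S : Finset V} {v : V} :
    nb E (S.erase v) v = nb E S v := by
  ext y
  simp only [mem_nb, Finset.mem_erase]
  constructor
  · rintro ⟨⟨_, h⟩, h'⟩; exact ⟨h, h'⟩
  · rintro ⟨h, h'⟩
    refine ⟨⟨?_, h⟩, h'⟩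
    rintro rfl
    exact hnd _ h' (by simp)

theorem nE_erase {E : Finset (Sym2 V)} (hnd : ∀ e ∈ E, ¬ e.IsDiag) {S : Finset V} {v : V}
    (hv : v ∈ S) : nE E S = nE E (S.erase v) + (nb E S v).card := by
  conv_lhs => rw [← Finset.insert_erase hv]
  rw [nE_insert hnd (Finset.notMem_erase _ _), nb_erase_self hnd]

theorem sum_nb {E : Finset (Sym2 V)} (hnd : ∀ e ∈ E, ¬ e.IsDiag) (S : Finset V) :
    ∑ v ∈ S, (nb E S v).card = 2 * nE E S := by
  induction S using Finset.induction_on with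
  | empty =>
    have : nE E (∅ : Finset V) = 0 := by
      unfold nE
      rw [Finset.card_eq_zero, Finset.filter_eq_empty_iff]
      intro e _ h
      induction e using Sym2.ind with
      | _ a b => simpa using h a (by simp)
    simp [this]
  | insert v S hv ih =>
    have hself : nb E (insert v S) v = nb E S v := by
      have := nb_erase_self hnd (S := insert v S) (v := v)
      rw [Finset.erase_insert hv] at this
      exact this.symm
    rw [Finset.sum_insert hv, nE_insert hnd hv, hself]
    have h1 : ∀ u ∈ S, (nb E (insert v S) u).card =
        (nb E S u).card + if s(v, u) ∈ E then 1 else 0 := by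
      intro u hu
      unfold nb
      rw [Finset.filter_insert]
      by_cases h : s(v, u) ∈ E
      · rw [if_pos (by rwa [Sym2.eq_swap]), if_pos h, Finset.card_insert_of_notMem]
        simp [hv]
      · rw [if_neg (by rwa [Sym2.eq_swap]), if_neg h, add_zero]
    rw [Finset.sum_congr rfl h1, Finset.sum_add_distrib, ih, ← Finset.card_filter]
    change _ + (_ + (nb E S v).card) = _
    ring

theorem nE_le_one {E : Finset (Sym2 V)} (hnd : ∀ e ∈ E, ¬ e.IsDiag) {S : Finset V}
    (h : S.card ≤ 1) : nE E S = 0 := by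
  have h1 := sum_nb hnd S
  have h2 : ∑ v ∈ S, (nb E S v).card = 0 := by
    refine Finset.sum_eq_zero fun v hv => ?_
    rw [Finset.card_eq_zero, Finset.eq_empty_iff_forall_notMem]
    intro y hy
    have := Finset.card_le_one.1 h v hv y (nb_sub hy)
    subst this
    exact not_mem_nb_self hnd hy
  omega

theorem nE_mono {E E' : Finset (Sym2 V)} (h : E' ⊆ E) (S : Finset V) : nE E' S ≤ nE E S :=
  Finset.card_le_card (Finset.filter_subset_filter _ h)

theorem Coll.mono {E E' : Finset (Sym2 V)} {S : Finset V} (hc : Coll E' S) (h : E' ⊆ E) :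
    Coll E S := by
  intro R hR he
  obtain ⟨Γ, h1, h2⟩ := hc R hR he
  exact ⟨Γ, h1.trans h, h2⟩

theorem mkDec {E : Finset (Sym2 V)} (hnd : ∀ e ∈ E, ¬ e.IsDiag) {S Z : Finset V}
    {T F : Finset (Sym2 V)} (hZS : Z ⊆ S) (hES : ∀ e ∈ E, In S e) (hne : (S \ Z).Nonempty)
    (h1 : T ∪ F = E) (h2 : Disjoint T F) (h3 : T.card + 1 = S.card) (h4 : Cn S T)
    (h5 : ∀ e ∈ F, In (S \ Z) e) (h6 : Cn (S \ Z) F) : Dec S Z T F where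
  hZS := hZS
  hTS := fun e he => hES e (h1 ▸ Finset.mem_union_left _ he)
  hTd := fun e he => hnd e (h1 ▸ Finset.mem_union_left _ he)
  hdis := h2
  hF := h5
  hne := hne
  hcT := h4
  hcF := h6
  hcard := h3

theorem Red.F0 {E : Finset (Sym2 V)} (hnd : ∀ e ∈ E, ¬ e.IsDiag) (hr : Red E) :
    ∀ (n : ℕ) (S : Finset V), S.card = n → 2 ≤ S.card → nE E S + 3 ≤ 2 * S.card := by
  intro n
  induction n using Nat.strong_induction_on with
  | _ n ih =>
  intro S hSn hS2
  by_contra hcon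
  push Not at hcon
  obtain ⟨E', hE', hcard⟩ := Finset.exists_subset_card_eq
    (s := E.filter (In S)) (n := 2 * S.card - 2) (by unfold nE at hcon; omega)
  have hE'E : E' ⊆ E := hE'.trans (Finset.filter_subset _ _)
  have hES : ∀ e ∈ E', In S e := fun e he => (Finset.mem_filter.1 (hE' he)).2
  have hne : (S \ ∅).Nonempty := by
    rw [Finset.sdiff_empty]; exact Finset.card_pos.1 (by omega)
  obtain ⟨T, F, g1, g2, g3, g4, g5, g6⟩ := decomp (S := S) (Z := ∅) (E := E') (by simp) (by simp) hES
    (by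
      intro e _
      induction e using Sym2.ind with
      | _ a b => exact ⟨a, by simp, by simp⟩)
    (by
      intro C hC hCne Z' hZ' _
      rw [Finset.subset_empty.1 hZ', Finset.union_empty, Finset.card_empty, add_zero]
      rw [Finset.sdiff_empty] at hC
      have hpos := Finset.card_pos.2 hCne
      by_cases h1 : C.card ≤ 1
      · rw [nE_le_one (fun e he => hnd e (hE'E he)) h1]; omega
      · by_cases h2 : C = S
        · subst h2
          have : nE E' C ≤ E'.card := Finset.card_le_card (Finset.filter_subset _ _)
          omega
        · have := Finset.card_lt_card (lt_of_le_of_ne hC h2)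
          have h3 := ih C.card (by omega) C rfl (by omega)
          have h4 := nE_mono hE'E C
          omega)
    (by simp) (by simp) hne (by rw [Finset.sdiff_empty]; omega)
  have hD := mkDec (fun e he => hnd e (hE'E he)) (by simp) hES hne g1 g2 g3 g4 g5 g6
  have hc := hD.coll0
  rw [g1] at hc
  exact hr S hS2 (hc.mono hE'E)

theorem exists_enum3 {N : Finset V} (h : N.card = 3) :
    ∃ a : Fin 3 → V, Function.Injective a ∧ ∀ y, y ∈ N ↔ ∃ i, y = a i := by
  obtain ⟨x, y, z, hxy, hxz, hyz, rfl⟩ := Finset.card_eq_three.1 h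
  refine ⟨![x, y, z], ?_, ?_⟩
  · intro i j hij
    fin_cases i <;> fin_cases j <;> simp_all [eq_comm]
  · intro t
    simp [Fin.exists_fin_succ]

theorem exists_star {E : Finset (Sym2 V)} {S Z : Finset V} {T F : Finset (Sym2 V)}
    (h1 : T ∪ F = E.filter (In S)) (h5 : ∀ e ∈ F, In (S \ Z) e) {v : V} (hvS : v ∈ S) (hv : v ∈ Z)
    (h3 : (nb E S v).card = 3) : ∃ a, Star3 T v a ∧ ∀ i, a i ∈ nb E S v := by
  obtain ⟨a, ha, haN⟩ := exists_enum3 h3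
  refine ⟨a, ⟨ha, ?_⟩, fun i => (haN _).2 ⟨i, rfl⟩⟩
  intro y
  rw [← haN, mem_nb]
  constructor
  · intro h
    have h2 : s(v, y) ∈ E.filter (In S) := h1 ▸ Finset.mem_union_left _ h
    rw [Finset.mem_filter, In_mk] at h2
    exact ⟨h2.2.2, h2.1⟩
  · rintro ⟨hy, hyE⟩
    have h2 : s(v, y) ∈ T ∪ F := by
      rw [h1, Finset.mem_filter, In_mk]; exact ⟨hyE, hvS, hy⟩
    rcases Finset.mem_union.1 h2 with h | h
    · exact h
    · exact ((Finset.mem_sdiff.1 ((In_mk.1 (h5 _ h)).1)).2 hv).elim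

theorem Red.h1 {E E' : Finset (Sym2 V)} (hnd : ∀ e ∈ E, ¬ e.IsDiag) (hr : Red E) (hE' : E' ⊆ E)
    {S Z : Finset V} (C : Finset V) (hC : C ⊆ S \ Z) (hCne : C.Nonempty) (Z' : Finset V)
    (hZ' : Z' ⊆ Z) (hZ1 : Z'.card ≤ 1) : nE E' (C ∪ Z') + 2 ≤ 2 * C.card + Z'.card := by
  have hd : Disjoint C Z' := by
    rw [Finset.disjoint_left]
    intro x hx hx'
    exact (Finset.mem_sdiff.1 (hC hx)).2 (hZ' hx')
  have hc := Finset.card_union_of_disjoint hd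
  have hpos := Finset.card_pos.2 hCne
  have hm := nE_mono hE' (C ∪ Z')
  by_cases h : (C ∪ Z').card ≤ 1
  · rw [nE_le_one hnd h] at hm
    omega
  · have := hr.F0 hnd _ (C ∪ Z') rfl (by omega)
    omega

theorem Red.F1 {E : Finset (Sym2 V)} (hnd : ∀ e ∈ E, ¬ e.IsDiag) (hr : Red E) :
    ∀ (n : ℕ) (S : Finset V), S.card = n → 3 ≤ S.card → nE E S + 4 ≤ 2 * S.card := by
  intro n
  induction n using Nat.strong_induction_on with
  | _ n ih =>
  intro S hSn hS3
  by_contra hcon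
  push Not at hcon
  have hF0 := hr.F0 hnd n S hSn (by omega)
  have hdeg : ∀ x ∈ S, 2 ≤ (nb E S x).card := by
    intro x hx
    have h1 := nE_erase hnd hx
    have h2 := Finset.card_erase_of_mem hx
    have h3 := hr.F0 hnd _ (S.erase x) rfl (by omega)
    omega
  by_cases h3 : S.card = 3
  · obtain ⟨a, b, c, hab, hac, hbc, rfl⟩ := Finset.card_eq_three.1 h3
    have key : ∀ x ∈ ({a, b, c} : Finset V), ∀ y ∈ ({a, b, c} : Finset V), x ≠ y → s(x, y) ∈ E := by
      intro x hx y hy hxy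
      have h1 : nb E {a, b, c} x ⊆ Finset.erase {a, b, c} x := by
        intro t ht
        refine Finset.mem_erase.2 ⟨?_, nb_sub ht⟩
        rintro rfl
        exact not_mem_nb_self hnd ht
      have h2 := Finset.eq_of_subset_of_card_le h1 (by
        rw [Finset.card_erase_of_mem hx, h3]; exact hdeg x hx)
      have : y ∈ nb E {a, b, c} x := by
        rw [h2]; exact Finset.mem_erase.2 ⟨hxy.symm, hy⟩
      exact (mem_nb.1 this).2
    exact hr.no_triangle hab hac hbc (key a (by simp) b (by simp) hab)
      (key a (by simp) c (by simp) hac) (key b (by simp) c (by simp) hbc)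
  · have hdeg3 : ∀ x ∈ S, 3 ≤ (nb E S x).card := by
      intro x hx
      have h1 := nE_erase hnd hx
      have h2 := Finset.card_erase_of_mem hx
      have h3 := ih (S.erase x).card (by omega) (S.erase x) rfl (by omega)
      omega
    obtain ⟨v, hvS, hv⟩ : ∃ v ∈ S, (nb E S v).card ≤ 3 := by
      by_contra hall
      push Not at hall
      have h1 := sum_nb hnd S
      have h2 := Finset.sum_le_sum (f := fun _ => 4) hall
      rw [Finset.sum_const, smul_eq_mul] at h2
      omega
    have hv3 := le_antisymm hv (hdeg3 v hvS)
    have hZS : ({v} : Finset V) ⊆ S := by simpa using hvS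
    have hcs : (S \ {v}).card = S.card - 1 := by
      rw [Finset.card_sdiff_of_subset hZS, Finset.card_singleton]
    have hne : (S \ {v}).Nonempty := Finset.card_pos.1 (by omega)
    have hES : ∀ e ∈ E.filter (In S), In S e := fun e he => (Finset.mem_filter.1 he).2
    have hE'E : E.filter (In S) ⊆ E := Finset.filter_subset _ _
    obtain ⟨T, F, g1, g2, g3, g4, g5, g6⟩ := decomp (S := S) (Z := {v}) (E := E.filter (In S)) hZS
      (by simp) hES
      (by
        intro e he
        have hd := hnd e (hE'E he)
        induction e using Sym2.ind with
        | _ a b =>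
          by_cases hav : a = v
          · refine ⟨b, by simp, ?_⟩
            rw [Finset.mem_singleton]
            rintro rfl
            exact hd (by simp [hav])
          · exact ⟨a, by simp, by simpa using hav⟩)
      (hr.h1 hnd hE'E) (by simp) (by simp) hne (by unfold nE at *; omega)
    have hD := mkDec (fun e he => hnd e (hE'E he)) hZS hES hne g1 g2 g3 g4 g5 g6
    obtain ⟨a, ha, haN⟩ := exists_star g1 g5 hvS (by simp) hv3
    have hc := hD.coll1 ha (by
      intro i
      refine Finset.mem_sdiff.2 ⟨nb_sub (haN i), ?_⟩
      rw [Finset.mem_singleton]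
      intro h
      have := haN i
      rw [h] at this
      exact not_mem_nb_self hnd this)
    rw [g1] at hc
    exact hr S (by omega) (hc.mono hE'E)

end RG

namespace RG
variable {V : Type} [Fintype V]

/-- `S` induces `K_{2,t}` -/
def K2t (E : Finset (Sym2 V)) (S : Finset V) : Prop :=
  ∃ u ∈ S, ∃ w ∈ S, u ≠ w ∧ s(u, w) ∉ E ∧ ∀ z ∈ S, z ≠ u → z ≠ w → nb E S z = {u, w}

theorem nb_symm {E : Finset (Sym2 V)} {S : Finset V} {x y : V} (hx : x ∈ S) (h : y ∈ nb E S x) :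
    x ∈ nb E S y := by
  rw [mem_nb] at h ⊢
  exact ⟨hx, by rw [Sym2.eq_swap]; exact h.2⟩

theorem nb_ne {E : Finset (Sym2 V)} (hnd : ∀ e ∈ E, ¬ e.IsDiag) {S : Finset V} {x y : V}
    (h : y ∈ nb E S x) : y ≠ x := by
  rintro rfl; exact not_mem_nb_self hnd h

/-- no triangles, in terms of neighbourhoods -/
theorem Red.tri {E : Finset (Sym2 V)} (hnd : ∀ e ∈ E, ¬ e.IsDiag) (hr : Red E) {S : Finset V}
    {x y z : V} (hy : y ∈ nb E S x) (hz : z ∈ nb E S x) : s(y, z) ∉ E := by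
  intro h
  have hyz : y ≠ z := by rintro rfl; exact hnd _ h (by simp)
  exact hr.no_triangle (nb_ne hnd hy).symm (nb_ne hnd hz).symm hyz (mem_nb.1 hy).2 (mem_nb.1 hz).2 h

/-- the case of a degree two vertex -/
theorem Red.ext2 {E : Finset (Sym2 V)} (hnd : ∀ e ∈ E, ¬ e.IsDiag) (hr : Red E) {S : Finset V}
    {x : V} (hx : x ∈ S) (hd : (nb E S x).card = 2) (hK : K2t E (S.erase x)) : K2t E S := by
  obtain ⟨u, hu, w, hw, huw, hnuw, hL⟩ := hK
  obtain ⟨p, q, hpq, hN⟩ := Finset.card_eq_two.1 hd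
  obtain ⟨hux, huS⟩ := Finset.mem_erase.1 hu
  obtain ⟨hwx, hwS⟩ := Finset.mem_erase.1 hw
  have hp : p ∈ nb E S x := by rw [hN]; simp
  have hq : q ∈ nb E S x := by rw [hN]; simp
  have hpx := nb_ne hnd hp
  have hqx := nb_ne hnd hq
  have hnpq : s(p, q) ∉ E := hr.tri hnd hp hq
  have hnqp : s(q, p) ∉ E := hr.tri hnd hq hp
  have hpe : p ∈ S.erase x := Finset.mem_erase.2 ⟨hpx, nb_sub hp⟩
  have hqe : q ∈ S.erase x := Finset.mem_erase.2 ⟨hqx, nb_sub hq⟩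
  have hLu : ∀ z ∈ S.erase x, z ≠ u → z ≠ w → s(z, u) ∈ E ∧ s(z, w) ∈ E := by
    intro z hz h1 h2
    have h3 := hL z hz h1 h2
    exact ⟨(mem_nb.1 (by rw [h3]; simp : u ∈ nb E (S.erase x) z)).2,
      (mem_nb.1 (by rw [h3]; simp : w ∈ nb E (S.erase x) z)).2⟩
  -- the case where the neighbours are the centres
  have centre : nb E S x = {u, w} → K2t E S := by
    intro hNx
    refine ⟨u, huS, w, hwS, huw, hnuw, ?_⟩
    intro z hz hzu hzw
    by_cases hzx : z = x
    · rw [hzx, hNx]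
    · rw [← hL z (Finset.mem_erase.2 ⟨hzx, hz⟩) hzu hzw]
      ext y
      simp only [mem_nb, Finset.mem_erase]
      constructor
      · rintro ⟨h1, h2⟩
        refine ⟨⟨?_, h1⟩, h2⟩
        rintro rfl
        have : z ∈ nb E S y := mem_nb.2 ⟨hz, by rwa [Sym2.eq_swap]⟩
        rw [hNx] at this
        simp at this
        tauto
      · rintro ⟨⟨_, h1⟩, h2⟩; exact ⟨h1, h2⟩
  by_cases hpu : p = u
  · by_cases hqw : q = w
    · exact centre (by rw [hN, hpu, hqw])
    · exact (hnqp (hpu ▸ (hLu q hqe (fun h => hpq (hpu.trans h.symm)) hqw).1)).elim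
  by_cases hpw : p = w
  · by_cases hqu : q = u
    · exact centre (by rw [hN, hpw, hqu, Finset.pair_comm])
    · exact (hnqp (hpw ▸ (hLu q hqe hqu (fun h => hpq (hpw.trans h.symm))).2)).elim
  have hp2 := hLu p hpe hpu hpw
  have hqu : q ≠ u := by rintro rfl; exact hnpq hp2.1
  have hqw : q ≠ w := by rintro rfl; exact hnpq hp2.2
  have hq2 := hLu q hqe hqu hqw
  have hxp := (mem_nb.1 hp).2
  have hxq := (mem_nb.1 hq).2
  by_cases hr' : ∃ r ∈ S.erase x, r ≠ u ∧ r ≠ w ∧ r ≠ p ∧ r ≠ q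
  · exfalso
    obtain ⟨r, hrS, h1, h2, h3, h4⟩ := hr'
    have hr2 := hLu r hrS h1 h2
    have hrx := (Finset.mem_erase.1 hrS).1
    refine hr.no_k33 (p := u) (q := w) (v := x) (x := p) (y := q) (z := r) ?_
      (by rw [Sym2.eq_swap]; exact hp2.1) (by rw [Sym2.eq_swap]; exact hq2.1)
      (by rw [Sym2.eq_swap]; exact hr2.1) (by rw [Sym2.eq_swap]; exact hp2.2)
      (by rw [Sym2.eq_swap]; exact hq2.2) (by rw [Sym2.eq_swap]; exact hr2.2) hxp hxq
    simp only [List.nodup_cons, List.mem_cons, List.not_mem_nil, or_false, not_or]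
    grind
  · push Not at hr'
    have hnu : ∀ c, (c = u ∨ c = w) → nb E S c = {p, q} := by
      intro c hc
      ext y
      simp only [mem_nb, Finset.mem_insert, Finset.mem_singleton]
      constructor
      · rintro ⟨h1, h2⟩
        by_cases hyx : y = x
        · exfalso
          have : c ∈ nb E S x := mem_nb.2 ⟨by grind, by rw [Sym2.eq_swap, ← hyx]; exact h2⟩
          rw [hN] at this
          simp at this
          grind
        · have h3 := hr' y (Finset.mem_erase.2 ⟨hyx, h1⟩)
          by_contra hcon
          push Not at hcon
          have h4 : y = u ∨ y = w := by grind
          rcases hc with rfl | rfl <;> rcases h4 with rfl | rfl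
          · exact hnd _ h2 (by simp)
          · exact hnuw h2
          · exact hnuw (by rwa [Sym2.eq_swap])
          · exact hnd _ h2 (by simp)
      · rintro (rfl | rfl)
        · refine ⟨nb_sub hp, ?_⟩
          rw [Sym2.eq_swap]
          rcases hc with rfl | rfl
          · exact hp2.1
          · exact hp2.2
        · refine ⟨nb_sub hq, ?_⟩
          rw [Sym2.eq_swap]
          rcases hc with rfl | rfl
          · exact hq2.1
          · exact hq2.2
    refine ⟨p, nb_sub hp, q, nb_sub hq, hpq, hnpq, ?_⟩
    intro z hz hzp hzq
    by_cases hzx : z = x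
    · rw [hzx, hN]
    · apply hnu
      have := hr' z (Finset.mem_erase.2 ⟨hzx, hz⟩)
      grind

/-- the pair of vertices used in the main reduction step -/
theorem Red.exists_pair {E : Finset (Sym2 V)} (hnd : ∀ e ∈ E, ¬ e.IsDiag) (hr : Red E)
    {S : Finset V} (hS : nE E S + 4 = 2 * S.card) (hd3 : ∀ x ∈ S, 3 ≤ (nb E S x).card) :
    ∃ v ∈ S, ∃ w ∈ S, v ≠ w ∧ s(v, w) ∉ E ∧ (nb E S v).card = 3 ∧ (nb E S w).card = 3 ∧
      (nb E S v ∩ nb E S w).card ≤ 1 := by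
  by_contra hcon
  push Not at hcon
  set D := S.filter (fun x => (nb E S x).card = 3) with hD
  have hDm : ∀ x, x ∈ D ↔ x ∈ S ∧ (nb E S x).card = 3 := by simp [hD]
  have hsum := sum_nb hnd S
  have hpt : ∀ x ∈ S, 4 ≤ (nb E S x).card + if (nb E S x).card = 3 then 1 else 0 := by
    intro x hx
    have := hd3 x hx
    split_ifs <;> omega
  have hDsum : ∑ x ∈ S, ((nb E S x).card + if (nb E S x).card = 3 then 1 else 0) =
      2 * nE E S + D.card := by
    rw [Finset.sum_add_distrib, hsum, ← Finset.card_filter]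
  have hD8 : 8 ≤ D.card := by
    have := Finset.sum_le_sum hpt
    rw [hDsum, Finset.sum_const, smul_eq_mul] at this
    omega
  obtain ⟨v, hvD⟩ : D.Nonempty := Finset.card_pos.1 (by omega)
  obtain ⟨hvS, hv3⟩ := (hDm v).1 hvD
  set N := nb E S v with hN
  set D' := D \ insert v N with hD'
  have hvN : v ∉ N := not_mem_nb_self hnd
  have hD'4 : 4 ≤ D'.card := by
    have h1 : D.card - (insert v N).card ≤ D'.card := Finset.le_card_sdiff (insert v N) D
    rw [Finset.card_insert_of_notMem hvN, hv3] at h1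
    omega
  have hD'm : ∀ w ∈ D', w ∈ S ∧ (nb E S w).card = 3 ∧ w ≠ v ∧ w ∉ N ∧ 2 ≤ (N ∩ nb E S w).card := by
    intro w hw
    obtain ⟨hwD, hwn⟩ := Finset.mem_sdiff.1 hw
    obtain ⟨hwS, hw3⟩ := (hDm w).1 hwD
    rw [Finset.mem_insert, not_or] at hwn
    refine ⟨hwS, hw3, hwn.1, hwn.2, ?_⟩
    exact hcon v hvS w hwS (Ne.symm hwn.1) (fun h => hwn.2 (mem_nb.2 ⟨hwS, h⟩)) hv3 hw3
  -- exactly two neighbours in `N`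
  have hex2 : ∀ w ∈ D', (N ∩ nb E S w).card = 2 := by
    intro w hw
    obtain ⟨hwS, hw3, hwv, hwN, hw2⟩ := hD'm w hw
    by_contra hne
    have hle : (N ∩ nb E S w).card ≤ N.card := Finset.card_le_card Finset.inter_subset_left
    have hNN : N ∩ nb E S w = N := Finset.eq_of_subset_of_card_le Finset.inter_subset_left (by omega)
    have hNw : N ⊆ nb E S w := Finset.inter_eq_left.1 hNN
    obtain ⟨w', hw', hww'⟩ : ∃ w' ∈ D', w' ≠ w :=
      Finset.exists_mem_ne (by omega) w
    obtain ⟨hwS', hw3', hwv', hwN', hw2'⟩ := hD'm w' hw'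
    obtain ⟨x, hx, y, hy, hxy⟩ := Finset.one_lt_card.1 (by omega : 1 < (N ∩ nb E S w').card)
    rw [Finset.mem_inter] at hx hy
    obtain ⟨z, hz, hzx, hzy⟩ : ∃ z ∈ N, z ≠ x ∧ z ≠ y := by
      have : ({x, y} : Finset V).card < N.card := by rw [Finset.card_pair hxy]; omega
      obtain ⟨z, hz, hz'⟩ := Finset.exists_mem_notMem_of_card_lt_card this
      simp at hz'
      exact ⟨z, hz, hz'.1, hz'.2⟩
    refine hr.no_k33 (p := v) (q := w) (v := w') (x := x) (y := y) (z := z) ?_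
      (mem_nb.1 hx.1).2 (mem_nb.1 hy.1).2 (mem_nb.1 hz).2 (mem_nb.1 (hNw hx.1)).2
      (mem_nb.1 (hNw hy.1)).2 (mem_nb.1 (hNw hz)).2 (mem_nb.1 hx.2).2 (mem_nb.1 hy.2).2
    simp only [List.nodup_cons, List.mem_cons, List.not_mem_nil, or_false, not_or]
    grind
  have hmis : ∀ w ∈ D', ∃ m ∈ N, N ∩ nb E S w = N.erase m := by
    intro w hw
    have h2 := hex2 w hw
    obtain ⟨m, hm, hm'⟩ := Finset.exists_mem_notMem_of_card_lt_card
      (by omega : (N ∩ nb E S w).card < N.card)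
    refine ⟨m, hm, Finset.eq_of_subset_of_card_le ?_ ?_⟩
    · intro t ht
      refine Finset.mem_erase.2 ⟨?_, (Finset.mem_inter.1 ht).1⟩
      rintro rfl; exact hm' ht
    · rw [Finset.card_erase_of_mem hm]; omega
  have hthird : ∀ w ∈ D', ∃ d, nb E S w \ N = {d} := by
    intro w hw
    have h2 := hex2 w hw
    have h3 := (hD'm w hw).2.1
    have h4 := Finset.card_sdiff_add_card_inter (nb E S w) N
    rw [Finset.inter_comm] at h4
    exact Finset.card_eq_one.1 (by omega)
  choose! m hmN hm using hmis
  choose! d hd using hthird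
  have hdd : ∀ w₁ ∈ D', ∀ w₂ ∈ D', m w₁ ≠ m w₂ → d w₁ = d w₂ := by
    intro w₁ h₁ w₂ h₂ hne
    obtain ⟨hwS, hw3, hwv, hwN, hw2⟩ := hD'm w₁ h₁
    obtain ⟨hwS', hw3', hwv', hwN', hw2'⟩ := hD'm w₂ h₂
    have hcomm : N ∩ (nb E S w₁ ∩ nb E S w₂) = (N.erase (m w₁)).erase (m w₂) := by
      rw [Finset.inter_inter_distrib_left, hm w₁ h₁, hm w₂ h₂]
      ext t; simp only [Finset.mem_inter, Finset.mem_erase]; tauto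
    have hc1 : (N ∩ (nb E S w₁ ∩ nb E S w₂)).card = 1 := by
      rw [hcomm, Finset.card_erase_of_mem, Finset.card_erase_of_mem (hmN w₁ h₁), hv3]
      exact Finset.mem_erase.2 ⟨hne.symm, hmN w₂ h₂⟩
    obtain ⟨t, ht⟩ := Finset.card_pos.1 (by omega : 0 < (N ∩ (nb E S w₁ ∩ nb E S w₂)).card)
    simp only [Finset.mem_inter] at ht
    have hnadj : s(w₁, w₂) ∉ E :=
      hr.tri hnd (nb_symm hwS ht.2.1) (nb_symm hwS' ht.2.2)
    have h2 := hcon w₁ hwS w₂ hwS' (by rintro rfl; exact hne rfl) hnadj hw3 hw3'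
    obtain ⟨c, hc, hc'⟩ := Finset.exists_mem_notMem_of_card_lt_card
      (by omega : (N ∩ (nb E S w₁ ∩ nb E S w₂)).card < (nb E S w₁ ∩ nb E S w₂).card)
    have hcN : c ∉ N := fun h => hc' (Finset.mem_inter.2 ⟨h, hc⟩)
    rw [Finset.mem_inter] at hc
    have e1 : c ∈ nb E S w₁ \ N := Finset.mem_sdiff.2 ⟨hc.1, hcN⟩
    have e2 : c ∈ nb E S w₂ \ N := Finset.mem_sdiff.2 ⟨hc.2, hcN⟩
    rw [hd w₁ h₁, Finset.mem_singleton] at e1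
    rw [hd w₂ h₂, Finset.mem_singleton] at e2
    rw [← e1, ← e2]
  obtain ⟨w₁, h₁, w₂, h₂, h12, hm12⟩ := Finset.exists_ne_map_eq_of_card_lt_of_maps_to
    (by omega : N.card < D'.card) (f := m) (fun w hw => hmN w hw)
  have hall : ∀ w ∈ D', m w = m w₁ := by
    intro w₃ h₃
    by_contra hne
    have e1 := hdd w₃ h₃ w₁ h₁ hne
    have e2 := hdd w₃ h₃ w₂ h₂ (by rwa [← hm12])
    obtain ⟨hwS, hw3, hwv, hwN, hw2⟩ := hD'm w₁ h₁
    obtain ⟨hwS', hw3', hwv', hwN', hw2'⟩ := hD'm w₂ h₂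
    obtain ⟨x, hx, y, hy, hxy⟩ := Finset.one_lt_card.1 (by omega : 1 < (N ∩ nb E S w₁).card)
    have hx' : x ∈ N ∩ nb E S w₂ := by rw [hm w₂ h₂, ← hm12, ← hm w₁ h₁]; exact hx
    have hy' : y ∈ N ∩ nb E S w₂ := by rw [hm w₂ h₂, ← hm12, ← hm w₁ h₁]; exact hy
    have hz : d w₁ ∈ nb E S w₁ \ N := by rw [hd w₁ h₁]; simp
    have hz' : d w₁ ∈ nb E S w₂ \ N := by rw [hd w₂ h₂, ← e1, e2]; simp
    generalize d w₁ = z at hz hz'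
    rw [Finset.mem_inter] at hx hy hx' hy'
    rw [Finset.mem_sdiff] at hz hz'
    have n1 := nb_ne hnd hz.1
    have n2 := nb_ne hnd hz'.1
    have n3 : z ≠ v := by
      rintro rfl
      exact hwN (nb_symm hwS hz.1)
    refine hr.no_k33 (p := w₁) (q := w₂) (v := v) (x := x) (y := y) (z := z) ?_
      (mem_nb.1 hx.2).2 (mem_nb.1 hy.2).2 (mem_nb.1 hz.1).2 (mem_nb.1 hx'.2).2
      (mem_nb.1 hy'.2).2 (mem_nb.1 hz'.1).2 (mem_nb.1 hx.1).2 (mem_nb.1 hy.1).2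
    simp only [List.nodup_cons, List.mem_cons, List.not_mem_nil, or_false, not_or]
    grind
  have hadj : ∀ x ∈ N.erase (m w₁), insert v D' ⊆ nb E S x := by
    intro x hx t ht
    have hxN := (Finset.mem_erase.1 hx).2
    rcases Finset.mem_insert.1 ht with rfl | ht
    · exact nb_symm hvS hxN
    · have : x ∈ N ∩ nb E S t := by rw [hm t ht, hall t ht]; exact hx
      exact nb_symm (hD'm t ht).1 (Finset.mem_inter.1 this).2
  have hvD' : v ∉ D' := by simp [hD']
  have hbig : ∀ x ∈ N.erase (m w₁), D'.card + 1 ≤ (nb E S x).card := by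
    intro x hx
    have := Finset.card_le_card (hadj x hx)
    rwa [Finset.card_insert_of_notMem hvD'] at this
  have hab : (N.erase (m w₁)).card = 2 := by
    rw [Finset.card_erase_of_mem (hmN w₁ h₁), hv3]
  have hD'D : D.card ≤ D'.card + 2 := by
    have hsubD : D ⊆ insert v (insert (m w₁) D') := by
      intro t ht
      by_contra hcon2
      rw [Finset.mem_insert, Finset.mem_insert, not_or, not_or] at hcon2
      obtain ⟨c1, c2, c3⟩ := hcon2
      have htN : t ∈ N := by
        by_contra htN
        exact c3 (Finset.mem_sdiff.2 ⟨ht, by simp [c1, htN]⟩)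
      have := hbig t (Finset.mem_erase.2 ⟨c2, htN⟩)
      have := ((hDm t).1 ht).2
      omega
    have c1 := Finset.card_le_card hsubD
    have c2 := Finset.card_insert_le v (insert (m w₁) D')
    have c3 := Finset.card_insert_le (m w₁) D'
    omega
  have habS : N.erase (m w₁) ⊆ S := (Finset.erase_subset _ _).trans nb_sub
  have s1 := Finset.sum_sdiff habS
    (f := fun x => (nb E S x).card + if (nb E S x).card = 3 then 1 else 0)
  have s2 := Finset.card_nsmul_le_sum (S \ N.erase (m w₁))
    (fun x => (nb E S x).card + if (nb E S x).card = 3 then 1 else 0) 4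
    (fun x hx => hpt x (Finset.mem_sdiff.1 hx).1)
  have s3 := Finset.card_nsmul_le_sum (N.erase (m w₁))
    (fun x => (nb E S x).card + if (nb E S x).card = 3 then 1 else 0) (D'.card + 1)
    (fun x hx => (hbig x hx).trans (Nat.le_add_right _ _))
  rw [Finset.card_sdiff_of_subset habS, hab, smul_eq_mul] at s2
  rw [hab, smul_eq_mul] at s3
  rw [hDsum] at s1
  have hS2 := Finset.card_le_card habS
  rw [hab] at hS2
  omega

/-- a tight set containing two nonadjacent vertices contains a common neighbour -/
theorem K2t.common {E : Finset (Sym2 V)} {C : Finset V} {v w : V}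
    (hC : C.Nonempty) (hvC : v ∉ C) (hwC : w ∉ C) (hvw : v ≠ w) (hn : s(v, w) ∉ E)
    (hK : K2t E (C ∪ {v, w})) : ∃ c ∈ C, s(v, c) ∈ E ∧ s(w, c) ∈ E := by
  obtain ⟨u, hu, t, ht, hut, hnut, hL⟩ := hK
  have hn' : s(w, v) ∉ E := by rwa [Sym2.eq_swap]
  have hL' : ∀ z ∈ C ∪ {v, w}, z ≠ u → z ≠ t → s(z, u) ∈ E ∧ s(z, t) ∈ E := by
    intro z hz h1 h2
    have h3 := hL z hz h1 h2
    exact ⟨(mem_nb.1 (by rw [h3]; simp : u ∈ nb E _ z)).2,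
      (mem_nb.1 (by rw [h3]; simp : t ∈ nb E _ z)).2⟩
  have hvP : v ∈ C ∪ {v, w} := by simp
  have hwP : w ∈ C ∪ {v, w} := by simp
  by_cases hv : v = u ∨ v = t
  · by_cases hw : w = u ∨ w = t
    · obtain ⟨c, hc⟩ := hC
      have h1 : c ≠ v := by rintro rfl; exact hvC hc
      have h2 : c ≠ w := by rintro rfl; exact hwC hc
      refine ⟨c, hc, ?_⟩
      have := hL' c (by simp [hc]) (by grind) (by grind)
      rw [Sym2.eq_swap, Sym2.eq_swap (a := w)]
      rcases hv with rfl | rfl <;> rcases hw with rfl | rfl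
      · exact (hvw rfl).elim
      · exact this
      · exact this.symm
      · exact (hvw rfl).elim
    · push Not at hw
      have := hL' w hwP hw.1 hw.2
      rcases hv with rfl | rfl
      · exact (hn' this.1).elim
      · exact (hn' this.2).elim
  · push Not at hv
    have hv2 := hL' v hvP hv.1 hv.2
    have hwu : w ≠ u := by rintro rfl; exact hn hv2.1
    have hwt : w ≠ t := by rintro rfl; exact hn hv2.2
    have hw2 := hL' w hwP hwu hwt
    refine ⟨u, ?_, hv2.1, hw2.1⟩
    simp only [Finset.mem_union, Finset.mem_insert, Finset.mem_singleton] at hu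
    rcases hu with h | h | h
    · exact h
    · exact (hv.1 h.symm).elim
    · exact (hwu h.symm).elim

theorem Red.F2 {E : Finset (Sym2 V)} (hnd : ∀ e ∈ E, ¬ e.IsDiag) (hr : Red E) :
    ∀ (n : ℕ) (S : Finset V), S.card = n → 2 ≤ S.card → nE E S + 4 = 2 * S.card → K2t E S := by
  intro n
  induction n using Nat.strong_induction_on with
  | _ n ih =>
  intro S hSn hS2 hS
  by_cases hc2 : S.card = 2
  · obtain ⟨u, w, huw, rfl⟩ := Finset.card_eq_two.1 hc2
    refine ⟨u, by simp, w, by simp, huw, ?_, ?_⟩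
    · intro h
      have : 0 < nE E {u, w} := Finset.card_pos.2 ⟨s(u, w), by simp [h, In_mk]⟩
      omega
    · intro z hz h1 h2
      simp at hz
      tauto
  have hsum := sum_nb hnd S
  by_cases hc3 : S.card = 3
  · obtain ⟨x, hx, hxd⟩ : ∃ x ∈ S, 2 ≤ (nb E S x).card := by
      by_contra hall
      push Not at hall
      have := Finset.sum_le_card_nsmul S (fun x => (nb E S x).card) 1
        (fun x hx => by have := hall x hx; omega)
      rw [smul_eq_mul] at this
      omega
    have hsub : nb E S x ⊆ S.erase x := fun t ht => Finset.mem_erase.2 ⟨nb_ne hnd ht, nb_sub ht⟩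
    have hce := Finset.card_erase_of_mem hx
    have heq := Finset.eq_of_subset_of_card_le hsub (by omega)
    have h2 : (nb E S x).card = 2 := by rw [heq]; omega
    refine hr.ext2 hnd hx h2 (ih _ (by omega) _ rfl (by omega) ?_)
    have := nE_erase hnd hx
    omega
  have hdeg2 : ∀ x ∈ S, 2 ≤ (nb E S x).card := by
    intro x hx
    have h1 := nE_erase hnd hx
    have h2 := Finset.card_erase_of_mem hx
    have h3 := hr.F1 hnd _ (S.erase x) rfl (by omega)
    omega
  by_cases hx2 : ∃ x ∈ S, (nb E S x).card = 2
  · obtain ⟨x, hx, h2⟩ := hx2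
    have hce := Finset.card_erase_of_mem hx
    refine hr.ext2 hnd hx h2 (ih _ (by omega) _ rfl (by omega) ?_)
    have := nE_erase hnd hx
    omega
  exfalso
  push Not at hx2
  obtain ⟨v, hvS, w, hwS, hvw, hn, hv3, hw3, hcom⟩ := hr.exists_pair hnd hS (by
    intro x hx
    have := hdeg2 x hx
    have := hx2 x hx
    omega)
  have hn' : s(w, v) ∉ E := by rwa [Sym2.eq_swap]
  have hZS : ({v, w} : Finset V) ⊆ S := by
    intro t ht
    simp at ht
    rcases ht with rfl | rfl
    · exact hvS
    · exact hwS
  have hZ2 : ({v, w} : Finset V).card = 2 := Finset.card_pair hvw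
  have hcs : (S \ {v, w}).card = S.card - 2 := by
    rw [Finset.card_sdiff_of_subset hZS, hZ2]
  have hne : (S \ {v, w}).Nonempty := Finset.card_pos.1 (by omega)
  have hES : ∀ e ∈ E.filter (In S), In S e := fun e he => (Finset.mem_filter.1 he).2
  have hE'E : E.filter (In S) ⊆ E := Finset.filter_subset _ _
  have hCd : ∀ C ⊆ S \ {v, w}, v ∉ C ∧ w ∉ C ∧ (C ∪ {v, w}).card = C.card + 2 := by
    intro C hC
    have h1 : v ∉ C := fun h => (Finset.mem_sdiff.1 (hC h)).2 (by simp)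
    have h2 : w ∉ C := fun h => (Finset.mem_sdiff.1 (hC h)).2 (by simp)
    refine ⟨h1, h2, ?_⟩
    rw [Finset.card_union_of_disjoint, hZ2]
    simp [h1, h2]
  have hC1 : ∀ C ⊆ S \ {v, w}, C.Nonempty → nE E (C ∪ {v, w}) + 4 ≤ 2 * (C.card + 2) := by
    intro C hC hCne
    have h1 := (hCd C hC).2.2
    have h2 := Finset.card_pos.2 hCne
    have h3 := hr.F1 hnd _ (C ∪ {v, w}) rfl (by omega)
    omega
  have hCK : ∀ C ⊆ S \ {v, w}, C.Nonempty → (∃ z ∈ S \ {v, w}, z ∉ C) →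
      nE (E.filter (In S)) (C ∪ {v, w}) = 2 * C.card → ∃ c ∈ C, s(v, c) ∈ E ∧ s(w, c) ∈ E := by
    rintro C hC hCne ⟨z, hz, hzC⟩ ht
    have h1 := (hCd C hC)
    have h2 := hC1 C hC hCne
    have h3 := nE_mono hE'E (C ∪ {v, w})
    have h4 : C.card < (S \ {v, w}).card :=
      Finset.card_lt_card (Finset.ssubset_iff_subset_ne.2 ⟨hC, by rintro rfl; exact hzC hz⟩)
    exact K2t.common hCne h1.1 h1.2.1 hvw hn (ih _ (by omega) (C ∪ {v, w}) rfl (by omega) (by omega))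
  obtain ⟨T, F, g1, g2, g3, g4, g5, g6⟩ := decomp (S := S) (Z := {v, w}) (E := E.filter (In S)) hZS
    (by omega) hES
    (by
      intro e he
      have he' := hE'E he
      have hd := hnd e he'
      induction e using Sym2.ind with
      | _ a b =>
        by_contra hcon
        push Not at hcon
        have ha := hcon a (by simp)
        have hb := hcon b (by simp)
        simp only [Finset.mem_insert, Finset.mem_singleton] at ha hb
        rcases ha with rfl | rfl <;> rcases hb with rfl | rfl
        · exact hd (by simp)
        · exact hn he'
        · exact hn' he'
        · exact hd (by simp))
    (hr.h1 hnd hE'E)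
    (by
      intro _ C hC hCne
      have := hC1 C hC hCne
      have h3 := nE_mono hE'E (C ∪ {v, w})
      omega)
    (by
      intro _ C hC hCne C' hC' hCne' hdis ht ht'
      obtain ⟨y, hy⟩ := hCne
      obtain ⟨y', hy'⟩ := hCne'
      obtain ⟨c, hc, hc1, hc2⟩ := hCK C hC ⟨y, hy⟩
        ⟨y', hC' hy', fun h => Finset.disjoint_left.1 hdis h hy'⟩ ht
      obtain ⟨c', hc', hc1', hc2'⟩ := hCK C' hC' ⟨y', hy'⟩
        ⟨y, hC hy, fun h => Finset.disjoint_left.1 hdis hy h⟩ ht'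
      have m1 : c ∈ nb E S v ∩ nb E S w := by
        have := (Finset.mem_sdiff.1 (hC hc)).1
        exact Finset.mem_inter.2 ⟨mem_nb.2 ⟨this, hc1⟩, mem_nb.2 ⟨this, hc2⟩⟩
      have m2 : c' ∈ nb E S v ∩ nb E S w := by
        have := (Finset.mem_sdiff.1 (hC' hc')).1
        exact Finset.mem_inter.2 ⟨mem_nb.2 ⟨this, hc1'⟩, mem_nb.2 ⟨this, hc2'⟩⟩
      have := Finset.card_le_one.1 hcom c m1 c' m2
      subst this
      exact Finset.disjoint_left.1 hdis hc hc')
    hne (by unfold nE at *; omega)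
  have hD := mkDec (fun e he => hnd e (hE'E he)) hZS hES hne g1 g2 g3 g4 g5 g6
  obtain ⟨a, ha, haN⟩ := exists_star g1 g5 hvS (by simp) hv3
  obtain ⟨b, hb, hbN⟩ := exists_star g1 g5 hwS (by simp) hw3
  have hc := hD.coll2 hvw ha hb (by
    intro i
    refine Finset.mem_sdiff.2 ⟨nb_sub (haN i), ?_⟩
    rw [Finset.mem_insert, Finset.mem_singleton, not_or]
    refine ⟨nb_ne hnd (haN i), fun h => ?_⟩
    have := (mem_nb.1 (haN i)).2
    rw [h] at this
    exact hn this) (by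
    intro i
    refine Finset.mem_sdiff.2 ⟨nb_sub (hbN i), ?_⟩
    rw [Finset.mem_insert, Finset.mem_singleton, not_or]
    refine ⟨fun h => ?_, nb_ne hnd (hbN i)⟩
    have := (mem_nb.1 (hbN i)).2
    rw [h] at this
    exact hn' this)
  rw [g1] at hc
  exact hr S hS2 (hc.mono hE'E)

end RG

namespace RG
variable {V : Type} [Fintype V]

theorem Cn.reach {S : Finset V} {Γ : Finset (Sym2 V)} (h : Cn S Γ) {E' : Multiset (Sym2 V)}
    (hE : ∀ e ∈ Γ, e ∈ E') : ∀ u ∈ S, ∀ v ∈ S,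
      Relation.ReflTransGen (fun a b => s(a, b) ∈ E') u v := by
  intro u hu v hv
  have hφ : (fun z => iv (Relation.ReflTransGen (fun a b => s(a, b) ∈ E') u z)) ∈ Pot Γ := by
    intro a b hab
    apply iv_congr
    constructor
    · intro h1
      exact h1.tail (hE _ hab)
    · intro h1
      refine h1.tail ?_
      rw [Sym2.eq_swap]
      exact hE _ hab
  have h1 := h _ hφ u hu v hv
  beta_reduce at h1
  rw [iv_true Relation.ReflTransGen.refl] at h1
  by_contra hcon
  rw [iv_false hcon] at h1
  exact absurd h1 (by decide)

theorem degIn_replicate (e : Sym2 V) (k : ℕ) {x : V} (hx : x ∈ e) :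
    Multigraph.degIn (Multiset.replicate k e) x = k := by
  unfold Multigraph.degIn
  rw [Multiset.filter_eq_self.2, Multiset.card_replicate]
  intro f hf
  rw [Multiset.eq_of_mem_replicate hf]
  exact hx

theorem nodup_of_reduced (G : Multigraph V) (hred : G.Reduced) : G.edges.Nodup := by
  rw [Multiset.nodup_iff_count_le_one]
  intro e
  by_contra hcon
  push Not at hcon
  have hle : Multiset.replicate 2 e ≤ G.edges := Multiset.le_count_iff_replicate_le.1 hcon
  have he : e ∈ G.edges := Multiset.count_pos.1 (by omega)
  have hd := G.loopless e he
  induction e using Sym2.ind with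
  | _ a b =>
  have hab : a ≠ b := by simpa using hd
  have hW : ∀ k, Multigraph.Within ({a, b} : Set V) (Multiset.replicate k s(a, b)) := by
    intro k f hf v hv
    rw [Multiset.eq_of_mem_replicate hf, Sym2.mem_iff] at hv
    simpa using hv
  have hC : ∀ k, 0 < k → Multigraph.ConnOn ({a, b} : Set V) (Multiset.replicate k s(a, b)) := by
    intro k hk
    refine ⟨⟨a, by simp⟩, hW k, ?_⟩
    have hm : s(a, b) ∈ Multiset.replicate k s(a, b) := Multiset.mem_replicate.2 ⟨by omega, rfl⟩
    have hm' : s(b, a) ∈ Multiset.replicate k s(a, b) := by rw [Sym2.eq_swap (a := b)]; exact hm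
    rintro u (rfl | rfl) v (rfl | rfl)
    · exact Relation.ReflTransGen.refl
    · exact Relation.ReflTransGen.single hm
    · exact Relation.ReflTransGen.single hm'
    · exact Relation.ReflTransGen.refl
  have h1 := hred {a, b} (Multiset.replicate 2 s(a, b)) ⟨hle, hW 2⟩ (by
    refine ⟨⟨a, by simp⟩, hW 2, ?_⟩
    intro R hR hRf hRe
    have hmem : ∀ x ∈ ({a, b} : Set V), x ∈ s(a, b) := by
      intro x hx; simpa using hx
    by_cases ha : a ∈ R
    · by_cases hb : b ∈ R
      · refine ⟨Multiset.replicate 1 s(a, b),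
          (Multiset.replicate_le_replicate _).2 (by norm_num), hC 1 (by norm_num), ?_⟩
        intro x hx
        rw [degIn_replicate _ _ (hmem x hx)]
        rcases hx with rfl | rfl
        · simpa using ha
        · simpa using hb
      · exfalso
        have : R = {a} := by
          ext x
          constructor
          · intro hx
            rcases hR hx with rfl | rfl
            · rfl
            · exact (hb hx).elim
          · rintro rfl; exact ha
        rw [this, Set.ncard_singleton] at hRe
        exact absurd hRe (by decide)
    · by_cases hb : b ∈ R
      · exfalso
        have : R = {b} := by
          ext x
          constructor
          · intro hx
            rcases hR hx with rfl | rfl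
            · exact (ha hx).elim
            · rfl
          · rintro rfl; exact hb
        rw [this, Set.ncard_singleton] at hRe
        exact absurd hRe (by decide)
      · refine ⟨Multiset.replicate 2 s(a, b), le_refl _, hC 2 (by norm_num), ?_⟩
        intro x hx
        rw [degIn_replicate _ _ (hmem x hx)]
        have h2 : ¬ Odd 2 := by decide
        rcases hx with rfl | rfl
        · exact ⟨fun h => (h2 h).elim, fun h => (ha h).elim⟩
        · exact ⟨fun h => (h2 h).elim, fun h => (hb h).elim⟩)
  rw [Set.ncard_pair hab] at h1
  omega

theorem degIn_val (Γ : Finset (Sym2 V)) (x : V) :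
    Multigraph.degIn Γ.val x = (Γ.filter (fun e => x ∈ e)).card := by
  unfold Multigraph.degIn
  rw [Finset.card_def, Finset.filter_val]

theorem dg_odd (Γ : Finset (Sym2 V)) (x : V) :
    Odd (Multigraph.degIn Γ.val x) ↔ dg Γ x = 1 := by
  rw [degIn_val, ← ZMod.natCast_eq_one_iff_odd, Finset.card_filter]
  unfold dg
  push_cast
  have : ∀ e : Sym2 V, iv (x ∈ e) = if x ∈ e then (1 : ZMod 2) else 0 := by
    intro e
    by_cases h : x ∈ e
    · rw [iv_true h, if_pos h]
    · rw [iv_false h, if_neg h]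
  simp only [this]

theorem red_of_reduced (G : Multigraph V) (hred : G.Reduced) : Red G.edges.toFinset := by
  intro S hS hcoll
  have hnd := nodup_of_reduced G hred
  have hW : ∀ Γ : Finset (Sym2 V), (∀ e ∈ Γ, In S e) → Multigraph.Within (↑S : Set V) Γ.val := by
    intro Γ h e he v hv
    exact h e he v hv
  have h1 := hred (↑S) (G.edges.toFinset.filter (In S)).val ⟨?_, ?_⟩ ⟨?_, ?_, ?_⟩
  · rw [Set.ncard_coe_finset] at h1
    omega
  · rw [Multiset.le_iff_subset (Finset.nodup _)]
    intro e he
    exact Multiset.mem_toFinset.1 (Finset.mem_filter.1 he).1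
  · exact hW _ (fun e he => (Finset.mem_filter.1 he).2)
  · exact Finset.coe_nonempty.2 (Finset.card_pos.1 (by omega))
  · exact hW _ (fun e he => (Finset.mem_filter.1 he).2)
  · intro R hR hRf hRe
    obtain ⟨R', rfl⟩ := hRf.exists_finset_coe
    rw [Set.ncard_coe_finset] at hRe
    obtain ⟨Γ, hΓ, hΓS, hΓc, hΓd⟩ := hcoll R' (Finset.coe_subset.1 hR) hRe
    refine ⟨Γ.val, ?_, ⟨?_, hW Γ hΓS, ?_⟩, ?_⟩
    · exact Finset.val_le_iff.2 (fun e he => Finset.mem_filter.2 ⟨hΓ he, hΓS e he⟩)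
    · exact Finset.coe_nonempty.2 (Finset.card_pos.1 (by omega))
    · exact hΓc.reach (fun e he => he)
    · intro x hx
      rw [dg_odd, hΓd x hx, Finset.mem_coe]
      by_cases h : x ∈ R'
      · rw [iv_true h]; simp [h]
      · rw [iv_false h]; simp [h]

theorem rk_univ_le [Nonempty V] (A : Finset (Sym2 V)) : rk A + 1 ≤ Fintype.card V := by
  have h1 : (fun _ => 1 : V → ZMod 2) ∈ Pot A := fun _ _ _ => rfl
  haveI : Nontrivial (Pot A) := by
    refine ⟨⟨⟨_, h1⟩, 0, ?_⟩⟩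
    intro h
    have h2 := congrFun (congrArg Subtype.val h) (Classical.arbitrary V)
    exact absurd h2 (by simp)
  have h3 : 0 < Module.finrank (ZMod 2) (Pot A) := Module.finrank_pos
  unfold rk
  omega

theorem fval_eq [Nonempty V] (G : Multigraph V) (hred : G.Reduced)
    (hc : G.edges.card + 5 = 2 * Fintype.card V) : G.FVal = 3 := by
  have hnodup := nodup_of_reduced G hred
  have hr := red_of_reduced G hred
  have hpos : 0 < Fintype.card V := Fintype.card_pos
  have hnd : ∀ e ∈ G.edges.toFinset, ¬ e.IsDiag := fun e he => G.loopless e (Multiset.mem_toFinset.1 he)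
  have hcE : G.edges.toFinset.card = G.edges.card := Multiset.toFinset_card_of_nodup hnodup
  have hval : G.edges.toFinset.val = G.edges := by
    rw [Multiset.toFinset_val, Multiset.dedup_eq_self.2 hnodup]
  have hmem : 3 ∈ {k : ℕ | ∃ Eadd : Multiset (Sym2 V), (∀ e ∈ Eadd, ¬ e.IsDiag) ∧
      Multiset.card Eadd = k ∧ Multigraph.HasTwoDisjointSpanningTrees (G.edges + Eadd)} := by
    obtain ⟨I1, I2, hu, hd, h1, h2⟩ := munion G.edges.toFinset.card G.edges.toFinset rk
      (fun A => rk (A.filter (In (Finset.univ \ ∅)))) rfl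
      rk_isRk (rk_filter_isRk _) (decomp_bound (S := Finset.univ) (Z := ∅) (by simp) (by simp)
        (fun e _ v _ => Finset.mem_univ v)
        (by
          intro e _
          induction e using Sym2.ind with
          | _ a b => exact ⟨a, by simp, by simp⟩)
        (hr.h1 hnd (Finset.Subset.refl _)) (by simp) (by simp))
    have hI2 : I2.filter (In (Finset.univ \ ∅)) = I2 :=
      Finset.filter_true_of_mem (fun e _ v _ => by simp)
    rw [hI2] at h2
    have u1 := rk_univ_le I1
    have u2 := rk_univ_le I2
    obtain ⟨M1, hM1, hM1d, B1, hB1, hB1c⟩ := exists_tree I1 h1 (Fintype.card V - 1 - I1.card) (by omega)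
    obtain ⟨M2, hM2, hM2d, B2, hB2, hB2c⟩ := exists_tree I2 h2 (Fintype.card V - 1 - I2.card) (by omega)
    have hcu := Finset.card_union_of_disjoint hd
    rw [hu] at hcu
    have htree : ∀ (I B : Finset (Sym2 V)) (M : Multiset (Sym2 V)), B.val = I.val + M →
        M.card = Fintype.card V - 1 - I.card → rk I = I.card → Cn Finset.univ B →
        Multigraph.IsSpanningTree B.val := by
      intro I B M hB hM hI hcn
      refine ⟨⟨Set.univ_nonempty, fun _ _ _ _ => Set.mem_univ _, ?_⟩, ?_⟩
      · intro u _ v _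
        exact hcn.reach (fun e he => he) u (Finset.mem_univ _) v (Finset.mem_univ _)
      · have := rk_univ_le I
        rw [hB, Multiset.card_add, Finset.card_val, hM]
        omega
    refine ⟨M1 + M2, ?_, ?_, B1.val, B2.val, ?_, htree I1 B1 M1 hB1 hM1 h1 hB1c,
      htree I2 B2 M2 hB2 hM2 h2 hB2c⟩
    · intro e he
      rcases Multiset.mem_add.1 he with he | he
      · exact hM1d e he
      · exact hM2d e he
    · rw [Multiset.card_add, hM1, hM2]; omega
    · have hvv : I1.val + I2.val = G.edges := by
        rw [← hval, ← hu, ← Finset.disjUnion_eq_union _ _ hd]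
        rfl
      rw [hB1, hB2, ← hvv]
      apply le_of_eq
      abel
  unfold Multigraph.FVal
  apply le_antisymm
  · exact Nat.sInf_le hmem
  · apply le_csInf ⟨3, hmem⟩
    rintro k ⟨Eadd, -, rfl, T1, T2, hle, ⟨-, hT1⟩, ⟨-, hT2⟩⟩
    have := Multiset.card_le_card hle
    rw [Multiset.card_add, Multiset.card_add] at this
    omega

end RG

/-- Lemma 3.2. Let `G` be a connected reduced graph of order `n`, and let
`H` be a spanning bipartite subgraph of `G` with bipartition `{X, Y}` where `|Y| ≥ |X|` and
`d_H(v) ≥ 3` for every `v ∈ Y`.  If `|X| ≤ (n + 5)/3`, then `G = H` and `F(G) = 3`. -/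
theorem statement3 {V : Type} [Fintype V] (G : Multigraph V)
    (hconn : G.Connected) (hred : G.Reduced)
    (X Y : Finset V) (EH : Multiset (Sym2 V))
    (hsub : EH ≤ G.edges)
    (hbip : Multigraph.IsBipartition X Y EH)
    (hXY : X.card ≤ Y.card)
    (hdeg : ∀ y ∈ Y, 3 ≤ Multigraph.degIn EH y)
    (hX : (X.card : ℝ) ≤ ((Fintype.card V : ℝ) + 5) / 3) :
    G.edges = EH ∧ G.FVal = 3 := by
  obtain ⟨hdisj, hcov, hbi⟩ := hbip
  obtain ⟨⟨v0, -⟩, -, -⟩ := hconn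
  haveI : Nonempty V := ⟨v0⟩
  have hnodup := RG.nodup_of_reduced G hred
  have hr := RG.red_of_reduced G hred
  have hnd : ∀ e ∈ G.edges.toFinset, ¬ e.IsDiag :=
    fun e he => G.loopless e (Multiset.mem_toFinset.1 he)
  have hHnd : EH.Nodup := Multiset.nodup_of_le hsub hnodup
  have hcE : G.edges.toFinset.card = G.edges.card := Multiset.toFinset_card_of_nodup hnodup
  have hcH : EH.toFinset.card = EH.card := Multiset.toFinset_card_of_nodup hHnd
  have hvalH : EH.toFinset.val = EH := by
    rw [Multiset.toFinset_val, Multiset.dedup_eq_self.2 hHnd]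
  have hHE : EH.toFinset ⊆ G.edges.toFinset := by
    intro e he
    exact Multiset.mem_toFinset.2 (Multiset.mem_of_le hsub (Multiset.mem_toFinset.1 he))
  have hn : X.card + Y.card = Fintype.card V := by
    rw [← Finset.card_union_of_disjoint hdisj, hcov, Finset.card_univ]
  have hX' : 3 * X.card ≤ Fintype.card V + 5 := by
    have : 3 * (X.card : ℝ) ≤ (Fintype.card V : ℝ) + 5 := by linarith
    exact_mod_cast this
  have hdegF : ∀ y ∈ Y, 3 ≤ (EH.toFinset.filter (fun e => y ∈ e)).card := by
    intro y hy
    rw [← RG.degIn_val, hvalH]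
    exact hdeg y hy
  have hYne : Y.Nonempty := by
    apply Finset.card_pos.1
    have : 0 < Fintype.card V := Fintype.card_pos
    omega
  have hX3 : 3 ≤ X.card := by
    obtain ⟨y, hy⟩ := hYne
    have hs : EH.toFinset.filter (fun e => y ∈ e) ⊆ X.image (fun x => s(y, x)) := by
      intro e he
      obtain ⟨he, hye⟩ := Finset.mem_filter.1 he
      obtain ⟨⟨a, hae, haX⟩, -⟩ := hbi e (Multiset.mem_toFinset.1 he)
      have hay : y ≠ a := by
        rintro rfl; exact Finset.disjoint_left.1 hdisj haX hy
      refine Finset.mem_image.2 ⟨a, haX, ?_⟩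
      exact ((Sym2.mem_and_mem_iff hay).1 ⟨hye, hae⟩).symm
    exact (hdegF y hy).trans ((Finset.card_le_card hs).trans Finset.card_image_le)
  have hcount : 3 * Y.card ≤ EH.card := by
    have hdj : Set.PairwiseDisjoint (↑Y) (fun y => EH.toFinset.filter (fun e => y ∈ e)) := by
      intro y hy y' hy' hne
      rw [Function.onFun, Finset.disjoint_left]
      intro e he he'
      obtain ⟨he, hye⟩ := Finset.mem_filter.1 he
      obtain ⟨-, hye'⟩ := Finset.mem_filter.1 he'
      obtain ⟨⟨a, hae, haX⟩, -⟩ := hbi e (Multiset.mem_toFinset.1 he)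
      rw [(Sym2.mem_and_mem_iff hne).1 ⟨hye, hye'⟩, Sym2.mem_iff] at hae
      rcases hae with rfl | rfl
      · exact Finset.disjoint_left.1 hdisj haX hy
      · exact Finset.disjoint_left.1 hdisj haX hy'
    have h1 := Finset.card_biUnion hdj
    have h2 : (Y.biUnion fun y => EH.toFinset.filter (fun e => y ∈ e)).card ≤ EH.toFinset.card :=
      Finset.card_le_card (Finset.biUnion_subset.2 fun y _ => Finset.filter_subset _ _)
    have h3 := Finset.card_nsmul_le_sum Y _ 3 hdegF
    rw [smul_eq_mul] at h3
    omega
  have hleE := Multiset.card_le_card hsub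
  have hnE : RG.nE G.edges.toFinset Finset.univ = G.edges.card := by
    unfold RG.nE
    rw [Finset.filter_true_of_mem (fun e _ v _ => Finset.mem_univ v), hcE]
  have hF1 := hr.F1 hnd _ Finset.univ rfl (by rw [Finset.card_univ]; omega)
  rw [hnE, Finset.card_univ] at hF1
  have hne4 : G.edges.card + 4 ≠ 2 * Fintype.card V := by
    intro h4
    obtain ⟨u, -, w, -, huw, -, hL⟩ := hr.F2 hnd _ Finset.univ rfl
      (by rw [Finset.card_univ]; omega) (by rw [hnE, Finset.card_univ]; exact h4)
    have hlt : ({u, w} : Finset V).card < Y.card := by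
      rw [Finset.card_pair huw]; omega
    obtain ⟨y, hy, hy'⟩ := Finset.exists_mem_notMem_of_card_lt_card hlt
    rw [Finset.mem_insert, Finset.mem_singleton, not_or] at hy'
    have hNy := hL y (Finset.mem_univ _) hy'.1 hy'.2
    have hs : EH.toFinset.filter (fun e => y ∈ e) ⊆
        (RG.nb G.edges.toFinset Finset.univ y).image (fun x => s(y, x)) := by
      intro e he
      obtain ⟨he, hye⟩ := Finset.mem_filter.1 he
      obtain ⟨z, rfl⟩ := Sym2.mem_iff_exists.1 hye
      exact Finset.mem_image.2 ⟨z, RG.mem_nb.2 ⟨Finset.mem_univ _, hHE he⟩, rfl⟩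
    have h5 := (hdegF y hy).trans ((Finset.card_le_card hs).trans Finset.card_image_le)
    rw [hNy, Finset.card_pair huw] at h5
    omega
  refine ⟨(Multiset.eq_of_le_of_card_le hsub (by omega)).symm, RG.fval_eq G hred (by omega)⟩
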